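/- Let D ≥ 1, let x = (x_1,…,x_n) and y = (y_1,…,y_t), let s ≤ n, and set 𝒟 = 2(n+s)·D^s·(D−1)^{n−s+1}·C(n,s). There exists a nonempty Zariski open subset 𝓕 of the space ℂ[x,y]_{≤D}^s of s-tuples of polynomials of total degree at most D such that for every f = (f_1,…,f_s) ∈ 𝓕 with coefficients in ℚ, there exists a semi-algebraic formula Φ involving only polynomials of ℚ[y] of degree at most 𝒟 whose solution set Z(Φ) ⊂ ℝ^t is a dense subset of the interior of π(V(f) ∩ ℝ^{t+n}). -/

import Mathlib

open MvPolynomial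

noncomputable section

/-- The common zero locus in `F^σ` of a set of polynomials. -/
def zLocus {σ F : Type*} [CommSemiring F] (S : Set (MvPolynomial σ F)) : Set (σ → F) :=
  {x | ∀ p ∈ S, eval x p = 0}

/-- The vanishing ideal of a subset of `F^σ`. -/
def vIdeal {σ F : Type*} [CommRing F] (V : Set (σ → F)) : Ideal (MvPolynomial σ F) where
  carrier := {p | ∀ x ∈ V, eval x p = 0}
  add_mem' := by
    intro p q hp hq x hx
    simp [hp x hx, hq x hx]
  zero_mem' := by intro x hx; simp
  smul_mem' := by
    intro c p hp x hx
    simp [smul_eq_mul, hp x hx]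

/-- The dimension of an algebraic set, as the Krull dimension of its coordinate ring. -/
def setDim {σ : Type*} (V : Set (σ → ℂ)) : WithBot (WithTop ℕ) :=
  ringKrullDim (MvPolynomial σ ℂ ⧸ vIdeal V)

/-- An ideal is equidimensional of dimension `d` if every minimal prime over it has
quotient of Krull dimension `d`. -/
def EquidimIdeal {R : Type*} [CommRing R] (I : Ideal R) (d : ℕ) : Prop :=
  ∀ P ∈ I.minimalPrimes, ringKrullDim (R ⧸ P) = (d : WithBot (WithTop ℕ))

/-- Differential at a point `p₀` of the polynomial `g`, applied to the vector `v`. -/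
def polyDiff {σ : Type*} [Fintype σ] [DecidableEq σ] (p₀ : σ → ℂ) (g : MvPolynomial σ ℂ)
    (v : σ → ℂ) : ℂ :=
  ∑ j, v j * eval p₀ (pderiv j g)

/-- The Zariski tangent space of `V` at `p₀`. -/
def tangentAt {σ : Type*} [Fintype σ] [DecidableEq σ] (V : Set (σ → ℂ)) (p₀ : σ → ℂ) :
    Submodule ℂ (σ → ℂ) where
  carrier := {v | ∀ g ∈ vIdeal V, polyDiff p₀ g v = 0}
  add_mem' := by
    intro a b ha hb g hg
    have h1 := ha g hg
    have h2 := hb g hg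
    simp only [polyDiff, Pi.add_apply, add_mul, Finset.sum_add_distrib] at *
    simp [h1, h2]
  zero_mem' := by intro g hg; simp [polyDiff]
  smul_mem' := by
    intro c a ha g hg
    have h1 := ha g hg
    simp only [polyDiff, Pi.smul_apply, smul_eq_mul, mul_assoc, ← Finset.mul_sum] at *
    simp [h1]

/-- The singular locus of `V`, relative to the expected dimension `d`:
points of `V` where the Zariski tangent space does not have dimension `d`. -/
def singLocus {σ : Type*} [Fintype σ] [DecidableEq σ] (V : Set (σ → ℂ)) (d : ℕ) :
    Set (σ → ℂ) :=
  {p | p ∈ V ∧ Module.finrank ℂ (tangentAt V p) ≠ d}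

/-- Critical points of the polynomial map with components `φ` restricted to the
nonsingular locus of `V` (`V` of expected dimension `d`). -/
def critMap {σ : Type*} [Fintype σ] [DecidableEq σ] {ι : Type*}
    (V : Set (σ → ℂ)) (d : ℕ) (φ : ι → MvPolynomial σ ℂ) : Set (σ → ℂ) :=
  {p | p ∈ V ∧ p ∉ singLocus V d ∧
    ¬ Function.Surjective (fun v : tangentAt V p => fun k : ι => polyDiff p (φ k) v)}

/-- The components of the projection on the first `i` coordinates, as polynomials. -/
def projPoly (n i : ℕ) : Fin i → MvPolynomial (Fin n) ℂ :=
  fun k => if h : (k : ℕ) < n then X ⟨k, h⟩ else 0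

/-- Critical locus of the projection to the first `i` coordinates restricted to `V`,
with the convention that for `i = d+1` it is all of `V`. -/
def critProj {n : ℕ} (V : Set (Fin n → ℂ)) (d i : ℕ) : Set (Fin n → ℂ) :=
  if i = d + 1 then V else critMap V d (projPoly n i)

/-- Projection of `ℂ^n` to the first `i` coordinates. -/
def projMap (n i : ℕ) (x : Fin n → ℂ) : Fin i → ℂ :=
  fun k => if h : (k : ℕ) < n then x ⟨k, h⟩ else 0

/-- `φ` restricted to `V` is proper at `β` (Euclidean topology). -/
def ProperAt {n i : ℕ} (φ : (Fin n → ℂ) → Fin i → ℂ) (V : Set (Fin n → ℂ))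
    (β : Fin i → ℂ) : Prop :=
  ∃ O : Set (Fin i → ℂ), IsOpen O ∧ β ∈ O ∧ IsCompact {x | x ∈ V ∧ φ x ∈ closure O}

/-- `φ` restricted to `V` is a proper map (onto its image). -/
def ProperOn {n i : ℕ} (φ : (Fin n → ℂ) → Fin i → ℂ) (V : Set (Fin n → ℂ)) : Prop :=
  ∀ β ∈ φ '' V, ProperAt φ V β

/-- Zariski open subsets of `F^k`: complements of zero loci of sets of polynomials. -/
def IsZariskiOpen {k : ℕ} {F : Type*} [CommSemiring F] (U : Set (Fin k → F)) : Prop :=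
  ∃ S : Set (MvPolynomial (Fin k) F), U = {x | ∃ p ∈ S, eval x p ≠ 0}

/-- Zariski open subsets of the space of `n × n` matrices over `F`. -/
def IsZariskiOpenMat {n : ℕ} {F : Type*} [CommSemiring F]
    (U : Set (Matrix (Fin n) (Fin n) F)) : Prop :=
  ∃ S : Set (MvPolynomial (Fin n × Fin n) F),
    U = {A | ∃ p ∈ S, eval (fun q => A q.1 q.2) p ≠ 0}

/-- Complexification of a rational polynomial. -/
def toC {σ : Type*} (p : MvPolynomial σ ℚ) : MvPolynomial σ ℂ :=
  MvPolynomial.map (algebraMap ℚ ℂ) p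

/-- The change of variables `x ↦ A·x` acting on the `x`-variables only
(the `y`-variables are left invariant). -/
def chgX {n t : ℕ} {F : Type*} [CommRing F] (A : Matrix (Fin n) (Fin n) F)
    (p : MvPolynomial (Fin n ⊕ Fin t) F) : MvPolynomial (Fin n ⊕ Fin t) F :=
  aeval (Sum.elim (fun j => ∑ k, C (A j k) * X (Sum.inl k)) (fun l => X (Sum.inr l))) p

/-- Specialization of the `y`-variables at the point `η`. -/
def specY {n t : ℕ} {F : Type*} [CommRing F] (η : Fin t → F)
    (p : MvPolynomial (Fin n ⊕ Fin t) F) : MvPolynomial (Fin n) F :=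
  aeval (Sum.elim X (fun l => C (η l))) p

/-- Jacobian matrix w.r.t. the `x`-variables, evaluated at a point `z ∈ ℂ^{n+t}`. -/
def jacXAt {n t s : ℕ} (f : Fin s → MvPolynomial (Fin n ⊕ Fin t) ℂ)
    (z : (Fin n ⊕ Fin t) → ℂ) : Matrix (Fin s) (Fin n) ℂ :=
  Matrix.of fun i j => eval z (pderiv (Sum.inl j) (f i))

/-- Symbolic Jacobian matrix of a polynomial system in the variables `x`. -/
def jacPoly {n s : ℕ} {F : Type*} [CommRing F] (g : Fin s → MvPolynomial (Fin n) F) :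
    Matrix (Fin s) (Fin n) (MvPolynomial (Fin n) F) :=
  Matrix.of fun i j => pderiv j (g i)

/-- Symbolic Jacobian matrix w.r.t. the `x`-variables of a system in variables `(x,y)`. -/
def jacPolyX {n t s : ℕ} {F : Type*} [CommRing F]
    (f : Fin s → MvPolynomial (Fin n ⊕ Fin t) F) :
    Matrix (Fin s) (Fin n) (MvPolynomial (Fin n ⊕ Fin t) F) :=
  Matrix.of fun i j => pderiv (Sum.inl j) (f i)

/-- The set of `k`-minors of `M` using only columns of index `≥ i` (0-indexed). -/
def minorsGE {s n : ℕ} {R : Type*} [CommRing R] (M : Matrix (Fin s) (Fin n) R)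
    (k i : ℕ) : Set R :=
  {q | ∃ (r : Fin k → Fin s) (c : Fin k → Fin n), Function.Injective r ∧
        Function.Injective c ∧ (∀ l, i ≤ (c l : ℕ)) ∧ q = (M.submatrix r c).det}

/-- Semi-algebraic formulas over `ℚ[y_1,…,y_t]`: boolean combinations of polynomial
sign conditions. -/
inductive SAForm (t : ℕ) : Type
  | eq (p : MvPolynomial (Fin t) ℚ) : SAForm t
  | pos (p : MvPolynomial (Fin t) ℚ) : SAForm t
  | nonneg (p : MvPolynomial (Fin t) ℚ) : SAForm t
  | ne (p : MvPolynomial (Fin t) ℚ) : SAForm t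
  | conj (φ ψ : SAForm t) : SAForm t
  | disj (φ ψ : SAForm t) : SAForm t
  | neg (φ : SAForm t) : SAForm t

/-- Truth value of a semi-algebraic formula at a point of `ℝ^t`. -/
def SAForm.holds {t : ℕ} : SAForm t → (Fin t → ℝ) → Prop
  | eq p, y => aeval y p = 0
  | pos p, y => 0 < aeval y p
  | nonneg p, y => 0 ≤ aeval y p
  | ne p, y => aeval y p ≠ 0
  | conj φ ψ, y => φ.holds y ∧ ψ.holds y
  | disj φ ψ, y => φ.holds y ∨ ψ.holds y
  | neg φ, y => ¬ φ.holds y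

/-- The maximal total degree of the polynomials involved in a semi-algebraic formula. -/
def SAForm.deg {t : ℕ} : SAForm t → ℕ
  | eq p => p.totalDegree
  | pos p => p.totalDegree
  | nonneg p => p.totalDegree
  | ne p => p.totalDegree
  | conj φ ψ => max φ.deg ψ.deg
  | disj φ ψ => max φ.deg ψ.deg
  | neg φ => φ.deg

/-- The solution set `Z(Φ) ⊆ ℝ^t` of a semi-algebraic formula. -/
def SAForm.zset {t : ℕ} (φ : SAForm t) : Set (Fin t → ℝ) := {y | φ.holds y}

/-- The real points of the variety defined by a rational system in variables `(x, y)`. -/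
def realPts {n t s : ℕ} (f : Fin s → MvPolynomial (Fin n ⊕ Fin t) ℚ) :
    Set ((Fin n ⊕ Fin t) → ℝ) :=
  {z | ∀ i, aeval z (f i) = 0}

/-- The real zero set of a set of rational polynomials. -/
def realZeros {σ : Type*} (S : Set (MvPolynomial σ ℚ)) : Set (σ → ℝ) :=
  {z | ∀ p ∈ S, aeval z p = 0}

/-- The projection `(x, y) ↦ y` on real points. -/
def projY {n t : ℕ} (z : (Fin n ⊕ Fin t) → ℝ) : Fin t → ℝ := z ∘ Sum.inr

/-- The projection `(x, y) ↦ y` on complex points. -/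
def projYC {n t : ℕ} (z : (Fin n ⊕ Fin t) → ℂ) : Fin t → ℂ := z ∘ Sum.inr

/-- The complex algebraic set defined by a rational polynomial system. -/
def VC {n t s : ℕ} (f : Fin s → MvPolynomial (Fin n ⊕ Fin t) ℚ) :
    Set ((Fin n ⊕ Fin t) → ℂ) :=
  zLocus (Set.range fun i => toC (f i))

/-- Assumption A: the ideal generated by `f` is radical, and its algebraic set is
(nonempty) equidimensional of dimension `d + t` with singular locus of dimension `< t`. -/
def AssumpA {n t s : ℕ} (f : Fin s → MvPolynomial (Fin n ⊕ Fin t) ℚ) (d : ℕ) : Prop :=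
  (Ideal.span (Set.range f)).IsRadical ∧
  (VC f).Nonempty ∧
  EquidimIdeal (vIdeal (VC f)) (d + t) ∧
  setDim (singLocus (VC f) (d + t)) < (t : WithBot (WithTop ℕ))

/-- Assumption B: the Zariski closure of `π(V)` is all of `ℂ^t` (no nonzero polynomial
vanishes on `π(V)`), and `π(V ∩ ℝ^{t+n})` has nonzero Lebesgue measure. -/
def AssumpB {n t s : ℕ} (f : Fin s → MvPolynomial (Fin n ⊕ Fin t) ℚ) : Prop :=
  (∀ p : MvPolynomial (Fin t) ℂ, (∀ z ∈ VC f, eval (projYC z) p = 0) → p = 0) ∧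
  MeasureTheory.volume (projY '' realPts f) ≠ 0

/-- The conclusion of Lemma (B-param): the system `g` generates a radical
equidimensional ideal whose algebraic set is either empty or smooth of dimension `d`. -/
def GoodSpec {n s : ℕ} (g : Fin s → MvPolynomial (Fin n) ℂ) (d : ℕ) : Prop :=
  (Ideal.span (Set.range g)).IsRadical ∧
  (zLocus (Set.range g) = ∅ ∨
    (EquidimIdeal (Ideal.span (Set.range g)) d ∧ singLocus (zLocus (Set.range g)) d = ∅))

/-- The field `ℚ(y_1, …, y_t)` of rational fractions. -/
abbrev RatFunc' (t : ℕ) : Type := FractionRing (MvPolynomial (Fin t) ℚ)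

/-- View a polynomial of `ℚ[x, y]` as a polynomial of `ℚ(y)[x]`. -/
def toKx {n t : ℕ} (p : MvPolynomial (Fin n ⊕ Fin t) ℚ) :
    MvPolynomial (Fin n) (RatFunc' t) :=
  eval₂ ((C : RatFunc' t →+* MvPolynomial (Fin n) (RatFunc' t)).comp
      ((algebraMap (MvPolynomial (Fin t) ℚ) (RatFunc' t)).comp (C : ℚ →+* MvPolynomial (Fin t) ℚ)))
    (Sum.elim X (fun l => C (algebraMap (MvPolynomial (Fin t) ℚ) (RatFunc' t) (X l)))) p

/-- Extension of a vector of `Fin d` to a function on `ℕ` (by zero). -/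
def extFun {d : ℕ} {F : Type*} [Zero F] (α : Fin d → F) : ℕ → F :=
  fun k => if h : k < d then α ⟨k, h⟩ else 0

/-- The polynomial system `W_i^{A,α}` (over the ground field `F`, the change of
variables being already performed): the input equations, the `(n-d)`-minors of the
truncated Jacobian (except when `i = d+1`), and the equations `x_k = α_k`, `k ≤ i-1`. -/
def Wsys {n s : ℕ} {F : Type*} [CommRing F] (g : Fin s → MvPolynomial (Fin n) F)
    (d i : ℕ) (a : ℕ → F) : Set (MvPolynomial (Fin n) F) :=
  Set.range g ∪ (if i = d + 1 then ∅ else minorsGE (jacPoly g) (n - d) i) ∪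
  {q | ∃ k : Fin n, (k : ℕ) < i - 1 ∧ q = X k - C (a k)}

/-- The polynomial system `W_i^{A,α}` viewed in `ℚ[y][x]` (variables `(x,y)`). -/
def WsysXY {n t s : ℕ} (f : Fin s → MvPolynomial (Fin n ⊕ Fin t) ℚ)
    (d i : ℕ) (a : ℕ → ℚ) : Set (MvPolynomial (Fin n ⊕ Fin t) ℚ) :=
  Set.range f ∪ (if i = d + 1 then ∅ else minorsGE (jacPolyX f) (n - d) i) ∪
  {q | ∃ k : Fin n, (k : ℕ) < i - 1 ∧ q = X (Sum.inl k) - C (a k)}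

/-- A commutative ring is Cohen–Macaulay if, for every maximal ideal `m`, there is a
regular sequence contained in `m` of length the height of `m`. -/
def IsCMRing (R : Type*) [CommRing R] : Prop :=
  ∀ m : Ideal R, ∀ hm : m.IsMaximal, ∃ rs : List R,
    (∀ r ∈ rs, r ∈ m) ∧ RingTheory.Sequence.IsRegular R rs ∧
    (rs.length : WithBot (WithTop ℕ)) = ringKrullDim (@Localization.AtPrime R _ m hm.isPrime)

/-- Homogenization of a polynomial w.r.t. all its variables, using a fresh variable. -/
def homog {σ : Type*} {F : Type*} [CommSemiring F] [DecidableEq σ] (p : MvPolynomial σ F) :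
    MvPolynomial (σ ⊕ Unit) F :=
  p.support.sum fun m =>
    monomial (m.mapDomain Sum.inl +
        Finsupp.single (Sum.inr ()) (p.totalDegree - m.sum fun _ e => e)) (coeff m p)

/-- Zariski open subsets of the space `ℂ[x,y]^s_{≤D}` of `s`-tuples of polynomials of
total degree at most `D`, described by polynomial conditions on the coefficients. -/
def IsZariskiOpenTuple {n t : ℕ} (s D : ℕ)
    (U : Set (Fin s → MvPolynomial (Fin n ⊕ Fin t) ℂ)) : Prop :=
  ∃ S : Set (MvPolynomial (Fin s × ((Fin n ⊕ Fin t) →₀ ℕ)) ℂ),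
    U = {f | (∀ i, (f i).totalDegree ≤ D) ∧
          ∃ p ∈ S, eval (fun im => coeff im.2 (f im.1)) p ≠ 0}

/-- Zariski open subsets of the product of the space of `n×n` complex matrices with `ℂ^n`. -/
def IsZariskiOpenMatVec {n : ℕ}
    (U : Set (Matrix (Fin n) (Fin n) ℂ × (Fin n → ℂ))) : Prop :=
  ∃ S : Set (MvPolynomial ((Fin n × Fin n) ⊕ Fin n) ℂ),
    U = {Aα | ∃ p ∈ S, eval (Sum.elim (fun q => Aα.1 q.1 q.2) Aα.2) p ≠ 0}



namespace HP

/-- A filtration on a commutative ring, indexed by integers. -/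
structure Filt (R : Type*) [CommRing R] where
  w : ℤ → AddSubgroup R
  neg : ∀ k < 0, ∀ a ∈ w k, a = 0
  mono : ∀ i j, i ≤ j → ∀ a ∈ w i, a ∈ w j
  mul : ∀ i j a b, a ∈ w i → b ∈ w j → a * b ∈ w (i + j)
  one : (1 : R) ∈ w 0

section fil
variable {m : ℕ} {R : Type*} [CommRing R] (W : Filt R)

def Fil (m : ℕ) (d : ℤ) : AddSubgroup (MvPolynomial (Fin m) R) where
  carrier := {p | ∀ α, coeff α p ∈ W.w (d - (α.degree : ℤ))}
  add_mem' := by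
    intro a b ha hb α
    rw [coeff_add]; exact add_mem (ha α) (hb α)
  zero_mem' := by intro α; rw [coeff_zero]; exact zero_mem _
  neg_mem' := by
    intro a ha α
    rw [coeff_neg]; exact neg_mem (ha α)

variable {W}

lemma mem_Fil {d : ℤ} {p : MvPolynomial (Fin m) R} :
    p ∈ Fil W m d ↔ ∀ α, coeff α p ∈ W.w (d - (α.degree : ℤ)) := Iff.rfl

lemma Fil_mono {d e : ℤ} (h : d ≤ e) {p : MvPolynomial (Fin m) R} (hp : p ∈ Fil W m d) :
    p ∈ Fil W m e := fun α => W.mono _ _ (by lia) _ (hp α)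

lemma Fil_mul {d e : ℤ} {p q : MvPolynomial (Fin m) R} (hp : p ∈ Fil W m d)
    (hq : q ∈ Fil W m e) : p * q ∈ Fil W m (d + e) := by
  intro α
  classical
  rw [coeff_mul]
  refine sum_mem fun x hx => ?_
  have h := W.mul _ _ _ _ (hp x.1) (hq x.2)
  rw [Finset.HasAntidiagonal.mem_antidiagonal] at hx
  have : α.degree = x.1.degree + x.2.degree := by rw [← hx, map_add]
  rw [this]
  convert h using 2
  push_cast; ring

lemma Fil_monomial {d : ℤ} {α : Fin m →₀ ℕ} {r : R} (h : r ∈ W.w (d - α.degree)) :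
    monomial α r ∈ Fil W m d := by
  intro β
  classical
  rw [coeff_monomial]
  split_ifs with hh
  · rw [← hh]; exact h
  · exact zero_mem _

lemma one_mem_w {k : ℤ} (hk : 0 ≤ k) : (1 : R) ∈ W.w k := W.mono _ _ hk _ W.one

lemma natCast_mem_w {k : ℤ} (hk : 0 ≤ k) (a : ℕ) : (a : R) ∈ W.w k := by
  have := nsmul_mem (one_mem_w (W := W) hk) a
  simpa using this

lemma Fil_C {d : ℤ} {r : R} (h : r ∈ W.w d) : (C r : MvPolynomial (Fin m) R) ∈ Fil W m d := by
  apply Fil_monomial; simpa using h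

lemma Fil_one {d : ℤ} (h : 0 ≤ d) : (1 : MvPolynomial (Fin m) R) ∈ Fil W m d := by
  rw [← C_1]; exact Fil_C (one_mem_w h)

lemma Fil_natCast {d : ℤ} (h : 0 ≤ d) (a : ℕ) : (a : MvPolynomial (Fin m) R) ∈ Fil W m d := by
  have := nsmul_mem (Fil_one (m := m) (W := W) h) a
  simpa using this

lemma Fil_X {d : ℤ} (h : 1 ≤ d) (j : Fin m) : (X j : MvPolynomial (Fin m) R) ∈ Fil W m d := by
  apply Fil_monomial; simp; exact one_mem_w (by lia)

lemma Fil_prod {ι : Type*} (S : Finset ι) (p : ι → MvPolynomial (Fin m) R) (d : ι → ℤ)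
    (h : ∀ i ∈ S, p i ∈ Fil W m (d i)) : ∏ i ∈ S, p i ∈ Fil W m (∑ i ∈ S, d i) := by
  classical
  induction S using Finset.induction_on with
  | empty => simpa using Fil_one le_rfl
  | insert a S ha ih =>
    rw [Finset.prod_insert ha, Finset.sum_insert ha]
    exact Fil_mul (h _ (by simp)) (ih fun i hi => h i (by simp [hi]))

lemma Fil_pow {d : ℤ} {p : MvPolynomial (Fin m) R} (hp : p ∈ Fil W m d) (k : ℕ) :
    p ^ k ∈ Fil W m (k * d) := by
  have := Fil_prod (W := W) (Finset.univ : Finset (Fin k)) (fun _ => p) (fun _ => d)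
    (fun _ _ => hp)
  simpa using this

lemma Fil_pderiv {d : ℤ} {p : MvPolynomial (Fin m) R} (hp : p ∈ Fil W m d) (j : Fin m) :
    pderiv j p ∈ Fil W m (d - 1) := by
  intro α
  rw [coeff_pderiv]
  have h := hp (α + Finsupp.single j 1)
  have h2 := nsmul_mem h (α j + 1)
  rw [nsmul_eq_mul, mul_comm] at h2
  push_cast at h2
  convert h2 using 2
  rw [map_add, Finsupp.degree_single]; push_cast; ring

lemma Fil_det {ι : Type*} [Fintype ι] [DecidableEq ι] {d : ℤ}
    {A : Matrix ι ι (MvPolynomial (Fin m) R)}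
    (h : ∀ i j, A i j ∈ Fil W m d) : A.det ∈ Fil W m (Fintype.card ι * d) := by
  rw [Matrix.det_apply]
  refine sum_mem fun σ _ => ?_
  have := Fil_prod (W := W) Finset.univ (fun i => A (σ i) i) (fun _ => d) (fun i _ => h _ _)
  simp only [Finset.sum_const, Finset.card_univ, nsmul_eq_mul] at this
  rcases Int.units_eq_one_or (Equiv.Perm.sign σ) with hs | hs <;> rw [hs]
  · simpa using this
  · simpa using this

lemma Fil_map {S : Type*} [CommRing S] {W' : Filt S} (ψ : R →+* S)
    (hψ : ∀ k a, a ∈ W.w k → ψ a ∈ W'.w k) {d : ℤ} {p : MvPolynomial (Fin m) R}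
    (hp : p ∈ Fil W m d) : map ψ p ∈ Fil W' m d := by
  intro α; rw [coeff_map]; exact hψ _ _ (hp α)

end fil

/-- trivial filtration -/
def triv (R : Type*) [CommRing R] : Filt R where
  w k := if k < 0 then ⊥ else ⊤
  neg k hk a ha := by simpa [hk] using ha
  mono i j hij a ha := by
    split_ifs at ha ⊢ with h1 h2 h2
    · exact ha
    · lia
    · simp
    · simp
  mul i j a b ha hb := by
    split_ifs at ha hb ⊢ with h1 h2 <;> simp_all
    lia
  one := by simp

lemma triv_mem {R : Type*} [CommRing R] {k : ℤ} {a : R} :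
    a ∈ (triv R).w k ↔ (k < 0 → a = 0) := by
  unfold triv; dsimp; split_ifs with h <;> simp [h]

lemma Fil_triv {R : Type*} [CommRing R] {m : ℕ} {d : ℕ} {p : MvPolynomial (Fin m) R} :
    p ∈ Fil (triv R) m d ↔ p.totalDegree ≤ d := by
  rw [mem_Fil]
  simp_rw [triv_mem]
  constructor
  · intro h
    refine Finset.sup_le fun α hα => ?_
    by_contra hc
    have h1 : (α.sum fun _ e => e) = α.degree := rfl
    exact (mem_support_iff.1 hα) (h α (by lia))
  · intro h α hα
    apply coeff_eq_zero_of_totalDegree_lt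
    have : (∑ i ∈ α.support, α i) = α.degree := rfl
    rw [this]; lia

/-- degree filtration -/
def tdeg (t : ℕ) : Filt (MvPolynomial (Fin t) ℚ) where
  w k :=
    { carrier := {a | a = 0 ∨ (a.totalDegree : ℤ) ≤ k}
      zero_mem' := Or.inl rfl
      add_mem' := by
        rintro a b (rfl | ha) (rfl | hb)
        · left; simp
        · right; simpa using hb
        · right; simpa using ha
        · right
          have := totalDegree_add a b
          lia
      neg_mem' := by
        rintro a (rfl | ha)
        · left; simp
        · right; simpa using ha }
  neg k hk a ha := by
    rcases ha with rfl | ha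
    · rfl
    · lia
  mono i j hij a ha := by
    rcases ha with rfl | ha
    · exact Or.inl rfl
    · exact Or.inr (by lia)
  mul i j a b ha hb := by
    rcases ha with rfl | ha
    · left; simp
    rcases hb with rfl | hb
    · left; simp
    right
    have := totalDegree_mul a b
    lia
  one := by right; simp

lemma tdeg_mem {t : ℕ} {k : ℤ} {a : MvPolynomial (Fin t) ℚ} :
    a ∈ (tdeg t).w k ↔ (a = 0 ∨ (a.totalDegree : ℤ) ≤ k) := Iff.rfl

section gens
variable {m s : ℕ} {R : Type*} [CommRing R] (D : ℕ)

def phi (m : ℕ) (R : Type*) [CommRing R] (D : ℕ) : MvPolynomial (Fin m) R :=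
  ∑ j, (X j ^ D - ((D - 1 : ℕ) : MvPolynomial (Fin m) R) * X j)

abbrev GI (m s : ℕ) := Fin s ⊕ (Fin (s + 1) → Fin m)

def gen (F : Fin s → MvPolynomial (Fin m) R) : GI m s → MvPolynomial (Fin m) R
  | Sum.inl i => F i
  | Sum.inr J => Matrix.det (Matrix.of fun i k => pderiv (J k)
      ((Fin.cons (phi m R D) F : Fin (s + 1) → MvPolynomial (Fin m) R) i))

def gdeg (m s D : ℕ) : GI m s → ℤ
  | Sum.inl _ => D
  | Sum.inr _ => (s + 1) * (D - 1)

lemma phi_map {S : Type*} [CommRing S] (ψ : R →+* S) :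
    map ψ (phi m R D) = phi m S D := by
  simp [phi]

lemma gen_map {S : Type*} [CommRing S] (ψ : R →+* S) (F : Fin s → MvPolynomial (Fin m) R)
    (g : GI m s) : gen D (fun i => map ψ (F i)) g = map ψ (gen D F g) := by
  rcases g with i | J
  · rfl
  · simp only [gen]
    rw [RingHom.map_det]
    congr 1
    ext1 i k
    simp only [RingHom.mapMatrix_apply, Matrix.map_apply, Matrix.of_apply]
    rw [← pderiv_map]
    congr 1
    refine Fin.cases ?_ (fun i => ?_) i
    · simp [phi_map]
    · simp

variable {D} {W : Filt R}

lemma phi_mem (hD : 1 ≤ D) : phi m R D ∈ Fil W m D := by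
  refine sum_mem fun j _ => sub_mem ?_ ?_
  · simpa using Fil_pow (W := W) (Fil_X le_rfl j) D
  · exact Fil_mono (d := 0 + 1) (by lia) (Fil_mul (Fil_natCast le_rfl _) (Fil_X le_rfl j))

lemma gen_mem (hD : 1 ≤ D) {F : Fin s → MvPolynomial (Fin m) R} (hF : ∀ i, F i ∈ Fil W m D)
    (g : GI m s) : gen D F g ∈ Fil W m (gdeg m s D g) := by
  rcases g with i | J
  · exact hF i
  · have := Fil_det (W := W) (d := (D : ℤ) - 1) (A := Matrix.of fun i k => pderiv (J k)
      ((Fin.cons (phi m R D) F : Fin (s + 1) → MvPolynomial (Fin m) R) i)) ?_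
    · simpa [gen, gdeg] using this
    · intro i j
      refine Fil_pderiv ?_ _
      refine Fin.cases ?_ (fun i => ?_) i
      · simpa using phi_mem hD
      · simpa using hF i

end gens

section inn
variable {m s D : ℕ} {R : Type*} [CommRing R]

def InN (W : Filt R) (D : ℕ) (B : Finset (Fin m →₀ ℕ)) (F : Fin s → MvPolynomial (Fin m) R)
    (d : ℤ) (p : MvPolynomial (Fin m) R) : Prop :=
  ∃ (u : (Fin m →₀ ℕ) → R) (H : GI m s → MvPolynomial (Fin m) R),
    (∀ b ∈ B, u b ∈ W.w (d - (b.degree : ℤ))) ∧ (∀ g, H g ∈ Fil W m (d - gdeg m s D g)) ∧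
    p = ∑ b ∈ B, monomial b (u b) + ∑ g, H g * gen D F g

variable {W : Filt R} {B : Finset (Fin m →₀ ℕ)} {F : Fin s → MvPolynomial (Fin m) R}

lemma InN.add {d : ℤ} {p q : MvPolynomial (Fin m) R} (hp : InN W D B F d p)
    (hq : InN W D B F d q) : InN W D B F d (p + q) := by
  obtain ⟨u, H, h1, h2, h3⟩ := hp
  obtain ⟨u', H', h1', h2', h3'⟩ := hq
  refine ⟨u + u', H + H', fun b hb => add_mem (h1 b hb) (h1' b hb),
    fun g => add_mem (h2 g) (h2' g), ?_⟩
  simp only [h3, h3', Pi.add_apply, map_add, Finset.sum_add_distrib, add_mul]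
  ring

lemma InN.zero {d : ℤ} : InN W D B F d 0 :=
  ⟨0, 0, fun b _ => zero_mem _, fun g => zero_mem _, by simp⟩

lemma InN.sum {ι : Type*} {S : Finset ι} {d : ℤ} {p : ι → MvPolynomial (Fin m) R}
    (h : ∀ i ∈ S, InN W D B F d (p i)) : InN W D B F d (∑ i ∈ S, p i) := by
  classical
  induction S using Finset.induction_on with
  | empty => simpa using InN.zero
  | insert a S ha ih =>
    rw [Finset.sum_insert ha]
    exact (h _ (by simp)).add (ih fun i hi => h i (by simp [hi]))

lemma InN.mono {d e : ℤ} (hde : d ≤ e) {p : MvPolynomial (Fin m) R} (hp : InN W D B F d p) :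
    InN W D B F e p := by
  obtain ⟨u, H, h1, h2, h3⟩ := hp
  exact ⟨u, H, fun b hb => W.mono _ _ (by lia) _ (h1 b hb), fun g => Fil_mono (by lia) (h2 g), h3⟩

lemma InN.C_mul {d k e : ℤ} (he : k + d = e) {r : R} (hr : r ∈ W.w k)
    {p : MvPolynomial (Fin m) R}
    (hp : InN W D B F d p) : InN W D B F e (C r * p) := by
  obtain ⟨u, H, h1, h2, h3⟩ := hp
  refine ⟨fun b => r * u b, fun g => C r * H g, fun b hb => ?_, fun g => ?_, ?_⟩
  · have := W.mul _ _ _ _ hr (h1 b hb)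
    convert this using 2; lia
  · have := Fil_mul (Fil_C (m := m) hr) (h2 g)
    convert this using 2; lia
  · rw [h3, mul_add, Finset.mul_sum, Finset.mul_sum]
    simp [C_mul_monomial, mul_assoc]

lemma InN.gen_mul {d : ℤ} (g : GI m s) {H : MvPolynomial (Fin m) R}
    (hH : H ∈ Fil W m (d - gdeg m s D g)) : InN W D B F d (H * gen D F g) := by
  classical
  refine ⟨0, Pi.single g H, fun b _ => zero_mem _, fun g' => ?_, ?_⟩
  · by_cases h : g' = g
    · subst h; simpa using hH
    · rw [Pi.single_eq_of_ne h]; exact zero_mem _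
  · simp only [Pi.zero_apply, map_zero, Finset.sum_const_zero, zero_add]
    rw [Finset.sum_eq_single g]
    · simp
    · intro b _ hb; rw [Pi.single_eq_of_ne hb]; simp
    · simp

lemma InN.basis {d : ℤ} {b : Fin m →₀ ℕ} (hb : b ∈ B) {r : R}
    (hr : r ∈ W.w (d - (b.degree : ℤ))) : InN W D B F d (monomial b r) := by
  classical
  refine ⟨Pi.single b r, 0, fun b' _ => ?_, fun g => zero_mem _, ?_⟩
  · by_cases h : b' = b
    · subst h; simpa using hr
    · rw [Pi.single_eq_of_ne h]; exact zero_mem _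
  · simp only [Pi.zero_apply, zero_mul, Finset.sum_const_zero, add_zero]
    rw [Finset.sum_eq_single b]
    · simp
    · intro b' _ hb; rw [Pi.single_eq_of_ne hb]; simp
    · simp [hb]

/-- If all monomials of degree at most `d` are in `InN` then so are all polynomials in `Fil d`. -/
lemma InN.of_Fil {d : ℤ} (h : ∀ α : Fin m →₀ ℕ, (α.degree : ℤ) ≤ d →
      InN W D B F α.degree (monomial α 1))
    {p : MvPolynomial (Fin m) R} (hp : p ∈ Fil W m d) : InN W D B F d p := by
  rw [p.as_sum]
  refine InN.sum fun α hα => ?_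
  have h1 : (α.degree : ℤ) ≤ d := by
    by_contra hc
    exact (mem_support_iff.1 hα) (W.neg _ (by lia) _ (hp α))
  have := (h α h1).C_mul (k := d - α.degree) (e := d) (by lia) (hp α)
  simpa [C_mul_monomial] using this

lemma InN.map {S : Type*} [CommRing S] {W' : Filt S} (ψ : R →+* S)
    (hψ : ∀ k a, a ∈ W.w k → ψ a ∈ W'.w k) {d : ℤ} {p : MvPolynomial (Fin m) R}
    (hp : InN W D B F d p) :
    InN W' D B (fun i => MvPolynomial.map ψ (F i)) d (MvPolynomial.map ψ p) := by
  obtain ⟨u, H, h1, h2, h3⟩ := hp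
  refine ⟨fun b => ψ (u b), fun g => MvPolynomial.map ψ (H g), fun b hb => hψ _ _ (h1 b hb),
    fun g => Fil_map ψ hψ (h2 g), ?_⟩
  simp [h3, gen_map]

end inn
end HP

namespace HP

section special
variable {m : ℕ} (s D ρ : ℕ) {R : Type*} [CommRing R]

def gp (R : Type*) [CommRing R] (D : ℕ) (j : Fin m) : MvPolynomial (Fin m) R :=
  X j ^ D - ((D - 1 : ℕ) : MvPolynomial (Fin m) R) * X j

/-- The special system. -/
def F0 (m s D ρ : ℕ) (R : Type*) [CommRing R] (i : Fin s) : MvPolynomial (Fin m) R :=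
  ∑ j : Fin m, ((j.val + 1 : ℕ) : MvPolynomial (Fin m) R) ^ (i.val + 1) * gp R D j
    - (ρ : MvPolynomial (Fin m) R) ^ (i.val + 1)

lemma F0_map {S : Type*} [CommRing S] (ψ : R →+* S) (i : Fin s) :
    map ψ (F0 m s D ρ R i) = F0 m s D ρ S i := by
  simp [F0, gp]

def gp' (R : Type*) [CommRing R] (D : ℕ) (j : Fin m) : MvPolynomial (Fin m) R :=
  (D : MvPolynomial (Fin m) R) * X j ^ (D - 1) - ((D - 1 : ℕ) : MvPolynomial (Fin m) R)

lemma pderiv_gp (k j : Fin m) : pderiv k (gp R D j) = if k = j then gp' R D j else 0 := by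
  unfold gp gp'
  have h : ∀ a : ℕ, pderiv k (a : MvPolynomial (Fin m) R) = 0 := fun a => by
    rw [← map_natCast (C : R →+* MvPolynomial (Fin m) R)]; exact pderiv_C
  rw [map_sub, pderiv_pow, pderiv_mul, h, pderiv_X]
  by_cases hk : k = j
  · subst hk; simp
  · simp [hk, Ne.symm hk]

lemma pderiv_phi (k : Fin m) : pderiv k (phi m R D) = gp' R D k := by
  have : phi m R D = ∑ j, gp R D j := rfl
  rw [this, map_sum]
  simp [pderiv_gp]

lemma pderiv_F0 (i : Fin s) (k : Fin m) : pderiv k (F0 m s D ρ R i) =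
    ((k.val + 1 : ℕ) : MvPolynomial (Fin m) R) ^ (i.val + 1) * gp' R D k := by
  have h : ∀ a : ℕ, pderiv k (a : MvPolynomial (Fin m) R) = 0 := fun a => by
    rw [← map_natCast (C : R →+* MvPolynomial (Fin m) R)]; exact pderiv_C
  unfold F0
  rw [map_sub, map_sum, ← Nat.cast_pow, h, sub_zero]
  rw [Finset.sum_eq_single k]
  · rw [← Nat.cast_pow, pderiv_mul, h, pderiv_gp]; simp
  · intro b _ hb
    rw [← Nat.cast_pow, pderiv_mul, h, pderiv_gp, if_neg (Ne.symm hb)]; simp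
  · simp

lemma gen_F0_inr (J : Fin (s + 1) → Fin m) : gen D (F0 m s D ρ R) (Sum.inr J) =
    (∏ k, gp' R D (J k)) *
      ((Matrix.det (Matrix.of fun i k : Fin (s + 1) => ((((J k).val + 1 : ℕ) : ℤ) ^ i.val)) : ℤ)
        : MvPolynomial (Fin m) R) := by
  have h := Matrix.det_mul_row (fun k => gp' R D (J k))
    (Matrix.of fun i k : Fin (s + 1) => (((J k).val + 1 : ℕ) : MvPolynomial (Fin m) R) ^ i.val)
  have h2 : ((Matrix.det (Matrix.of fun i k : Fin (s + 1) => ((((J k).val + 1 : ℕ) : ℤ) ^ i.val))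
        : ℤ) : MvPolynomial (Fin m) R) = Matrix.det (Matrix.of fun i k : Fin (s + 1) =>
        (((J k).val + 1 : ℕ) : MvPolynomial (Fin m) R) ^ i.val) := by
    have h3 := RingHom.map_det (Int.castRingHom (MvPolynomial (Fin m) R))
      (Matrix.of fun i k : Fin (s + 1) => ((((J k).val + 1 : ℕ) : ℤ) ^ i.val))
    refine h3.trans ?_
    congr 1
    ext1 i k
    simp
  rw [h2, ← h]
  simp only [gen]
  congr 1
  ext1 i k
  simp only [Matrix.of_apply]
  refine Fin.cases ?_ (fun i => ?_) i
  · simp [pderiv_phi]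
  · simp [pderiv_F0, mul_comm]

lemma vdm_ne (J : Fin (s + 1) → Fin m) (hJ : Function.Injective J) :
    Matrix.det (Matrix.of fun i k : Fin (s + 1) => ((((J k).val + 1 : ℕ) : ℤ) ^ i.val)) ≠ 0 := by
  have : (Matrix.of fun i k : Fin (s + 1) => ((((J k).val + 1 : ℕ) : ℤ) ^ i.val)) =
      (Matrix.vandermonde (fun k => (((J k).val + 1 : ℕ) : ℤ))).transpose := by
    ext i k; simp [Matrix.vandermonde]
  rw [this, Matrix.det_transpose, Matrix.det_vandermonde_ne_zero_iff]
  intro a b hab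
  simp at hab
  exact hJ (Fin.ext hab)

lemma V1 {K ι : Type*} [Field K] [DecidableEq ι] (ν : ι → K) (hν : Function.Injective ν)
    (hν0 : ∀ j, ν j ≠ 0)
    (P : Finset ι) (hP : P.card ≤ s) (i : ι) (hi : i ∈ P) :
    ∃ c : Fin s → K, ∑ k, c k * ν i ^ (k.val + 1) = 1 ∧
      ∀ l ∈ P, l ≠ i → ∑ k, c k * ν l ^ (k.val + 1) = 0 := by
  let h : Polynomial K := (Polynomial.C (ν i)⁻¹ * Polynomial.X) *
    ∏ l ∈ P.erase i, (Polynomial.C (ν i - ν l)⁻¹ * (Polynomial.X - Polynomial.C (ν l)))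
  have hdeg : h.natDegree < s + 1 := by
    have h1 : (∏ l ∈ P.erase i, (Polynomial.C (ν i - ν l)⁻¹ *
        (Polynomial.X - Polynomial.C (ν l)))).natDegree ≤ ∑ l ∈ P.erase i, 1 := by
      refine (Polynomial.natDegree_prod_le _ _).trans (Finset.sum_le_sum fun l _ => ?_)
      exact (Polynomial.natDegree_C_mul_le _ _).trans (Polynomial.natDegree_X_sub_C_le _)
    have h2 : (Polynomial.C (ν i)⁻¹ * Polynomial.X : Polynomial K).natDegree ≤ 1 :=
      (Polynomial.natDegree_C_mul_le _ _).trans Polynomial.natDegree_X_le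
    have h3 := Polynomial.natDegree_mul_le (p := Polynomial.C (ν i)⁻¹ * Polynomial.X)
      (q := ∏ l ∈ P.erase i, (Polynomial.C (ν i - ν l)⁻¹ * (Polynomial.X - Polynomial.C (ν l))))
    have h4 : ∑ l ∈ P.erase i, 1 = P.card - 1 := by simp [Finset.card_erase_of_mem hi]
    have h5 : 0 < P.card := Finset.card_pos.2 ⟨i, hi⟩
    have : h.natDegree ≤ 1 + (P.card - 1) := by lia
    lia
  have hev : ∀ x, ∑ k : Fin s, h.coeff (k.val + 1) * x ^ (k.val + 1) = h.eval x := by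
    intro x
    rw [Polynomial.eval_eq_sum_range' hdeg, Finset.sum_range_succ',
      Fin.sum_univ_eq_sum_range (fun k => h.coeff (k + 1) * x ^ (k + 1))]
    have : h.coeff 0 = 0 := by
      rw [Polynomial.coeff_zero_eq_eval_zero]; simp [h]
    rw [this]; simp
  refine ⟨fun k => h.coeff (k.val + 1), ?_, ?_⟩
  · rw [hev]
    simp only [h, Polynomial.eval_mul, Polynomial.eval_prod, Polynomial.eval_C, Polynomial.eval_X,
      Polynomial.eval_sub]
    rw [inv_mul_cancel₀ (hν0 i), one_mul]
    refine Finset.prod_eq_one fun l hl => ?_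
    refine inv_mul_cancel₀ (sub_ne_zero.2 fun hh => ?_)
    exact (Finset.mem_erase.1 hl).1 (hν hh).symm
  · intro l hl hli
    rw [hev]
    simp only [h, Polynomial.eval_mul, Polynomial.eval_prod, Polynomial.eval_C, Polynomial.eval_X,
      Polynomial.eval_sub]
    rw [Finset.prod_eq_zero (Finset.mem_erase.2 ⟨hli, hl⟩) (by simp), mul_zero]

end special

section basis

def qs {m : ℕ} (D : ℕ) (α : Fin m →₀ ℕ) : ℕ := ∑ j, α j / D
def ts {m : ℕ} (D : ℕ) (α : Fin m →₀ ℕ) : ℕ := (Finset.univ.filter fun j => α j % D = D - 1).card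

lemma finite_deg (m d : ℕ) : {α : Fin m →₀ ℕ | α.degree ≤ d}.Finite :=
  Finsupp.finite_of_degree_le d

def Mon (m d : ℕ) : Finset (Fin m →₀ ℕ) := (finite_deg m d).toFinset

lemma mem_Mon {m d : ℕ} {α : Fin m →₀ ℕ} : α ∈ Mon m d ↔ α.degree ≤ d := by
  simp [Mon]

def MM (m s D : ℕ) : ℕ := (m + s) * (D - 1)

open Classical in
def BB (m s D : ℕ) : Finset (Fin m →₀ ℕ) :=
  (Mon m (MM m s D)).filter fun α => (∀ j : Fin m, m - s ≤ j.val → α j < D) ∧ qs D α + ts D α ≤ s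

lemma degree_eq {m : ℕ} (α : Fin m →₀ ℕ) : α.degree = ∑ j, α j := by
  rw [Finsupp.degree_eq_sum]

lemma degree_qr {m : ℕ} (D : ℕ) (α : Fin m →₀ ℕ) :
    α.degree = D * qs D α + ∑ j, α j % D := by
  rw [degree_eq, qs, Finset.mul_sum, ← Finset.sum_add_distrib]
  exact Finset.sum_congr rfl fun j _ => (Nat.div_add_mod _ _).symm

lemma ts_eq {m : ℕ} (D : ℕ) (α : Fin m →₀ ℕ) :
    ts D α = ∑ j, if α j % D = D - 1 then 1 else 0 := by
  rw [ts, Finset.card_filter]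

lemma deg_bound {m s D : ℕ} (hD : 1 ≤ D) (hs : s ≤ m) (α : Fin m →₀ ℕ)
    (h : qs D α + ts D α ≤ s) : α.degree ≤ MM m s D := by
  have h1 : ∑ j, (α j % D + 1) ≤ ∑ j : Fin m, ((D - 1) + if α j % D = D - 1 then 1 else 0) := by
    refine Finset.sum_le_sum fun j _ => ?_
    have := Nat.mod_lt (α j) hD
    split_ifs <;> lia
  rw [Finset.sum_add_distrib, Finset.sum_add_distrib, ← ts_eq] at h1
  simp at h1
  rw [degree_qr D, MM]
  obtain ⟨E, rfl⟩ : ∃ E, D = E + 1 := ⟨D - 1, by lia⟩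
  simp at h1 ⊢
  have : E * qs (E + 1) α ≤ E * s := Nat.mul_le_mul_left _ (by lia)
  nlinarith

lemma mem_BB {m s D : ℕ} (hD : 1 ≤ D) (hs : s ≤ m) {α : Fin m →₀ ℕ} : α ∈ BB m s D ↔
    (∀ j : Fin m, m - s ≤ j.val → α j < D) ∧ qs D α + ts D α ≤ s := by
  rw [BB, Finset.mem_filter, mem_Mon]
  exact ⟨fun h => h.2, fun h => ⟨deg_bound hD hs α h.2, h⟩⟩

lemma BB_deg {m s D : ℕ} {α : Fin m →₀ ℕ} (h : α ∈ BB m s D) : α.degree ≤ MM m s D :=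
  mem_Mon.1 (Finset.mem_filter.1 h).1

/-- Move `D` units from `i` to `l`. -/
def sh {m : ℕ} (D : ℕ) (α : Fin m →₀ ℕ) (i l : Fin m) : Fin m →₀ ℕ :=
  α - Finsupp.single i D + Finsupp.single l D

lemma sh_deg {m D : ℕ} {α : Fin m →₀ ℕ} {i l : Fin m} (h : D ≤ α i) :
    (sh D α i l).degree = α.degree := by
  have h1 : Finsupp.single i D ≤ α := by simpa using h
  have : α = α - Finsupp.single i D + Finsupp.single i D := (tsub_add_cancel_of_le h1).symm
  rw [sh, map_add]
  conv_rhs => rw [this, map_add]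
  simp

lemma sh_apply {m D : ℕ} {α : Fin m →₀ ℕ} {i l : Fin m} (hil : i ≠ l) (j : Fin m) :
    sh D α i l j = if j = i then α i - D else if j = l then α l + D else α j := by
  unfold sh
  simp only [Finsupp.coe_add, Finsupp.coe_tsub, Pi.add_apply, Pi.sub_apply, Finsupp.single_apply]
  by_cases h1 : j = i
  · subst h1; simp [Ne.symm hil]
  · by_cases h2 : j = l
    · subst h2; simp [hil, Ne.symm hil]
    · simp [h1, h2, Ne.symm h1, Ne.symm h2]

lemma sh_mod {m D : ℕ} {α : Fin m →₀ ℕ} {i l : Fin m} (hil : i ≠ l) (h : D ≤ α i) (j : Fin m) :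
    sh D α i l j % D = α j % D := by
  rw [sh_apply hil]
  split_ifs with h1 h2
  · subst h1; exact (Nat.mod_eq_sub_mod h).symm
  · subst h2; simp
  · rfl

lemma sh_ts {m D : ℕ} {α : Fin m →₀ ℕ} {i l : Fin m} (hil : i ≠ l) (h : D ≤ α i) :
    ts D (sh D α i l) = ts D α := by
  simp only [ts, sh_mod hil h]

lemma sh_qs {m D : ℕ} (hD : 1 ≤ D) {α : Fin m →₀ ℕ} {i l : Fin m} (hil : i ≠ l) (h : D ≤ α i) :
    qs D (sh D α i l) = qs D α := by
  have h1 := degree_qr D α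
  have h2 := degree_qr D (sh D α i l)
  rw [sh_deg h] at h2
  simp only [sh_mod hil h] at h2
  have : D * qs D (sh D α i l) = D * qs D α := by lia
  exact Nat.eq_of_mul_eq_mul_left hD this

end basis

section span
variable {m s D ρ : ℕ}

local notation "Good" => InN (triv ℚ) D (BB m s D) (F0 m s D ρ ℚ)

lemma Good_of_sub {d : ℕ} (IH : ∀ α : Fin m →₀ ℕ, α.degree < d →
      Good α.degree (monomial α 1)) {p p' : MvPolynomial (Fin m) ℚ} (hp : Good d p)
    (h : p' - p ∈ Fil (triv ℚ) m ((d : ℤ) - 1)) : Good d p' := by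
  have : p' = p + (p' - p) := by ring
  rw [this]
  refine hp.add ((InN.of_Fil (d := (d : ℤ) - 1) ?_ h).mono (by lia))
  intro α hα
  exact IH α (by lia)

lemma triv_w_of_nonneg {R : Type*} [CommRing R] {k : ℤ} (hk : 0 ≤ k) (a : R) :
    a ∈ (triv R).w k := by
  rw [triv_mem]; intro h; lia

lemma replace_step (hD : 1 ≤ D) {d : ℕ} (IH : ∀ α : Fin m →₀ ℕ, α.degree < d →
      Good α.degree (monomial α 1)) (α : Fin m →₀ ℕ) (hα : α.degree = d) (P : Finset (Fin m))
    (hP : P.card ≤ s) (i : Fin m) (hi : i ∈ P) (hiD : D ≤ α i)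
    (h : ∀ l ∉ P, Good d (monomial (sh D α i l) 1)) : Good d (monomial α 1) := by
  obtain ⟨c, hc1, hc2⟩ := V1 s (fun j : Fin m => ((j.val + 1 : ℕ) : ℚ))
    (fun a b hab => by
      apply Fin.ext
      have : a.val + 1 = b.val + 1 := by
        simp only at hab
        exact_mod_cast hab
      lia) (fun j => by positivity) P hP i hi
  have h1 : Finsupp.single i D ≤ α := by simpa using hiD
  have hsum : α - Finsupp.single i D + Finsupp.single i D = α := (tsub_add_cancel_of_le h1)
  have hdeg : (α - Finsupp.single i D).degree + D = d := by
    rw [← hα]; conv_rhs => rw [← hsum, map_add]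
    simp
  set β := α - Finsupp.single i D with hβ
  have hshl : ∀ l, sh D α i l = β + Finsupp.single l D := fun l => rfl
  -- the combination
  let e : Fin m → ℚ := fun l => ∑ k, c k * ((l.val + 1 : ℕ) : ℚ) ^ (k.val + 1)
  let E : MvPolynomial (Fin m) ℚ := ∑ k, C (c k) * F0 m s D ρ ℚ k
  have hE : E = ∑ l, C (e l) * gp ℚ D l - C (∑ k, c k * (ρ : ℚ) ^ (k.val + 1)) := by
    have hk : ∀ k, C (c k) * F0 m s D ρ ℚ k = ∑ l : Fin m,
        C (c k * ((l.val + 1 : ℕ) : ℚ) ^ (k.val + 1)) * gp ℚ D l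
        - C (c k * (ρ : ℚ) ^ (k.val + 1)) := by
      intro k
      rw [F0, mul_sub, Finset.mul_sum]
      congr 1
      · refine Finset.sum_congr rfl fun l _ => ?_
        rw [C_mul, C_pow, map_natCast, mul_assoc]
      · rw [C_mul, C_pow, map_natCast]
    simp only [E, hk, e]
    rw [Finset.sum_sub_distrib, Finset.sum_comm, map_sum]
    simp only [map_sum, Finset.sum_mul]
  have hGE : Good d (monomial β 1 * E) := by
    simp only [E, Finset.mul_sum]
    refine InN.sum fun k _ => ?_
    have : monomial β 1 * (C (c k) * F0 m s D ρ ℚ k) = (monomial β (c k)) *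
        gen D (F0 m s D ρ ℚ) (Sum.inl k) := by
      rw [← mul_assoc, mul_comm _ (C _), C_mul_monomial, mul_one]; rfl
    rw [this]
    refine InN.gen_mul _ (Fil_monomial ?_)
    simp only [gdeg]
    exact triv_w_of_nonneg (by lia) _
  have hsum2 : Good d (∑ l ∈ Finset.univ.filter (· ∉ P), C (- e l) * monomial (sh D α i l) 1) := by
    refine InN.sum fun l hl => ?_
    exact (h l (Finset.mem_filter.1 hl).2).C_mul (k := 0) (by lia) (triv_w_of_nonneg le_rfl _)
  refine Good_of_sub IH (hGE.add hsum2) ?_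
  have key : monomial α (1 : ℚ) = ∑ l, C (e l) * monomial (sh D α i l) 1 +
      ∑ l ∈ Finset.univ.filter (· ∉ P), C (- e l) * monomial (sh D α i l) 1 := by
    rw [← Finset.sum_filter_add_sum_filter_not Finset.univ (· ∈ P), add_assoc,
      ← Finset.sum_add_distrib]
    have : ∑ l ∈ Finset.univ.filter (· ∉ P), (C (e l) * monomial (sh D α i l) 1 +
        C (- e l) * monomial (sh D α i l) 1) = (0 : MvPolynomial (Fin m) ℚ) := by
      refine Finset.sum_eq_zero fun l _ => ?_
      simp
    rw [this, add_zero, Finset.sum_eq_single i]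
    · have : e i = 1 := hc1
      rw [this, hshl, hsum]; simp
    · intro l hl hli
      have : e l = 0 := hc2 l (Finset.mem_filter.1 hl).2 hli
      rw [this]; simp
    · simp [hi]
  have : monomial α (1 : ℚ) - (monomial β 1 * E + ∑ l ∈ Finset.univ.filter (· ∉ P),
      C (- e l) * monomial (sh D α i l) 1) = ∑ l, monomial β (e l) * (((D - 1 : ℕ)
        : MvPolynomial (Fin m) ℚ) * X l) + monomial β (∑ k, c k * (ρ : ℚ) ^ (k.val + 1)) := by
    rw [key, hE]
    have h2 : ∀ l, monomial (sh D α i l) (1 : ℚ) = monomial β 1 * X l ^ D := by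
      intro l; rw [hshl, monomial_add_single]
    have h3 : ∀ a : ℚ, monomial β a = C a * monomial β 1 := by
      intro a; rw [C_mul_monomial, mul_one]
    simp only [h2, gp]
    rw [h3 (∑ k, c k * (ρ : ℚ) ^ (k.val + 1)), mul_sub]
    simp only [h3 (e _), Finset.mul_sum]
    have : ∀ A B C' E' F' : MvPolynomial (Fin m) ℚ, A - C' = F' →
      A + B - (C' - E' + B) = F' + E' := by intro A B C' E' F' h; rw [← h]; ring
    rw [mul_comm (C (∑ k, c k * (ρ : ℚ) ^ (k.val + 1)))]
    apply this
    rw [← Finset.sum_sub_distrib]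
    refine Finset.sum_congr rfl fun l _ => ?_
    ring
  rw [this]
  refine add_mem (sum_mem fun l _ => ?_) (Fil_monomial (triv_w_of_nonneg (by lia) _))
  by_cases hD1 : D = 1
  · subst hD1; simp
  refine Fil_mono (d := (β.degree : ℤ) + (0 + 1)) (by lia) ?_
  refine Fil_mul (Fil_monomial (triv_w_of_nonneg (by lia) _)) (Fil_mul (Fil_natCast le_rfl _)
    (Fil_X le_rfl l))

lemma prod_approx {R : Type*} [CommRing R] {W : Filt R} {ι : Type*} (S : Finset ι)
    (p q : ι → MvPolynomial (Fin m) R) (d : ι → ℤ)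
    (hp : ∀ i ∈ S, p i ∈ Fil W m (d i)) (hq : ∀ i ∈ S, q i ∈ Fil W m (d i))
    (hpq : ∀ i ∈ S, p i - q i ∈ Fil W m (d i - 1)) :
    ∏ i ∈ S, p i - ∏ i ∈ S, q i ∈ Fil W m (∑ i ∈ S, d i - 1) := by
  classical
  induction S using Finset.induction_on with
  | empty => simp
  | insert a S ha ih =>
    rw [Finset.prod_insert ha, Finset.prod_insert ha, Finset.sum_insert ha]
    have : p a * ∏ i ∈ S, p i - q a * ∏ i ∈ S, q i = (p a - q a) * ∏ i ∈ S, p i +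
      q a * (∏ i ∈ S, p i - ∏ i ∈ S, q i) := by ring
    rw [this]
    refine add_mem ?_ ?_
    · have := Fil_mul (hpq a (by simp)) (Fil_prod S p d fun i hi => hp i (by simp [hi]))
      convert this using 2; ring
    · have := Fil_mul (hq a (by simp)) (ih (fun i hi => hp i (by simp [hi]))
        (fun i hi => hq i (by simp [hi])) (fun i hi => hpq i (by simp [hi])))
      convert this using 2; ring

lemma minor_step (hD : 1 ≤ D) {d : ℕ} (IH : ∀ α : Fin m →₀ ℕ, α.degree < d →
      Good α.degree (monomial α 1)) (α : Fin m →₀ ℕ) (hα : α.degree = d)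
    (J : Fin (s + 1) → Fin m) (hJ : Function.Injective J) (h : ∀ k, D - 1 ≤ α (J k)) :
    Good d (monomial α 1) := by
  set v : ℤ := Matrix.det (Matrix.of fun i k : Fin (s + 1) => ((((J k).val + 1 : ℕ) : ℤ) ^ i.val))
    with hv
  have hv0 : v ≠ 0 := vdm_ne s J hJ
  let δ : Fin m →₀ ℕ := ∑ k, Finsupp.single (J k) (D - 1)
  have hδ : δ ≤ α := by
    intro j
    simp only [δ, Finsupp.coe_finsetSum, Finset.sum_apply, Finsupp.single_apply]
    by_cases hj : ∃ k, J k = j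
    · obtain ⟨k, rfl⟩ := hj
      rw [Finset.sum_eq_single k]
      · simpa using h k
      · intro b _ hb; rw [if_neg]; intro hh; exact hb (hJ hh)
      · simp
    · push Not at hj
      rw [Finset.sum_eq_zero]
      · simp
      · intro k _; simp [hj k]
  have hδd : δ.degree = (s + 1) * (D - 1) := by
    simp only [δ, map_sum, Finsupp.degree_single]; simp
  have hsum : α - δ + δ = α := tsub_add_cancel_of_le hδ
  have hdeg : (α - δ).degree + (s + 1) * (D - 1) = d := by
    rw [← hα, ← hδd, ← map_add, hsum]
  set β := α - δ
  have hc0 : ((v : ℚ) * (D : ℚ) ^ (s + 1)) ≠ 0 := by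
    have : (v : ℚ) ≠ 0 := by exact_mod_cast hv0
    positivity
  set c : ℚ := ((v : ℚ) * (D : ℚ) ^ (s + 1))⁻¹ with hc
  have hG : Good d (monomial β c * gen D (F0 m s D ρ ℚ) (Sum.inr J)) := by
    refine InN.gen_mul _ (Fil_monomial (triv_w_of_nonneg ?_ _))
    simp only [gdeg]
    have : (((D - 1 : ℕ)) : ℤ) = D - 1 := by lia
    rw [← hdeg]; push_cast [this]; ring_nf; lia
  refine Good_of_sub IH hG ?_
  have hmon : monomial α (1 : ℚ) = monomial β c * ((∏ k, ((D : MvPolynomial (Fin m) ℚ) *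
      X (J k) ^ (D - 1))) * (v : MvPolynomial (Fin m) ℚ)) := by
    have h1 : (∏ k, ((D : MvPolynomial (Fin m) ℚ) * X (J k) ^ (D - 1))) =
        monomial δ ((D : ℚ) ^ (s + 1)) := by
      have : ∀ k, ((D : MvPolynomial (Fin m) ℚ) * X (J k) ^ (D - 1)) =
          monomial (Finsupp.single (J k) (D - 1)) (D : ℚ) := by
        intro k
        rw [X_pow_eq_monomial, ← map_natCast (C : ℚ →+* MvPolynomial (Fin m) ℚ), C_mul_monomial,
          mul_one]
      simp only [this, δ]
      rw [← monomial_sum_prod]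
      simp
    have h2 : (v : MvPolynomial (Fin m) ℚ) = C (v : ℚ) := by simp
    rw [h1, h2, mul_comm _ (C _), C_mul_monomial, monomial_mul, hsum, hc, inv_mul_cancel₀ hc0]
  rw [gen_F0_inr, hmon, ← hv, ← mul_sub, ← sub_mul]
  have hgp : ∀ k, gp' ℚ D (J k) ∈ Fil (triv ℚ) m ((D : ℤ) - 1) := by
    intro k
    refine sub_mem ?_ (Fil_natCast (by lia) _)
    have := Fil_mul (Fil_natCast (W := triv ℚ) (m := m) le_rfl D)
      (Fil_pow (Fil_X (W := triv ℚ) le_rfl (J k)) (D - 1))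
    convert this using 2; lia
  have hlead : ∀ k, ((D : MvPolynomial (Fin m) ℚ) * X (J k) ^ (D - 1)) ∈
      Fil (triv ℚ) m ((D : ℤ) - 1) := by
    intro k
    have := Fil_mul (Fil_natCast (W := triv ℚ) (m := m) le_rfl D)
      (Fil_pow (Fil_X (W := triv ℚ) le_rfl (J k)) (D - 1))
    convert this using 2; lia
  have hap := prod_approx (W := triv ℚ) Finset.univ
    (fun k => ((D : MvPolynomial (Fin m) ℚ) * X (J k) ^ (D - 1)))
    (fun k => gp' ℚ D (J k)) (fun _ => (D : ℤ) - 1)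
    (fun k _ => hlead k) (fun k _ => hgp k) (fun k _ => by
      unfold gp'
      rw [sub_sub_cancel]
      by_cases hD1 : D = 1
      · subst hD1; simp
      · exact Fil_natCast (by lia) _)
  have hvm : (v : MvPolynomial (Fin m) ℚ) ∈ Fil (triv ℚ) m 0 := by
    have : (v : MvPolynomial (Fin m) ℚ) = C (v : ℚ) := by simp
    rw [this]; exact Fil_C (triv_w_of_nonneg le_rfl _)
  have hβm : monomial β c ∈ Fil (triv ℚ) m β.degree :=
    Fil_monomial (triv_w_of_nonneg (by lia) _)
  have := Fil_mul hβm (Fil_mul hap hvm)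
  convert this using 2
  simp only [Finset.sum_const, Finset.card_univ, Fintype.card_fin]
  have h9 : (((D - 1 : ℕ)) : ℤ) = D - 1 := by lia
  rw [← hdeg]; push_cast [h9]; simp; ring

lemma claim1 (hD : 1 ≤ D) {d : ℕ} (IH : ∀ α : Fin m →₀ ℕ, α.degree < d →
      Good α.degree (monomial α 1)) (k : ℕ) : ∀ (α : Fin m →₀ ℕ), α.degree = d →
    s + 1 ≤ qs D α + ts D α → m - (Finset.univ.filter fun j => D - 1 ≤ α j).card = k →
    Good d (monomial α 1) := by
  classical
  induction k using Nat.strong_induction_on with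
  | _ k ihk =>
  intro α hα hqt hk
  set P := Finset.univ.filter fun j => D - 1 ≤ α j with hP
  by_cases hc : s + 1 ≤ P.card
  · obtain ⟨J, hJ⟩ : ∃ J : Fin (s + 1) ↪ Fin m, ∀ k, J k ∈ P := by
      obtain ⟨P', hP', hcard⟩ := Finset.exists_subset_card_eq hc
      refine ⟨(P'.orderEmbOfFin hcard).toEmbedding, fun k => hP' ?_⟩
      exact P'.orderEmbOfFin_mem hcard k
    exact minor_step hD IH α hα J J.injective fun k => (Finset.mem_filter.1 (hJ k)).2
  · obtain ⟨i, hi⟩ : ∃ i ∈ P, 2 ≤ α i / D + if α i % D = D - 1 then 1 else 0 := by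
      by_contra hcon
      push Not at hcon
      have : qs D α + ts D α ≤ P.card := by
        rw [ts_eq, qs, ← Finset.sum_add_distrib, hP, Finset.card_filter]
        refine Finset.sum_le_sum fun j _ => ?_
        by_cases hj : D - 1 ≤ α j
        · have := hcon j (Finset.mem_filter.2 ⟨Finset.mem_univ _, hj⟩); simp only [hj, if_true]; lia
        · have h1 : α j < D := by lia
          rw [Nat.div_eq_of_lt h1, Nat.mod_eq_of_lt h1, if_neg (by lia), if_neg hj]
      lia
    obtain ⟨hiP, hi2⟩ := hi
    have hdm := Nat.div_add_mod (α i) D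
    have hsub : D + (D - 1) ≤ α i := by
      split_ifs at hi2 with hh
      · have : D * 1 ≤ D * (α i / D) := Nat.mul_le_mul_left _ (by lia)
        lia
      · have : D * 2 ≤ D * (α i / D) := Nat.mul_le_mul_left _ (by lia)
        lia
    refine replace_step hD IH α hα P (by lia) i hiP (by lia) fun l hl => ?_
    have hil : i ≠ l := fun h => hl (h ▸ hiP)
    refine ihk _ ?_ (sh D α i l) (by rw [sh_deg (by lia), hα])
      (by rw [sh_qs hD hil (by lia), sh_ts hil (by lia)]; exact hqt) rfl
    have hPi : insert l P ⊆ Finset.univ.filter fun j => D - 1 ≤ sh D α i l j := by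
      intro j hj
      simp only [Finset.mem_filter, Finset.mem_univ, true_and]
      rw [sh_apply hil]
      rcases Finset.mem_insert.1 hj with rfl | hj
      · rw [if_neg (Ne.symm hil), if_pos rfl]; lia
      · have := (Finset.mem_filter.1 hj).2
        split_ifs <;> lia
    have h1 := Finset.card_le_card hPi
    rw [Finset.card_insert_of_notMem hl] at h1
    have h2 := Finset.card_le_univ (Finset.univ.filter fun j => D - 1 ≤ sh D α i l j)
    simp only [Fintype.card_fin] at h2
    lia

lemma claim2 (hD : 1 ≤ D) (hs : s ≤ m) {d : ℕ} (IH : ∀ α : Fin m →₀ ℕ, α.degree < d →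
      Good α.degree (monomial α 1)) (k : ℕ) : ∀ (α : Fin m →₀ ℕ), α.degree = d →
    qs D α + ts D α ≤ s → (∑ j ∈ Finset.univ.filter (fun j : Fin m => m - s ≤ j.val), α j) = k →
    Good d (monomial α 1) := by
  classical
  induction k using Nat.strong_induction_on with
  | _ k ihk =>
  intro α hα hqt hk
  by_cases hB : α ∈ BB m s D
  · exact InN.basis hB (triv_w_of_nonneg (by lia) _)
  · rw [mem_BB hD hs] at hB
    have : ∃ i : Fin m, m - s ≤ i.val ∧ D ≤ α i := by
      by_contra hcon
      push Not at hcon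
      exact hB ⟨hcon, hqt⟩
    obtain ⟨i, hi1, hi2⟩ := this
    have hcard : (Finset.univ.filter (fun j : Fin m => m - s ≤ j.val)).card ≤ s := by
      have h1 : (Finset.univ.filter (fun j : Fin m => m - s ≤ j.val)).card =
        ((Finset.univ.filter (fun j : Fin m => m - s ≤ j.val)).map Fin.valEmbedding).card := by
        simp
      rw [h1]
      have h2 : (Finset.univ.filter (fun j : Fin m => m - s ≤ j.val)).map Fin.valEmbedding ⊆
          Finset.Ico (m - s) m := by
        intro x hx
        simp at hx
        obtain ⟨a, ha, rfl⟩ := hx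
        simp; exact ha
      have := Finset.card_le_card h2
      simp only [Nat.card_Ico] at this
      lia
    have hiP : i ∈ Finset.univ.filter (fun j : Fin m => m - s ≤ j.val) := by simpa using hi1
    refine replace_step hD IH α hα _ hcard i hiP hi2 fun l hl => ?_
    have hil : i ≠ l := fun h => hl (h ▸ hiP)
    refine ihk _ ?_ (sh D α i l) (by rw [sh_deg (by lia), hα])
      (by rw [sh_qs hD hil (by lia), sh_ts hil (by lia)]; exact hqt) rfl
    rw [← hk]
    refine Finset.sum_lt_sum (fun j hj => ?_) ⟨i, hiP, ?_⟩
    · rw [sh_apply hil]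
      have : j ≠ l := fun h => hl (h ▸ hj)
      split_ifs <;> simp_all
    · rw [sh_apply hil]; simp; lia

theorem span_F0 (hD : 1 ≤ D) (hs : s ≤ m) (d : ℕ) : ∀ α : Fin m →₀ ℕ, α.degree = d →
    Good α.degree (monomial α 1) := by
  induction d using Nat.strong_induction_on with
  | _ d ihd =>
  intro α hα
  have IH : ∀ α : Fin m →₀ ℕ, α.degree < d → Good α.degree (monomial α 1) :=
    fun α h => ihd _ h α rfl
  rw [hα]
  by_cases h : qs D α + ts D α ≤ s
  · exact claim2 hD hs IH _ α hα h rfl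
  · exact claim1 hD IH _ α hα (by lia) rfl

end span
end HP

namespace HP

section count
variable {m s D : ℕ}

def N0 (m s D : ℕ) : ℕ := D ^ s * (D - 1) ^ (m - s) * m.choose s

/-- The index set of the points of the special system. -/
abbrev Pt (m s D : ℕ) := (S : {S : Finset (Fin m) // S ∈ Finset.powersetCard s Finset.univ}) ×
  ((j : Fin m) → Fin (if j ∈ S.1 then D else D - 1))

lemma card_Pt : Fintype.card (Pt m s D) = N0 m s D := by
  rw [Fintype.card_sigma]
  have : ∀ S : {S : Finset (Fin m) // S ∈ Finset.powersetCard s Finset.univ},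
      Fintype.card ((j : Fin m) → Fin (if j ∈ S.1 then D else D - 1)) =
      D ^ s * (D - 1) ^ (m - s) := by
    intro S
    have hS := (Finset.mem_powersetCard.1 S.2).2
    rw [Fintype.card_pi]
    simp only [Fintype.card_fin]
    rw [Finset.prod_ite]
    simp only [Finset.prod_const]
    congr 2
    · refine Eq.trans ?_ hS; congr 1; ext; simp
    · have h1 := Finset.card_compl S.1
      rw [hS, Fintype.card_fin] at h1
      rw [← h1]; congr 1; ext; simp
  simp only [this]
  simp [N0, mul_comm]

lemma superset_count (T : Finset (Fin m)) (hT : T.card ≤ s) :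
    (m - T.card).choose (s - T.card) ≤
      ((Finset.powersetCard s (Finset.univ : Finset (Fin m))).filter (T ⊆ ·)).card := by
  classical
  have h1 : (Finset.powersetCard (s - T.card) Tᶜ).card = (m - T.card).choose (s - T.card) := by
    rw [Finset.card_powersetCard, Finset.card_compl, Fintype.card_fin]
  rw [← h1]
  refine Finset.card_le_card_of_injOn (fun S => S ∪ T) ?_ ?_
  · intro S hS
    simp only [Finset.coe_filter, Finset.mem_powersetCard, Set.mem_ofPred_eq]
    obtain ⟨h2, h3⟩ := Finset.mem_powersetCard.1 hS
    have hd : Disjoint S T := by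
      rw [Finset.disjoint_left]; intro a ha hb
      exact (Finset.mem_compl.1 (h2 ha)) hb
    refine ⟨⟨Finset.subset_univ _, ?_⟩, Finset.subset_union_right⟩
    rw [Finset.card_union_of_disjoint hd]; lia
  · intro S hS S' hS' h
    have hd : ∀ S ∈ Finset.powersetCard (s - T.card) Tᶜ, (S ∪ T) \ T = S := by
      intro S hS
      have h2 := (Finset.mem_powersetCard.1 hS).1
      ext a
      have := @h2 a
      simp at this ⊢
      tauto
    rw [← hd S hS, ← hd S' hS']
    simp only at h
    rw [h]

/-- residues -/
def res (D : ℕ) (α : Fin m →₀ ℕ) : Fin m → ℕ := fun j => α j % D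

lemma fiber_count (hD : 1 ≤ D) (hs : s ≤ m) (r : Fin m → Fin D) :
    ((BB m s D).filter fun α => ∀ j, α j % D = (r j).val).card ≤
      ((Finset.powersetCard s (Finset.univ : Finset (Fin m))).filter
        ((Finset.univ.filter fun j => (r j).val = D - 1) ⊆ ·)).card := by
  classical
  set T := Finset.univ.filter fun j => (r j).val = D - 1 with hT
  by_cases hc : T.card ≤ s
  · refine le_trans ?_ (superset_count T hc)
    have hcard := Finset.card_finsuppAntidiag_nat_eq_choose
      (s := (Finset.univ : Finset (Fin (m - s + 1)))) (s - T.card)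
    have e1 : (Finset.univ : Finset (Fin (m - s + 1))).card + (s - T.card) - 1 = m - T.card := by
      simp; lia
    rw [e1] at hcard
    rw [← hcard]
    let q : (Fin m →₀ ℕ) → Fin (m - s) → ℕ := fun α k => α ⟨k.val, by lia⟩ / D
    let v : (Fin m →₀ ℕ) → Fin (m - s + 1) → ℕ := fun α =>
      Fin.cons (s - T.card - ∑ k, q α k) (q α)
    have hts : ∀ α, (∀ j, α j % D = (r j).val) → ts D α = T.card := by
      intro α h; simp only [ts, hT, h]
    have hqs : ∀ α ∈ BB m s D, ∑ k, q α k = qs D α := by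
      intro α hα
      have h1 := ((mem_BB hD hs).1 hα).1
      unfold qs
      let e : Fin (m - s) ↪ Fin m := ⟨fun k => ⟨k.val, by lia⟩, fun a b h => by
        simpa [Fin.ext_iff] using h⟩
      have : ∑ k, q α k = ∑ j ∈ Finset.univ.map e, α j / D := by
        rw [Finset.sum_map]; rfl
      rw [this]
      refine Finset.sum_subset (Finset.subset_univ _) fun j _ hj => ?_
      refine Nat.div_eq_of_lt (h1 j ?_)
      by_contra hlt
      push Not at hlt
      apply hj
      simp only [Finset.mem_map, Finset.mem_univ, true_and]
      exact ⟨⟨j.val, hlt⟩, rfl⟩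
    refine Finset.card_le_card_of_injOn (fun α => Finsupp.equivFunOnFinite.symm (v α)) ?_ ?_
    · intro α hα
      have hα := Finset.mem_filter.1 hα
      have h1 := ((mem_BB hD hs).1 hα.1).2
      have h2 := hqs α hα.1
      have h3 := hts α hα.2
      rw [Finset.mem_coe, Finset.mem_finsuppAntidiag]
      refine ⟨?_, Finset.subset_univ _⟩
      simp only [Finsupp.equivFunOnFinite_symm_apply_apply, v]
      rw [Fin.sum_univ_succ]
      simp only [Fin.cons_zero, Fin.cons_succ]
      lia
    · intro α hα β hβ h
      have hα := Finset.mem_filter.1 hα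
      have hβ := Finset.mem_filter.1 hβ
      have hv : v α = v β := Finsupp.equivFunOnFinite.symm.injective h
      have hq : q α = q β := by
        funext k
        have := congrFun hv k.succ
        simpa [v] using this
      ext j
      have h1 := Nat.div_add_mod (α j) D
      have h2 := Nat.div_add_mod (β j) D
      rw [hα.2 j] at h1
      rw [hβ.2 j] at h2
      have : α j / D = β j / D := by
        by_cases hj : j.val < m - s
        · exact congrFun hq ⟨j.val, hj⟩
        · rw [Nat.div_eq_of_lt (((mem_BB hD hs).1 hα.1).1 j (by lia)),
            Nat.div_eq_of_lt (((mem_BB hD hs).1 hβ.1).1 j (by lia))]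
      rw [this] at h1
      lia
  · have : ((BB m s D).filter fun α => ∀ j, α j % D = (r j).val) = ∅ := by
      rw [Finset.filter_eq_empty_iff]
      intro α hα h
      have h1 := ((mem_BB hD hs).1 hα).2
      have hts : ts D α = T.card := by simp only [ts, hT, h]
      lia
    rw [this]; simp

lemma card_BB (hD : 1 ≤ D) (hs : s ≤ m) : (BB m s D).card ≤ N0 m s D := by
  classical
  let ρ : (Fin m →₀ ℕ) → Fin m → Fin D := fun α j => ⟨α j % D, Nat.mod_lt _ hD⟩
  have h1 := Finset.card_eq_sum_card_fiberwise (s := BB m s D) (f := ρ) (t := Finset.univ)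
    (fun _ _ => by simp)
  have h2 : ∀ r, (BB m s D).filter (fun α => ρ α = r) =
      (BB m s D).filter fun α => ∀ j, α j % D = (r j).val := by
    intro r; ext α
    simp [ρ, funext_iff, Fin.ext_iff]
  simp only [h2] at h1
  rw [h1]
  refine (Finset.sum_le_sum fun r _ => fiber_count hD hs r).trans ?_
  simp only [Finset.card_filter]
  rw [Finset.sum_comm]
  have h3 : ∀ S ∈ Finset.powersetCard s (Finset.univ : Finset (Fin m)),
      (∑ r : Fin m → Fin D, if (Finset.univ.filter fun j => (r j).val = D - 1) ⊆ S then 1 else 0) =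
      D ^ s * (D - 1) ^ (m - s) := by
    intro S hS
    have hS := (Finset.mem_powersetCard.1 hS).2
    rw [← Finset.card_filter]
    have : (Finset.univ.filter fun r : Fin m → Fin D =>
        (Finset.univ.filter fun j => (r j).val = D - 1) ⊆ S) =
        Fintype.piFinset fun j => if j ∈ S then Finset.univ else
          Finset.univ.filter fun a : Fin D => a.val ≠ D - 1 := by
      ext r
      simp only [Finset.mem_filter, Finset.mem_univ, true_and, Fintype.mem_piFinset,
        Finset.subset_iff]
      refine forall_congr' fun j => ?_
      split_ifs with hj <;> simp [hj]
    rw [this, Fintype.card_piFinset]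
    have h5 : (Finset.univ.filter fun a : Fin D => a.val ≠ D - 1).card = D - 1 := by
      obtain ⟨E, rfl⟩ : ∃ E, D = E + 1 := ⟨D - 1, by lia⟩
      have : (Finset.univ.filter fun a : Fin (E + 1) => a.val ≠ E + 1 - 1) =
          {Fin.last E}ᶜ := by
        ext a; simp [Fin.ext_iff]
      rw [this, Finset.card_compl]; simp
    have h6 : ∀ j, (if j ∈ S then Finset.univ else
          Finset.univ.filter fun a : Fin D => a.val ≠ D - 1).card = if j ∈ S then D else D - 1 := by
      intro j; split_ifs <;> simp [h5]
    simp only [h6]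
    rw [Finset.prod_ite]
    simp only [Finset.prod_const]
    congr 2
    · rw [← hS]; congr 1; ext; simp
    · have h1 := Finset.card_compl S
      rw [hS, Fintype.card_fin] at h1
      rw [← h1]; congr 1; ext; simp
  rw [Finset.sum_congr rfl h3]
  simp [N0, mul_comm]

end count
end HP

namespace HP

section vv
variable {m s D : ℕ} {k R S : Type*} [CommRing k] [CommRing R] [CommRing S] [Algebra k R]
  [Algebra k S]

def vv (D : ℕ) (B : Finset (Fin m →₀ ℕ)) (u : (Fin m →₀ ℕ) → k)
    (H : GI m s → MvPolynomial (Fin m) k) (F : Fin s → MvPolynomial (Fin m) R) :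
    MvPolynomial (Fin m) R :=
  ∑ b ∈ B, monomial b (algebraMap k R (u b)) + ∑ g, map (algebraMap k R) (H g) * gen D F g

lemma vv_map (B : Finset (Fin m →₀ ℕ)) (u : (Fin m →₀ ℕ) → k)
    (H : GI m s → MvPolynomial (Fin m) k) (F : Fin s → MvPolynomial (Fin m) R) (θ : R →ₐ[k] S) :
    map (θ : R →+* S) (vv D B u H F) = vv D B u H (fun i => map (θ : R →+* S) (F i)) := by
  simp only [vv, map_add, map_sum, map_mul, gen_map, map_monomial]
  congr 1
  · simp
  · refine Finset.sum_congr rfl fun g _ => ?_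
    congr 1
    rw [MvPolynomial.map_map]
    have : (θ : R →+* S).comp (algebraMap k R) = algebraMap k S := by
      apply RingHom.ext; intro a; simp
    rw [this]

def GG (D d : ℕ) (B : Finset (Fin m →₀ ℕ)) (u : (Fin m →₀ ℕ) → (Fin m →₀ ℕ) → k)
    (H : (Fin m →₀ ℕ) → GI m s → MvPolynomial (Fin m) k) (F : Fin s → MvPolynomial (Fin m) R) :
    Matrix (Mon m d) (Mon m d) R :=
  Matrix.of fun μ ν => coeff ν.1 (vv D B (u μ.1) (H μ.1) F)

lemma GG_map (d : ℕ) (B : Finset (Fin m →₀ ℕ)) (u : (Fin m →₀ ℕ) → (Fin m →₀ ℕ) → k)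
    (H : (Fin m →₀ ℕ) → GI m s → MvPolynomial (Fin m) k) (F : Fin s → MvPolynomial (Fin m) R)
    (θ : R →ₐ[k] S) :
    GG D d B u H (fun i => map (θ : R →+* S) (F i)) = (GG D d B u H F).map θ := by
  ext μ ν
  simp only [GG, Matrix.of_apply, Matrix.map_apply]
  rw [← vv_map, coeff_map]
  rfl

lemma GG_det_map (d : ℕ) (B : Finset (Fin m →₀ ℕ)) (u : (Fin m →₀ ℕ) → (Fin m →₀ ℕ) → k)
    (H : (Fin m →₀ ℕ) → GI m s → MvPolynomial (Fin m) k) (F : Fin s → MvPolynomial (Fin m) R)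
    (θ : R →ₐ[k] S) :
    (GG D d B u H (fun i => map (θ : R →+* S) (F i))).det = θ (GG D d B u H F).det := by
  rw [GG_map, ← RingHom.coe_coe θ, RingHom.map_det]; rfl

/-- filtered data -/
def IsData (D d : ℕ) (B : Finset (Fin m →₀ ℕ)) (u : (Fin m →₀ ℕ) → (Fin m →₀ ℕ) → k)
    (H : (Fin m →₀ ℕ) → GI m s → MvPolynomial (Fin m) k) : Prop :=
  ∀ μ ∈ Mon m d, (∀ b ∈ B, u μ b ∈ (triv k).w ((d : ℤ) - (b.degree : ℤ))) ∧
    (∀ g, H μ g ∈ Fil (triv k) m ((d : ℤ) - gdeg m s D g))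

lemma triv_hom {k R : Type*} [CommRing k] [CommRing R] (ψ : k →+* R) : ∀ j a, a ∈ (triv k).w j → ψ a ∈ (triv R).w j := by
  intro j a ha
  rw [triv_mem] at ha ⊢
  intro h; rw [ha h, map_zero]

lemma vv_InN {d : ℕ} {B : Finset (Fin m →₀ ℕ)} {u : (Fin m →₀ ℕ) → (Fin m →₀ ℕ) → k}
    {H : (Fin m →₀ ℕ) → GI m s → MvPolynomial (Fin m) k} (hd : IsData D d B u H)
    (F : Fin s → MvPolynomial (Fin m) R) (μ : Fin m →₀ ℕ) (hμ : μ ∈ Mon m d) :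
    InN (triv R) D B F d (vv D B (u μ) (H μ) F) :=
  ⟨fun b => algebraMap k R (u μ b), fun g => map (algebraMap k R) (H μ g),
    fun b hb => triv_hom _ _ _ ((hd μ hμ).1 b hb),
    fun g => Fil_map _ (triv_hom _) ((hd μ hμ).2 g), rfl⟩

lemma InN.mem_Fil (hD : 1 ≤ D) {W : Filt R} {B : Finset (Fin m →₀ ℕ)}
    {F : Fin s → MvPolynomial (Fin m) R}
    (hF : ∀ i, F i ∈ Fil W m D) {d : ℤ} {p : MvPolynomial (Fin m) R} (h : InN W D B F d p) :
    p ∈ Fil W m d := by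
  obtain ⟨u, H, h1, h2, rfl⟩ := h
  refine add_mem (sum_mem fun b hb => Fil_monomial (h1 b hb)) (sum_mem fun g _ => ?_)
  exact Fil_mono (by lia) (Fil_mul (h2 g) (gen_mem hD hF g))

lemma sum_Mon {d : ℕ} {p : MvPolynomial (Fin m) R} (hp : p ∈ Fil (triv R) m d) :
    p = ∑ ν : Mon m d, monomial ν.1 (coeff ν.1 p) := by
  rw [Finset.sum_coe_sort (Mon m d) (fun ν => monomial ν (coeff ν p))]
  conv_lhs => rw [p.as_sum]
  refine Finset.sum_subset (fun ν hν => ?_) (fun ν _ hν => ?_)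
  · rw [mem_Mon]
    by_contra hc
    exact (mem_support_iff.1 hν) ((triv_mem.1 (hp ν)) (by lia))
  · rw [notMem_support_iff.1 hν, map_zero]

/-- If the matrix is invertible, all monomials are in `InN`. -/
lemma InN_of_det (hD : 1 ≤ D) {d : ℕ} {B : Finset (Fin m →₀ ℕ)}
    {u : (Fin m →₀ ℕ) → (Fin m →₀ ℕ) → k}
    {H : (Fin m →₀ ℕ) → GI m s → MvPolynomial (Fin m) k} (hd : IsData D d B u H)
    (F : Fin s → MvPolynomial (Fin m) R) (hF : ∀ i, F i ∈ Fil (triv R) m D)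
    (hdet : IsUnit (GG D d B u H F).det) (ν : Fin m →₀ ℕ) (hν : ν ∈ Mon m d) :
    InN (triv R) D B F d (monomial ν 1) := by
  set G := GG D d B u H F with hG
  have h1 : ∀ μ : Mon m d, vv D B (u μ.1) (H μ.1) F = ∑ ν' : Mon m d, monomial ν'.1 (G μ ν') :=
    fun μ => sum_Mon ((vv_InN hd F μ.1 μ.2).mem_Fil hD hF)
  have h2 : monomial ν (1 : R) = ∑ μ : Mon m d, C (G⁻¹ ⟨ν, hν⟩ μ) * vv D B (u μ.1) (H μ.1) F := by
    simp only [h1, Finset.mul_sum, C_mul_monomial]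
    rw [Finset.sum_comm]
    have h3 : ∀ ν' : Mon m d, ∑ μ : Mon m d, monomial ν'.1 (G⁻¹ ⟨ν, hν⟩ μ * G μ ν') =
        monomial ν'.1 ((1 : Matrix (Mon m d) (Mon m d) R) ⟨ν, hν⟩ ν') := by
      intro ν'
      rw [← map_sum, ← Matrix.nonsing_inv_mul G hdet, Matrix.mul_apply]
    simp only [h3]
    rw [Finset.sum_eq_single ⟨ν, hν⟩]
    · simp
    · intro b _ hb
      rw [Matrix.one_apply_ne (Ne.symm hb), map_zero]
    · simp
  rw [h2]
  refine InN.sum fun μ _ => ?_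
  refine (vv_InN hd F μ.1 μ.2).C_mul (k := 0) (by lia) (triv_w_of_nonneg le_rfl _)

lemma exists_data {d : ℕ} {B : Finset (Fin m →₀ ℕ)} {F : Fin s → MvPolynomial (Fin m) k}
    (h : ∀ μ ∈ Mon m d, InN (triv k) D B F d (monomial μ 1)) :
    ∃ (u : (Fin m →₀ ℕ) → (Fin m →₀ ℕ) → k) (H : (Fin m →₀ ℕ) → GI m s → MvPolynomial (Fin m) k),
      IsData D d B u H ∧ GG D d B u H F = 1 := by
  classical
  choose! u H h1 h2 h3 using h
  refine ⟨u, H, fun μ hμ => ⟨h1 μ hμ, h2 μ hμ⟩, ?_⟩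
  ext μ ν
  simp only [GG, Matrix.of_apply, vv]
  have := h3 μ.1 μ.2
  simp only [Algebra.algebraMap_self, RingHom.id_apply, map_id]
  rw [← this, coeff_monomial, Matrix.one_apply]
  by_cases hμν : μ = ν
  · rw [if_pos hμν, if_pos (by rw [hμν])]
  · rw [if_neg hμν, if_neg (fun h => hμν (Subtype.ext h))]

end vv

section red
variable {m s D t : ℕ}

lemma C_filt : ∀ k a, a ∈ (triv ℚ).w k → (C a : MvPolynomial (Fin t) ℚ) ∈ (tdeg t).w k := by
  intro k a ha
  rw [triv_mem] at ha
  rw [tdeg_mem]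
  by_cases h : k < 0
  · left; rw [ha h, map_zero]
  · right; rw [totalDegree_C]; lia

lemma red_step {R : Type*} [CommRing R] {W : Filt R} {B : Finset (Fin m →₀ ℕ)}
    {F : Fin s → MvPolynomial (Fin m) R} (γ : Fin m →₀ ℕ) (j : Fin m)
    (h : InN W D B F γ.degree (monomial γ 1))
    (hB : ∀ b ∈ B, InN W D B F ((b.degree + 1 : ℕ) : ℤ) (monomial (b + Finsupp.single j 1) 1)) :
    InN W D B F ((γ.degree + 1 : ℕ) : ℤ) (monomial (γ + Finsupp.single j 1) 1) := by
  obtain ⟨u, H, h1, h2, h3⟩ := h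
  have : monomial (γ + Finsupp.single j 1) (1 : R) =
      ∑ b ∈ B, C (u b) * monomial (b + Finsupp.single j 1) 1 +
        ∑ g, (X j * H g) * gen D F g := by
    have e : ∀ (b : Fin m →₀ ℕ) (r : R),
      monomial (b + Finsupp.single j 1) r = X j * monomial b r := by
      intro b r; rw [monomial_add_single, pow_one, mul_comm]
    rw [e, h3, mul_add, Finset.mul_sum, Finset.mul_sum]
    congr 1
    · refine Finset.sum_congr rfl fun b _ => ?_
      rw [← e, C_mul_monomial, mul_one]
    · refine Finset.sum_congr rfl fun g _ => ?_
      rw [mul_assoc]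
  rw [this]
  refine InN.add (InN.sum fun b hb => ?_) (InN.sum fun g _ => InN.gen_mul g ?_)
  · exact (hB b hb).C_mul (by push_cast; lia) (h1 b hb)
  · have := Fil_mul (Fil_X le_rfl j) (h2 g)
    refine Fil_mono (by push_cast; lia) this

theorem red (hD : 1 ≤ D) (F : Fin s → MvPolynomial (Fin m) (MvPolynomial (Fin t) ℚ))
    (hF : ∀ i, F i ∈ Fil (tdeg t) m D)
    (h : ∀ γ : Fin m →₀ ℕ, γ.degree ≤ MM m s D + 1 →
      InN (triv ℚ) D (BB m s D) (fun i => map constantCoeff (F i)) γ.degree (monomial γ 1))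
    (d : ℕ) : ∀ γ : Fin m →₀ ℕ, γ.degree = d →
    InN (tdeg t) D (BB m s D) F γ.degree (monomial γ 1) := by
  induction d using Nat.strong_induction_on with
  | _ d ih =>
  intro γ hγ
  by_cases hd : d ≤ MM m s D + 1
  · obtain ⟨u, H, h1, h2, h3⟩ := h γ (by lia)
    set p : MvPolynomial (Fin m) (MvPolynomial (Fin t) ℚ) :=
      ∑ b ∈ BB m s D, monomial b (C (u b)) + ∑ g, map C (H g) * gen D F g with hp
    have hpN : InN (tdeg t) D (BB m s D) F γ.degree p :=
      ⟨fun b => C (u b), fun g => map C (H g), fun b hb => C_filt _ _ (h1 b hb),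
        fun g => Fil_map C C_filt (h2 g), rfl⟩
    have hmon : monomial γ (1 : MvPolynomial (Fin t) ℚ) ∈ Fil (tdeg t) m γ.degree :=
      Fil_monomial (one_mem_w (by lia))
    have hE : monomial γ 1 - p ∈ Fil (tdeg t) m γ.degree := sub_mem hmon (hpN.mem_Fil hD hF)
    have hE0 : map constantCoeff (monomial γ 1 - p) = 0 := by
      rw [map_sub, map_monomial, map_one, h3, hp]
      simp only [map_add, map_sum, map_mul, map_monomial, constantCoeff_C, gen_map,
        MvPolynomial.map_map]
      have : (constantCoeff : MvPolynomial (Fin t) ℚ →+* ℚ).comp C = RingHom.id ℚ := by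
        apply RingHom.ext; intro a; simp
      simp only [this, MvPolynomial.map_id, RingHom.id_apply, sub_self]
    have : monomial γ 1 = p + (monomial γ 1 - p) := (add_sub_cancel _ _).symm
    rw [this]
    refine hpN.add ?_
    rw [MvPolynomial.as_sum (monomial γ 1 - p)]
    refine InN.sum fun α hα => ?_
    have h5 := hE α
    have h6 : constantCoeff (coeff α (monomial γ 1 - p)) = 0 := by
      rw [← coeff_map, hE0, coeff_zero]
    have h7 := mem_support_iff.1 hα
    have hlt : α.degree < d := by
      by_contra hc
      rcases tdeg_mem.1 h5 with h8 | h8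
      · exact h7 h8
      · have h9 : (coeff α (monomial γ 1 - p)).totalDegree = 0 := by lia
        rw [totalDegree_eq_zero_iff_eq_C] at h9
        apply h7
        rw [h9, ← constantCoeff_eq, h6, map_zero]
    have := (ih _ hlt α rfl).C_mul (k := (γ.degree : ℤ) - α.degree)
      (e := (γ.degree : ℤ)) (sub_add_cancel _ _) h5
    rwa [C_mul_monomial, mul_one] at this
  · have hne : γ ≠ 0 := by rintro rfl; simp at hγ; lia
    obtain ⟨j, hj⟩ : ∃ j, γ j ≠ 0 := by
      by_contra hc; push Not at hc; exact hne (Finsupp.ext hc)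
    have hle : Finsupp.single j 1 ≤ γ := by
      simp; lia
    obtain ⟨γ', rfl⟩ : ∃ γ', γ = γ' + Finsupp.single j 1 :=
      ⟨γ - Finsupp.single j 1, (tsub_add_cancel_of_le hle).symm⟩
    have hdeg : γ'.degree + 1 = d := by rw [← hγ, map_add]; simp
    rw [hγ, ← hdeg]
    exact red_step γ' j (ih γ'.degree (by lia) γ' rfl) (fun b hb => by
      have hb' := BB_deg hb
      have hbd : (b + Finsupp.single j 1).degree = b.degree + 1 := by rw [map_add]; simp
      have := ih _ (by lia) (b + Finsupp.single j 1) rfl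
      rwa [hbd] at this)

end red

section sys
variable {n t m : ℕ}

/-- Keep the first `m` of the `x`-variables. -/
def keepX (n m : ℕ) (R : Type*) [CommRing R] (j : Fin n) : MvPolynomial (Fin m) R :=
  if h : j.val < m then X ⟨j.val, h⟩ else 0

def Psi (n t m : ℕ) : MvPolynomial (Fin n ⊕ Fin t) ℚ →ₐ[ℚ]
    MvPolynomial (Fin m) (MvPolynomial (Fin t) ℚ) :=
  aeval (Sum.elim (keepX n m _) (fun l => C (X l)))

def Psi0 (n t m : ℕ) (R : Type*) [CommRing R] : MvPolynomial (Fin n ⊕ Fin t) R →ₐ[R]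
    MvPolynomial (Fin m) R :=
  aeval (Sum.elim (keepX n m _) (fun _ => 0))

lemma keepX_map {R S : Type*} [CommRing R] [CommRing S] (ψ : R →+* S) (j : Fin n) :
    map ψ (keepX n m R j) = keepX n m S j := by
  unfold keepX; split_ifs <;> simp

lemma Psi_const (f : MvPolynomial (Fin n ⊕ Fin t) ℚ) :
    map constantCoeff (Psi n t m f) = Psi0 n t m ℚ f := by
  have : (map constantCoeff : MvPolynomial (Fin m) (MvPolynomial (Fin t) ℚ) →+*
      MvPolynomial (Fin m) ℚ).comp (Psi n t m).toRingHom = (Psi0 n t m ℚ).toRingHom := by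
    apply MvPolynomial.ringHom_ext
    · intro a; simp
    · rintro (j | l)
      · simp [Psi, Psi0, keepX_map]
      · simp [Psi, Psi0]
  exact RingHom.congr_fun this f

lemma Psi0_map {R S : Type*} [CommRing R] [CommRing S] (ψ : R →+* S)
    (f : MvPolynomial (Fin n ⊕ Fin t) R) :
    map ψ (Psi0 n t m R f) = Psi0 n t m S (map ψ f) := by
  have : (map ψ : MvPolynomial (Fin m) R →+* MvPolynomial (Fin m) S).comp
      (Psi0 n t m R).toRingHom = (Psi0 n t m S).toRingHom.comp (map ψ) := by
    apply MvPolynomial.ringHom_ext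
    · intro a; simp [Psi0]
    · rintro (j | l)
      · simp [Psi0, keepX_map]
      · simp [Psi0]
  exact RingHom.congr_fun this f

lemma keepX_Fil {R : Type*} [CommRing R] {W : Filt R} (j : Fin n) :
    keepX n m R j ∈ Fil W m 1 := by
  unfold keepX; split_ifs
  · exact Fil_X le_rfl _
  · exact zero_mem _

lemma aeval_Fil {k R σ : Type*} [CommRing k] [CommRing R] [Algebra k R] {W : Filt R}
    (hW : ∀ a : k, algebraMap k R a ∈ W.w 0)
    (v : σ → MvPolynomial (Fin m) R) (hv : ∀ j, v j ∈ Fil W m 1) (f : MvPolynomial σ k) {D : ℕ}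
    (hf : f.totalDegree ≤ D) : aeval v f ∈ Fil W m D := by
  rw [aeval_def, eval₂_eq]
  refine sum_mem fun γ hγ => ?_
  have h1 := Fil_prod (W := W) γ.support (fun i => v i ^ γ i) (fun i => γ i * 1)
    (fun i _ => Fil_pow (hv i) (γ i))
  have h2 : algebraMap k (MvPolynomial (Fin m) R) (coeff γ f) ∈ Fil W m 0 := by
    rw [IsScalarTower.algebraMap_apply k R (MvPolynomial (Fin m) R), algebraMap_eq]
    exact Fil_C (hW _)
  refine Fil_mono ?_ (Fil_mul h2 h1)
  have h3 := (le_totalDegree hγ).trans hf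
  have h4 : (γ.sum fun _ e => e) = ∑ i ∈ γ.support, γ i := rfl
  rw [h4] at h3
  simp only [mul_one, zero_add]
  exact_mod_cast h3

lemma Psi_Fil (f : MvPolynomial (Fin n ⊕ Fin t) ℚ) {D : ℕ} (hf : f.totalDegree ≤ D) :
    Psi n t m f ∈ Fil (tdeg t) m D := by
  refine aeval_Fil ?_ _ ?_ f hf
  · intro a; rw [tdeg_mem]; right; simp [algebraMap_eq]
  · rintro (j | l)
    · exact keepX_Fil j
    · refine Fil_C ?_
      rw [tdeg_mem]; right; simp

lemma Psi0_Fil {R : Type*} [CommRing R] (f : MvPolynomial (Fin n ⊕ Fin t) R) {D : ℕ}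
    (hf : f.totalDegree ≤ D) : Psi0 n t m R f ∈ Fil (triv R) m D := by
  refine aeval_Fil ?_ _ ?_ f hf
  · intro a; exact triv_w_of_nonneg le_rfl _
  · rintro (j | l)
    · exact keepX_Fil j
    · exact zero_mem _

lemma Psi0_rename (hm : m ≤ n) {R : Type*} [CommRing R] (p : MvPolynomial (Fin m) R) :
    Psi0 n t m R (rename (Sum.inl ∘ Fin.castLE hm) p) = p := by
  rw [Psi0, aeval_rename]
  have : (Sum.elim (keepX n m R) (fun _ : Fin t => (0 : MvPolynomial (Fin m) R))) ∘
      (Sum.inl ∘ Fin.castLE hm) = X := by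
    funext j; simp [keepX]
  rw [this, aeval_X_left]; rfl

end sys

section F0facts
variable {m s D ρ : ℕ} {R : Type*} [CommRing R]

lemma F0_Fil (hD : 1 ≤ D) (W : Filt R) (i : Fin s) : F0 m s D ρ R i ∈ Fil W m D := by
  have hn : ∀ (a b : ℕ), ((a : MvPolynomial (Fin m) R)) ^ b ∈ Fil W m 0 := by
    intro a b; rw [← Nat.cast_pow]; exact Fil_natCast le_rfl _
  refine sub_mem (sum_mem fun j _ => ?_) (Fil_mono (by lia) (hn _ _))
  refine Fil_mono (d := 0 + D) (by lia) (Fil_mul (hn _ _) (sub_mem ?_ ?_))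
  · simpa using Fil_pow (W := W) (Fil_X le_rfl j) D
  · exact Fil_mono (d := 0 + 1) (by lia) (Fil_mul (Fil_natCast le_rfl _) (Fil_X le_rfl j))

end F0facts

section openset

lemma tot_map_le {σ R S : Type*} [CommSemiring R] [CommSemiring S] (ψ : R →+* S)
    (f : MvPolynomial σ R) : (map ψ f).totalDegree ≤ f.totalDegree :=
  Finset.sup_mono (support_map_subset ψ f)

variable {n t m s D : ℕ}

lemma eval_toHom {σ : Type*} (x : σ → ℂ) : ∃ θ : MvPolynomial σ ℂ →ₐ[ℚ] ℂ,
    ∀ p, θ p = eval x p := ⟨(aeval x : MvPolynomial σ ℂ →ₐ[ℂ] ℂ).restrictScalars ℚ, fun p => rfl⟩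

/-- The open set: existence of a polynomial condition. -/
theorem exists_open (hD : 1 ≤ D) (hs : s ≤ m) (hm : m ≤ n) :
    ∃ P : MvPolynomial (Fin s × ((Fin n ⊕ Fin t) →₀ ℕ)) ℂ,
      (∃ f : Fin s → MvPolynomial (Fin n ⊕ Fin t) ℂ, (∀ i, (f i).totalDegree ≤ D) ∧
        eval (fun im => coeff im.2 (f im.1)) P ≠ 0) ∧
      ∀ f : Fin s → MvPolynomial (Fin n ⊕ Fin t) ℚ, (∀ i, (f i).totalDegree ≤ D) →
        eval (fun im => coeff im.2 (map (algebraMap ℚ ℂ) (f im.1))) P ≠ 0 →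
        ∀ γ : Fin m →₀ ℕ, InN (tdeg t) D (BB m s D) (fun i => Psi n t m (f i)) γ.degree
          (monomial γ 1) := by
  classical
  have hdat : ∀ d : ℕ, ∃ (u : (Fin m →₀ ℕ) → (Fin m →₀ ℕ) → ℚ)
      (H : (Fin m →₀ ℕ) → GI m s → MvPolynomial (Fin m) ℚ),
      IsData D d (BB m s D) u H ∧ GG D d (BB m s D) u H (F0 m s D 0 ℚ) = 1 := by
    intro d
    refine exists_data fun μ hμ => ?_
    exact (span_F0 hD hs _ μ rfl).mono (by have := mem_Mon.1 hμ; lia)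
  choose u H hdata hGG using hdat
  let σ := Fin s × ((Fin n ⊕ Fin t) →₀ ℕ)
  have hfin : {γ : Fin n ⊕ Fin t →₀ ℕ | γ.degree ≤ D}.Finite := Finsupp.finite_of_degree_le D
  let E := hfin.toFinset
  let Fu : Fin s → MvPolynomial (Fin m) (MvPolynomial σ ℂ) := fun i =>
    Psi0 n t m _ (∑ γ ∈ E, monomial γ (X (i, γ)))
  let P : MvPolynomial σ ℂ := ∏ d ∈ Finset.range (MM m s D + 2),
    (GG D d (BB m s D) (u d) (H d) Fu).det
  have hev : ∀ f : Fin s → MvPolynomial (Fin n ⊕ Fin t) ℂ, (∀ i, (f i).totalDegree ≤ D) →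
      eval (fun im => coeff im.2 (f im.1)) P = ∏ d ∈ Finset.range (MM m s D + 2),
        (GG D d (BB m s D) (u d) (H d) (fun i => Psi0 n t m ℂ (f i))).det := by
    intro f hf
    obtain ⟨θ, hθ⟩ := eval_toHom (fun im : σ => coeff im.2 (f im.1))
    rw [← hθ, map_prod]
    refine Finset.prod_congr rfl fun d _ => ?_
    rw [← GG_det_map]
    congr 2
    funext i
    simp only [Fu]
    rw [Psi0_map]
    congr 1
    rw [map_sum]
    conv_rhs => rw [(f i).as_sum]
    symm
    simp only [map_monomial, RingHom.coe_coe, hθ, eval_X]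
    refine Finset.sum_subset (fun γ hγ => ?_) (fun γ _ hγ => ?_)
    · simp only [E, Set.Finite.mem_toFinset]
      exact (le_totalDegree hγ).trans (hf i)
    · rw [notMem_support_iff.1 hγ, map_zero]
  refine ⟨P, ⟨fun i => rename (Sum.inl ∘ Fin.castLE hm) (F0 m s D 0 ℂ i), ?_, ?_⟩, ?_⟩
  · intro i
    refine (totalDegree_rename_le _ _).trans ?_
    exact Fil_triv.1 (F0_Fil hD _ i)
  · rw [hev (fun i => rename (Sum.inl ∘ Fin.castLE hm) (F0 m s D 0 ℂ i))]
    · rw [Finset.prod_ne_zero_iff]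
      intro d _
      simp only [Psi0_rename hm]
      have : (fun i => F0 m s D 0 ℂ i) = fun i => map ((Algebra.ofId ℚ ℂ : ℚ →ₐ[ℚ] ℂ) : ℚ →+* ℂ)
          (F0 m s D 0 ℚ i) := by
        funext i; rw [F0_map]
      rw [this, GG_det_map]
      have h2 : (fun i => F0 m s D 0 ℚ i) = F0 m s D 0 ℚ := rfl
      rw [hGG]; simp
    · intro i
      refine (totalDegree_rename_le _ _).trans ?_
      exact Fil_triv.1 (F0_Fil hD _ i)
  · intro f hf hne γ
    rw [hev (fun i => map (algebraMap ℚ ℂ) (f i))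
      (fun i => (tot_map_le _ _).trans (hf i)), Finset.prod_ne_zero_iff] at hne
    refine red hD _ (fun i => Psi_Fil (f i) (hf i)) (fun γ hγ => ?_) _ γ rfl
    simp only [Psi_const]
    refine InN_of_det hD (hdata γ.degree) _ (fun i => Psi0_Fil (f i) (hf i)) ?_ γ
      (mem_Mon.2 le_rfl)
    rw [isUnit_iff_ne_zero]
    intro h0
    apply hne γ.degree (by simp; lia)
    have : (fun i => Psi0 n t m ℂ (map (algebraMap ℚ ℂ) (f i))) =
        fun i => map ((Algebra.ofId ℚ ℂ : ℚ →ₐ[ℚ] ℂ) : ℚ →+* ℂ) (Psi0 n t m ℚ (f i)) := by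
      funext i; rw [Psi0_map]; rfl
    rw [this, GG_det_map, h0, map_zero]

end openset
end HP

namespace HP

section ift
open Filter Topology

lemma ift {E G : Type*} [NormedAddCommGroup E] [NormedSpace ℂ E] [FiniteDimensional ℂ E]
    [NormedAddCommGroup G] [NormedSpace ℂ G] [FiniteDimensional ℂ G]
    (hdim : Module.finrank ℂ E = Module.finrank ℂ G)
    (f : ℂ × E → G) (z0 : E) (hf : ContDiff ℂ 1 f) (h0 : f (0, z0) = 0)
    (hinj : ∀ v : E, HasDerivAt (fun ε : ℂ => f (0, z0 + ε • v)) 0 0 → v = 0)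
    (U : Set E) (hU : U ∈ 𝓝 z0) : ∀ᶠ τ in 𝓝 (0 : ℂ), ∃ z ∈ U, f (τ, z) = 0 := by
  have := FiniteDimensional.complete ℂ E
  have := FiniteDimensional.complete ℂ G
  have h1 : HasStrictFDerivAt f (fderiv ℂ f (0, z0)) (0, z0) :=
    hf.hasStrictFDerivAt one_ne_zero
  have h2 : HasStrictFDerivAt (fun p : ℂ × E => (p.1, f p))
      ((ContinuousLinearMap.fst ℂ ℂ E).prod (fderiv ℂ f (0, z0))) (0, z0) :=
    hasStrictFDerivAt_fst.prodMk h1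
  set T := (ContinuousLinearMap.fst ℂ ℂ E).prod (fderiv ℂ f (0, z0)) with hT
  have hTinj : Function.Injective (T : ℂ × E →ₗ[ℂ] ℂ × G) := by
    rw [← LinearMap.ker_eq_bot, LinearMap.ker_eq_bot']
    rintro ⟨a, v⟩ hav
    have ha : a = 0 := congrArg Prod.fst hav
    have hv : fderiv ℂ f (0, z0) (a, v) = 0 := congrArg Prod.snd hav
    subst ha
    have hl : HasDerivAt (fun ε : ℂ => ((0 : ℂ), z0 + ε • v)) ((0 : ℂ), v) 0 := by
      refine (hasDerivAt_const _ _).prodMk ?_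
      simpa using ((hasDerivAt_id (0 : ℂ)).smul_const v).const_add z0
    have hl2 : HasFDerivAt f (fderiv ℂ f (0, z0)) ((0 : ℂ), z0 + (0 : ℂ) • v) := by
      simpa using h1.hasFDerivAt
    have h3 := hl2.comp_hasDerivAt (0 : ℂ) hl
    rw [hv] at h3
    rw [hinj v h3]; rfl
  have hTs : T.range = ⊤ := by
    rw [LinearMap.range_eq_top]
    refine (LinearMap.injective_iff_surjective_of_finrank_eq_finrank ?_).1 hTinj
    simp [hdim]
  have h3 := h2.map_nhds_eq_of_surj hTs
  rw [h0] at h3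
  have h4 : (Prod.snd ⁻¹' U : Set (ℂ × E)) ∈ 𝓝 ((0 : ℂ), z0) :=
    continuous_snd.continuousAt.preimage_mem_nhds hU
  have h5 := image_mem_map (m := fun p : ℂ × E => (p.1, f p)) h4
  rw [h3] at h5
  have h6 : Tendsto (fun τ : ℂ => (τ, (0 : G))) (𝓝 0) (𝓝 (0, 0)) := by
    exact (continuous_id.prodMk continuous_const).tendsto' _ _ rfl
  filter_upwards [h6 h5] with τ hτ
  obtain ⟨⟨a, z⟩, hz, hz2⟩ := hτ
  simp only [Prod.mk.injEq] at hz2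
  obtain ⟨rfl, hz2⟩ := hz2
  exact ⟨z, hz, hz2⟩

end ift

section lagr
variable {m s D : ℕ} {K : Type*} [Field K]

lemma gen_lagr (D : ℕ) (x : Fin m → K) (F : Fin s → MvPolynomial (Fin m) K)
    (hF : ∀ i, eval x (F i) = 0) (w : Fin (s + 1) → K) (hw : w ≠ 0)
    (hL : ∀ j, ∑ i, w i * eval x (pderiv j
      ((Fin.cons (phi m K D) F : Fin (s + 1) → MvPolynomial (Fin m) K) i)) = 0) (g : GI m s) :
    eval x (gen D F g) = 0 := by
  rcases g with i | J
  · exact hF i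
  · rw [gen, RingHom.map_det]
    rw [← Matrix.exists_vecMul_eq_zero_iff]
    refine ⟨w, hw, ?_⟩
    funext k
    simpa [Matrix.vecMul, dotProduct] using hL (J k)

end lagr

section vand
variable {s : ℕ} {K ι : Type*} [Field K] [DecidableEq ι] (ν : ι → K)

def VT (s : ℕ) (P : Finset ι) : (Fin s → K) →ₗ[K] (P → K) where
  toFun c := fun j => ∑ k : Fin s, c k * ν j.1 ^ (k.val + 1)
  map_add' c c' := by funext j; simp [add_mul, Finset.sum_add_distrib]
  map_smul' a c := by funext j; simp [Finset.mul_sum, mul_assoc]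

def VU (s : ℕ) (P : Finset ι) : (P → K) →ₗ[K] (Fin s → K) where
  toFun z := fun k => ∑ j : P, ν j.1 ^ (k.val + 1) * z j
  map_add' c c' := by funext j; simp [mul_add, Finset.sum_add_distrib]
  map_smul' a c := by
    funext j; simp only [Finset.mul_sum, Pi.smul_apply, smul_eq_mul, RingHom.id_apply]
    exact Finset.sum_congr rfl fun _ _ => by ring

variable {ν} (hν : Function.Injective ν) (hν0 : ∀ j, ν j ≠ 0)
include hν hν0

lemma VT_surj {P : Finset ι} (hP : P.card ≤ s) : Function.Surjective (VT ν s P) := by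
  intro y
  choose c hc1 hc2 using fun i : P => V1 (s := s) ν hν hν0 P hP i.1 i.2
  refine ⟨∑ i : P, y i • c i, ?_⟩
  rw [map_sum]
  funext j
  simp only [map_smul, Finset.sum_apply, Pi.smul_apply, smul_eq_mul]
  rw [Finset.sum_eq_single j]
  · simp only [VT, LinearMap.coe_mk, AddHom.coe_mk]; rw [hc1, mul_one]
  · intro b _ hb
    simp only [VT, LinearMap.coe_mk, AddHom.coe_mk]
    rw [hc2 b j.1 j.2 (fun h => hb (Subtype.ext h.symm)), mul_zero]
  · simp

lemma VT_inj {P : Finset ι} (hP : P.card = s) : Function.Injective (VT ν s P) :=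
  (LinearMap.injective_iff_surjective_of_finrank_eq_finrank (by simp [hP])).2
    (VT_surj hν hν0 hP.le)

lemma VU_inj {P : Finset ι} (hP : P.card ≤ s) : Function.Injective (VU ν s P) := by
  rw [← LinearMap.ker_eq_bot, LinearMap.ker_eq_bot']
  intro z hz
  funext j
  obtain ⟨c, hc1, hc2⟩ := V1 (s := s) ν hν hν0 P hP j.1 j.2
  have h : ∑ k, c k * (VU ν s P z) k = 0 := by rw [hz]; simp
  simp only [VU, LinearMap.coe_mk, AddHom.coe_mk, Finset.mul_sum] at h
  rw [Finset.sum_comm] at h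
  simp only [← mul_assoc, ← Finset.sum_mul] at h
  rw [Finset.sum_eq_single j, hc1, one_mul] at h
  · exact h
  · intro b _ hb
    rw [hc2 b.1 b.2 (fun h => hb (Subtype.ext h)), zero_mul]
  · simp

lemma VU_surj {P : Finset ι} (hP : P.card = s) : Function.Surjective (VU ν s P) :=
  (LinearMap.injective_iff_surjective_of_finrank_eq_finrank (by simp [hP])).1
    (VU_inj hν hν0 hP.le)

omit [DecidableEq ι] hν0 in
lemma ell_ne (P : Finset ι) (hP : s < P.card) (c : Fin s → K) :
    ∃ j ∈ P, 1 + ∑ k, c k * ν j ^ (k.val + 1) ≠ 0 := by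
  by_contra hc
  push Not at hc
  let p : Polynomial K := 1 + ∑ k : Fin s, Polynomial.C (c k) * Polynomial.X ^ (k.val + 1)
  have hp : p = 0 := by
    classical
    refine Polynomial.eq_zero_of_natDegree_lt_card_of_eval_eq_zero' p (P.image ν) ?_ ?_
    · intro y hy
      obtain ⟨j, hj, rfl⟩ := Finset.mem_image.1 hy
      simpa [p, Polynomial.eval_finsetSum] using hc j hj
    · rw [Finset.card_image_of_injective _ hν]
      refine lt_of_le_of_lt ?_ hP
      refine Polynomial.natDegree_add_le_of_degree_le (by simp) ?_
      refine Polynomial.natDegree_sum_le_of_forall_le _ _ fun k _ => ?_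
      exact (Polynomial.natDegree_C_mul_X_pow_le _ _).trans (by lia)
  have : p.eval 0 = 1 := by simp [p, Polynomial.eval_finsetSum]
  rw [hp] at this; simp at this

end vand

section roots
open Filter

lemma enum_roots (p : Polynomial ℂ) (hp : ∀ x, p.eval x = 0 → p.derivative.eval x ≠ 0) :
    ∃ e : ℕ → ℂ, (∀ i < p.natDegree, p.eval (e i) = 0) ∧
      ∀ i < p.natDegree, ∀ j < p.natDegree, e i = e j → i = j := by
  classical
  by_cases hp0 : p = 0
  · subst hp0; exact ⟨fun _ => 0, by simp, by simp⟩
  have hnd : p.roots.Nodup := by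
    rw [Multiset.nodup_iff_count_le_one]
    intro a
    by_contra hc
    push Not at hc
    rw [Polynomial.count_roots] at hc
    obtain ⟨h1, h2⟩ := (Polynomial.one_lt_rootMultiplicity_iff_isRoot hp0).1 hc
    exact hp a h1 h2
  have hcard : p.roots.toFinset.card = p.natDegree := by
    rw [Multiset.toFinset_card_of_nodup hnd]
    exact (IsAlgClosed.splits p).natDegree_eq_card_roots.symm
  let E := (Fintype.equivFinOfCardEq (by rw [Fintype.card_coe]; exact hcard) :
    p.roots.toFinset ≃ Fin p.natDegree)
  refine ⟨fun i => if h : i < p.natDegree then (E.symm ⟨i, h⟩ : ℂ) else 0, ?_, ?_⟩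
  · intro i hi
    simp only [hi, dif_pos]
    have := (E.symm ⟨i, hi⟩).2
    rw [Multiset.mem_toFinset, Polynomial.mem_roots hp0] at this
    exact this
  · intro i hi j hj h
    simp only [hi, hj, dif_pos] at h
    have := E.symm.injective (Subtype.ext h)
    simpa using this

def g0 (D : ℕ) (x : ℂ) : ℂ := x ^ D - ((D - 1 : ℕ) : ℂ) * x
def g1 (D : ℕ) (x : ℂ) : ℂ := (D : ℂ) * x ^ (D - 1) - ((D - 1 : ℕ) : ℂ)
def g2 (D : ℕ) (x : ℂ) : ℂ := (D : ℂ) * (((D - 1 : ℕ) : ℂ) * x ^ (D - 1 - 1))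

lemma g2_ne {D : ℕ} (hD : 1 ≤ D) (x : ℂ) (h : g1 D x = 0) : g2 D x ≠ 0 := by
  unfold g1 at h
  unfold g2
  have hD0 : (D : ℂ) ≠ 0 := by exact_mod_cast (by lia : D ≠ 0)
  rcases Nat.lt_or_ge 1 D with h1 | h1
  · have hD1 : ((D - 1 : ℕ) : ℂ) ≠ 0 := by exact_mod_cast (by lia : D - 1 ≠ 0)
    have hx : x ≠ 0 := by
      rintro rfl
      rw [zero_pow (by lia), mul_zero, zero_sub, neg_eq_zero] at h
      exact hD1 h
    exact mul_ne_zero hD0 (mul_ne_zero hD1 (pow_ne_zero _ hx))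
  · have : D = 1 := by lia
    subst this; simp at h

lemma enum_crit {D : ℕ} (hD : 1 ≤ D) : ∃ e : ℕ → ℂ, (∀ i < D - 1, g1 D (e i) = 0) ∧
      ∀ i < D - 1, ∀ j < D - 1, e i = e j → i = j := by
  let p : Polynomial ℂ := Polynomial.C (D : ℂ) * Polynomial.X ^ (D - 1)
    - Polynomial.C ((D - 1 : ℕ) : ℂ)
  have h1 : ∀ x, p.eval x = g1 D x := by intro x; simp [p, g1]
  have h2 : ∀ x, p.derivative.eval x = g2 D x := by
    intro x
    simp only [p, g2, Polynomial.derivative_sub, Polynomial.derivative_C, sub_zero,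
      Polynomial.derivative_C_mul_X_pow, Polynomial.eval_mul, Polynomial.eval_C,
      Polynomial.eval_pow, Polynomial.eval_X, mul_assoc]
  have hD0 : (D : ℂ) ≠ 0 := by exact_mod_cast (by lia : D ≠ 0)
  have h3 : p.natDegree = D - 1 := by
    rw [Polynomial.natDegree_sub_C, Polynomial.natDegree_C_mul_X_pow _ _ hD0]
  have := enum_roots p (fun x hx => by rw [h2]; exact g2_ne hD x (by rw [← h1, hx]))
  simpa only [h1, h3] using this

lemma enum_val {D : ℕ} (hD : 1 ≤ D) (z : ℂ) (hz : ∀ x, g1 D x = 0 → z ≠ g0 D x) :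
    ∃ e : ℕ → ℂ, (∀ i < D, g0 D (e i) = z) ∧ ∀ i < D, ∀ j < D, e i = e j → i = j := by
  let p : Polynomial ℂ := Polynomial.X ^ D - (Polynomial.C ((D - 1 : ℕ) : ℂ) * Polynomial.X
    + Polynomial.C z)
  have h1 : ∀ x, p.eval x = g0 D x - z := by intro x; simp [p, g0]; ring
  have h2 : ∀ x, p.derivative.eval x = g1 D x := by
    intro x; simp [p, g1, Polynomial.derivative_X_pow]
  have h3 : p.natDegree = D := by
    rcases Nat.lt_or_ge 1 D with h | h
    · rw [Polynomial.natDegree_sub_eq_left_of_natDegree_lt] <;>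
        rw [Polynomial.natDegree_X_pow]
      exact lt_of_le_of_lt Polynomial.natDegree_linear_le h
    · have : D = 1 := by lia
      subst this
      have : p = Polynomial.X - Polynomial.C z := by simp [p]
      rw [this, Polynomial.natDegree_X_sub_C]
  have := enum_roots p (fun x hx => by
    rw [h2]; intro h; rw [h1] at hx; exact hz x h (sub_eq_zero.1 hx).symm)
  simpa only [h1, h3, sub_eq_zero] using this

lemma crit_finite {D : ℕ} (hD : 1 ≤ D) : {x : ℂ | g1 D x = 0}.Finite := by
  let p : Polynomial ℂ := Polynomial.C (D : ℂ) * Polynomial.X ^ (D - 1)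
    - Polynomial.C ((D - 1 : ℕ) : ℂ)
  have h1 : ∀ x, p.eval x = g1 D x := by intro x; simp [p, g1]
  have h0 : p ≠ 0 := by
    intro h
    have a := h1 0
    have b := h1 1
    rw [h] at a b
    simp only [Polynomial.eval_zero, g1, one_pow] at a b
    rcases Nat.lt_or_ge 1 D with h | h
    · rw [zero_pow (by lia)] at a
      have : ((D - 1 : ℕ) : ℂ) = 0 := by simpa using a
      have : D - 1 = 0 := by exact_mod_cast this
      lia
    · have : D = 1 := by lia
      subst this; simp at a
  refine (p.roots.toFinset.finite_toSet).subset fun x hx => ?_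
  simp only [Finset.mem_coe, Multiset.mem_toFinset, Polynomial.mem_roots h0, Polynomial.IsRoot, h1]
  exact hx

lemma ev_ne {s : ℕ} (c : Fin s → ℂ) (a : ℂ) (ha : ∑ k, c k * a ^ (k.val + 1) ≠ 0) (b : ℂ) :
    ∀ᶠ ρ : ℕ in atTop, ∑ k, c k * (ρ : ℂ) ^ (k.val + 1) ≠ b := by
  let p : Polynomial ℂ := ∑ k : Fin s, Polynomial.C (c k) * Polynomial.X ^ (k.val + 1)
    - Polynomial.C b
  have h1 : ∀ x, p.eval x = ∑ k, c k * x ^ (k.val + 1) - b := by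
    intro x; simp [p, Polynomial.eval_finsetSum]
  have h0 : p ≠ 0 := by
    intro h
    have e0 := h1 0
    have e1 := h1 a
    rw [h] at e0 e1
    simp at e0 e1
    rw [e0, sub_zero] at e1
    exact ha e1.symm
  rw [← Nat.cofinite_eq_atTop]
  have hf : {x : ℂ | p.eval x = 0}.Finite := by
    refine (p.roots.toFinset.finite_toSet).subset fun x hx => ?_
    simpa [h0] using hx
  have := (hf.preimage (Nat.cast_injective (R := ℂ)).injOn)
  filter_upwards [this.eventually_cofinite_notMem] with ρ hρ h
  apply hρ
  simp [h1, h]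

end roots
end HP

namespace HP

section pts
open Filter Topology
variable {m s D : ℕ}

def nu (j : Fin m) : ℂ := ((j.val + 1 : ℕ) : ℂ)

lemma nu_inj : Function.Injective (nu : Fin m → ℂ) := by
  intro a b h
  have : a.val + 1 = b.val + 1 := Nat.cast_injective (R := ℂ) h
  exact Fin.ext (by lia)

lemma nu_ne (j : Fin m) : nu j ≠ 0 := by
  unfold nu; exact_mod_cast (by lia : j.val + 1 ≠ 0)

lemma exists_rho (m s : ℕ) {D : ℕ} (hD : 1 ≤ D) : ∃ ρ : ℕ, ∀ S : Finset (Fin m), S.card ≤ s →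
    ∀ y z : Fin m → ℂ, (∀ l, l ∉ S → g1 D (y l) = 0) →
    (∀ i : Fin s, ∑ j ∈ S, nu j ^ (i.val + 1) * z j +
      ∑ l ∈ Sᶜ, nu l ^ (i.val + 1) * g0 D (y l) = (ρ : ℂ) ^ (i.val + 1)) →
    ∀ j ∈ S, ∀ c, g1 D c = 0 → z j ≠ g0 D c := by
  classical
  let Cr := {x : ℂ | g1 D x = 0}
  have : Finite Cr := crit_finite hD
  have key : ∀ (S : Finset (Fin m)) (j : Fin m) (y : Fin m → Cr) (c : Cr), ∀ᶠ ρ : ℕ in atTop,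
      S.card ≤ s → j ∈ S → ∀ z : Fin m → ℂ, (∀ i : Fin s, ∑ j ∈ S, nu j ^ (i.val + 1) * z j +
      ∑ l ∈ Sᶜ, nu l ^ (i.val + 1) * g0 D (y l) = (ρ : ℂ) ^ (i.val + 1)) → z j ≠ g0 D c := by
    intro S j y c
    by_cases hS : S.card ≤ s
    swap
    · exact Eventually.of_forall fun _ h => absurd h hS
    by_cases hj : j ∈ S
    swap
    · exact Eventually.of_forall fun _ _ h => absurd h hj
    obtain ⟨a, ha1, ha2⟩ := V1 (s := s) nu nu_inj nu_ne S hS j hj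
    filter_upwards [ev_ne a (nu j) (by rw [ha1]; exact one_ne_zero)
      (g0 D c + ∑ l ∈ Sᶜ, (∑ k, a k * nu l ^ (k.val + 1)) * g0 D (y l))] with ρ hρ _ _ z hz hzc
    apply hρ
    simp only [← hz, mul_add, Finset.sum_add_distrib, Finset.mul_sum]
    rw [Finset.sum_comm, Finset.sum_comm (s := Finset.univ)]
    simp only [← mul_assoc, ← Finset.sum_mul]
    congr 1
    rw [Finset.sum_eq_single_of_mem j hj, ha1, one_mul, hzc]
    intro b hb hbj
    rw [ha2 b hb hbj, zero_mul]
  simp only [← eventually_all] at key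
  obtain ⟨ρ, hρ⟩ := key.exists
  refine ⟨ρ, fun S hS y z hy hz j hj c hc => ?_⟩
  have := hρ S j (fun l => if h : l ∈ S then ⟨c, hc⟩ else ⟨y l, hy l h⟩) ⟨c, hc⟩ hS hj z
  refine this fun i => ?_
  rw [← hz i]
  congr 1
  refine Finset.sum_congr rfl fun l hl => ?_
  rw [Finset.mem_compl] at hl
  simp [hl]

/-- The Lagrange system of the deformation. -/
def sysf (D : ℕ) (F G : Fin s → MvPolynomial (Fin m) ℂ)
    (p : ℂ × ((Fin m → ℂ) × (Fin s → ℂ))) : (Fin s → ℂ) × (Fin m → ℂ) :=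
  (fun i => eval p.2.1 (F i) + p.1 * eval p.2.1 (G i),
   fun j => eval p.2.1 (pderiv j (phi m ℂ D)) + ∑ i, p.2.2 i *
     (eval p.2.1 (pderiv j (F i)) + p.1 * eval p.2.1 (pderiv j (G i))))

lemma contDiff_ev {E : Type*} [NormedAddCommGroup E] [NormedSpace ℂ E] (q : MvPolynomial (Fin m) ℂ)
    (f : E → Fin m → ℂ) (hf : ContDiff ℂ 1 f) : ContDiff ℂ 1 (fun e => eval (f e) q) := by
  rw [contDiff_pi] at hf
  induction q using MvPolynomial.induction_on with
  | C a => simpa using contDiff_const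
  | add p q hp hq => simpa using hp.add hq
  | mul_X p j hp => simpa using hp.mul (hf j)

lemma sysf_contDiff (F G : Fin s → MvPolynomial (Fin m) ℂ) : ContDiff ℂ 1 (sysf D F G) := by
  have hx : ContDiff ℂ 1 (fun p : ℂ × ((Fin m → ℂ) × (Fin s → ℂ)) => p.2.1) :=
    contDiff_fst.comp contDiff_snd
  have hl : ∀ i, ContDiff ℂ 1 (fun p : ℂ × ((Fin m → ℂ) × (Fin s → ℂ)) => p.2.2 i) := by
    intro i
    exact contDiff_pi.1 (contDiff_snd.comp contDiff_snd) i
  have e := fun q => contDiff_ev q _ hx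
  refine ContDiff.prodMk (contDiff_pi.2 fun i => ?_) (contDiff_pi.2 fun j => ?_)
  · exact (e _).add (contDiff_fst.mul (e _))
  · exact (e _).add (ContDiff.sum fun i _ => (hl i).mul ((e _).add (contDiff_fst.mul (e _))))

lemma sysf_zero_gen (F G : Fin s → MvPolynomial (Fin m) ℂ) (τ : ℂ) (x : Fin m → ℂ)
    (lam : Fin s → ℂ) (h : sysf D F G (τ, x, lam) = 0) (g : GI m s) :
    eval x (gen D (fun i => F i + C τ * G i) g) = 0 := by
  have h1 := fun i => congrFun (congrArg Prod.fst h) i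
  have h2 := fun i => congrFun (congrArg Prod.snd h) i
  simp only [sysf, Prod.fst_zero, Prod.snd_zero, Pi.zero_apply] at h1 h2
  refine gen_lagr D x _ (fun i => by simpa using h1 i) (Fin.cons 1 lam)
    (fun h => one_ne_zero (congrFun h 0)) (fun j => ?_) g
  rw [Fin.sum_univ_succ]
  simp only [Fin.cons_zero, Fin.cons_succ, one_mul, map_add, pderiv_C_mul, map_mul, eval_C]
  simpa [pderiv_mul] using h2 j

lemma sysf_F0 (ρ : ℕ) (G : Fin s → MvPolynomial (Fin m) ℂ) (x : Fin m → ℂ) (lam : Fin s → ℂ) :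
    sysf D (F0 m s D ρ ℂ) G (0, x, lam) =
      (fun i => ∑ j, nu j ^ (i.val + 1) * g0 D (x j) - (ρ : ℂ) ^ (i.val + 1),
       fun j => g1 D (x j) * (1 + ∑ i, lam i * nu j ^ (i.val + 1))) := by
  unfold sysf
  refine Prod.ext ?_ ?_
  · funext i
    simp [F0, gp, nu, g0]
  · funext j
    simp only [pderiv_phi, pderiv_F0, zero_mul, add_zero, mul_add, mul_one, Finset.mul_sum]
    simp only [gp', g1, nu, map_sub, map_mul, map_pow, map_natCast, eval_X]
    congr 1
    refine Finset.sum_congr rfl fun i _ => by ring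

lemma hasDeriv_g0 (a b : ℂ) : HasDerivAt (fun ε : ℂ => g0 D (a + ε * b)) (g1 D a * b) 0 := by
  unfold g0 g1
  have h : HasDerivAt (fun ε : ℂ => a + ε * b) b 0 := by
    simpa using ((hasDerivAt_id (0 : ℂ)).mul_const b).const_add a
  refine HasDerivAt.congr_deriv ((h.fun_pow D).fun_sub (h.const_mul ((D - 1 : ℕ) : ℂ))) ?_
  rw [zero_mul, add_zero]; ring

lemma hasDeriv_g1 (a b : ℂ) : HasDerivAt (fun ε : ℂ => g1 D (a + ε * b)) (g2 D a * b) 0 := by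
  unfold g1 g2
  have h : HasDerivAt (fun ε : ℂ => a + ε * b) b 0 := by
    simpa using ((hasDerivAt_id (0 : ℂ)).mul_const b).const_add a
  refine HasDerivAt.congr_deriv
    (((h.fun_pow (D - 1)).const_mul (D : ℂ)).sub_const ((D - 1 : ℕ) : ℂ)) ?_
  rw [zero_mul, add_zero]; ring

lemma nondeg (hD : 1 ≤ D) (ρ : ℕ) (G : Fin s → MvPolynomial (Fin m) ℂ) (x : Fin m → ℂ)
    (lam : Fin s → ℂ)
    (S : Finset (Fin m)) (hS : S.card = s) (h1 : ∀ j ∉ S, g1 D (x j) = 0)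
    (h2 : ∀ j ∈ S, g1 D (x j) ≠ 0)
    (h3 : ∀ j ∉ S, 1 + ∑ i, lam i * nu j ^ (i.val + 1) ≠ 0)
    (h4 : ∀ j ∈ S, 1 + ∑ i, lam i * nu j ^ (i.val + 1) = 0)
    (v : (Fin m → ℂ) × (Fin s → ℂ))
    (hv : HasDerivAt (fun ε : ℂ => sysf D (F0 m s D ρ ℂ) G (0, (x, lam) + ε • v)) 0 0) : v = 0 := by
  classical
  obtain ⟨v, w⟩ := v
  have e : (fun ε : ℂ => sysf D (F0 m s D ρ ℂ) G (0, (x, lam) + ε • (v, w))) = fun ε =>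
      (fun i => ∑ j, nu j ^ (i.val + 1) * g0 D (x j + ε * v j) - (ρ : ℂ) ^ (i.val + 1),
       fun j => g1 D (x j + ε * v j) * (1 + ∑ i, (lam i + ε * w i) * nu j ^ (i.val + 1))) := by
    funext ε
    have : ((x, lam) + ε • (v, w)) = (x + ε • v, lam + ε • w) := rfl
    rw [this, sysf_F0]; rfl
  rw [e] at hv
  have d1 : ∀ i : Fin s, ∑ j, nu j ^ (i.val + 1) * (g1 D (x j) * v j) = 0 := by
    intro i
    have a := (hasDerivAt_pi.1 hv.fst) i
    have b : HasDerivAt (fun ε : ℂ => ∑ j, nu j ^ (i.val + 1) * g0 D (x j + ε * v j)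
        - (ρ : ℂ) ^ (i.val + 1)) (∑ j, nu j ^ (i.val + 1) * (g1 D (x j) * v j)) 0 := by
      refine HasDerivAt.sub_const _ ?_
      exact HasDerivAt.fun_sum fun j _ => (hasDeriv_g0 (x j) (v j)).const_mul _
    exact b.unique a
  have d2 : ∀ j : Fin m, g2 D (x j) * v j * (1 + ∑ i, lam i * nu j ^ (i.val + 1)) +
      g1 D (x j) * ∑ i, w i * nu j ^ (i.val + 1) = 0 := by
    intro j
    have a := (hasDerivAt_pi.1 hv.snd) j
    have c : HasDerivAt (fun ε : ℂ => 1 + ∑ i, (lam i + ε * w i) * nu j ^ (i.val + 1))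
        (∑ i, w i * nu j ^ (i.val + 1)) 0 := by
      refine HasDerivAt.const_add _ ?_
      refine HasDerivAt.fun_sum fun i _ => ?_
      refine HasDerivAt.mul_const ?_ _
      simpa using ((hasDerivAt_id (0 : ℂ)).mul_const (w i)).const_add (lam i)
    have b := (hasDeriv_g1 (D := D) (x j) (v j)).mul c
    have := b.unique a
    simpa using this
  have hw : w = 0 := by
    apply VT_inj (ν := nu) nu_inj nu_ne hS
    rw [map_zero]
    funext j
    have := d2 j.1
    rw [h4 j.1 j.2, mul_zero, zero_add] at this
    exact (mul_eq_zero.1 this).resolve_left (h2 j.1 j.2)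
  have hv1 : ∀ j ∉ S, v j = 0 := by
    intro j hj
    have := d2 j
    rw [h1 j hj, zero_mul, add_zero] at this
    rcases mul_eq_zero.1 this with h | h
    · exact (mul_eq_zero.1 h).resolve_left (g2_ne hD _ (h1 j hj))
    · exact absurd h (h3 j hj)
  have hv2 : (fun j : S => g1 D (x j) * v j) = 0 := by
    apply VU_inj (ν := nu) nu_inj nu_ne hS.le
    rw [map_zero]
    funext i
    have := d1 i
    rw [← Finset.sum_subset (Finset.subset_univ S) (fun j _ hj => by rw [hv1 j hj]; simp)] at this
    rw [← Finset.sum_coe_sort] at this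
    exact this
  have hv0 : v = 0 := by
    funext j
    by_cases hj : j ∈ S
    · have := congrFun hv2 ⟨j, hj⟩
      exact (mul_eq_zero.1 this).resolve_left (h2 j hj)
    · exact hv1 j hj
  rw [hv0, hw]; rfl

/-- Nondegenerate solutions of the special system. -/
lemma special_sols (m s : ℕ) {D : ℕ} (hD : 1 ≤ D) : ∃ ρ : ℕ, ∃ x : Pt m s D → Fin m → ℂ,
    ∃ lam : Pt m s D → Fin s → ℂ, Function.Injective x ∧
    ∀ G : Fin s → MvPolynomial (Fin m) ℂ, ∀ p, sysf D (F0 m s D ρ ℂ) G (0, x p, lam p) = 0 ∧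
    ∀ v, HasDerivAt (fun ε : ℂ => sysf D (F0 m s D ρ ℂ) G (0, (x p, lam p) + ε • v)) 0 0
      → v = 0 := by
  classical
  obtain ⟨ρ, hρ⟩ := exists_rho m s hD
  obtain ⟨ec, hec, heci⟩ := enum_crit hD
  have hval := fun z => enum_val hD z
  choose! er her heri using hval
  have hcard : ∀ p : Pt m s D, p.1.1.card = s := fun p => (Finset.mem_powersetCard.1 p.1.2).2
  have hlt1 : ∀ (p : Pt m s D) j, j ∈ p.1.1 → (p.2 j).val < D := fun p j h => by
    have := (p.2 j).2; simpa [h] using this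
  have hlt2 : ∀ (p : Pt m s D) j, j ∉ p.1.1 → (p.2 j).val < D - 1 := fun p j h => by
    have := (p.2 j).2; simpa [h] using this
  have hz : ∀ (S : Finset (Fin m)) (y : Fin m → ℂ), S.card = s → ∃ z : Fin m → ℂ, ∀ i : Fin s,
      ∑ j ∈ S, nu j ^ (i.val + 1) * z j +
      ∑ l ∈ Sᶜ, nu l ^ (i.val + 1) * g0 D (y l) = (ρ : ℂ) ^ (i.val + 1) := by
    intro S y hS
    obtain ⟨z, hz⟩ := VU_surj (ν := nu) nu_inj nu_ne hS
      (fun i => (ρ : ℂ) ^ (i.val + 1) - ∑ l ∈ Sᶜ, nu l ^ (i.val + 1) * g0 D (y l))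
    refine ⟨fun j => if h : j ∈ S then z ⟨j, h⟩ else 0, fun i => ?_⟩
    beta_reduce
    have := congrFun hz i
    rw [← eq_sub_iff_add_eq, ← this, ← Finset.sum_coe_sort]
    simp [VU]
  choose! z hz using hz
  have hlam : ∀ (S : Finset (Fin m)), S.card = s → ∃ lam : Fin s → ℂ, ∀ j ∈ S,
      1 + ∑ i, lam i * nu j ^ (i.val + 1) = 0 := by
    intro S hS
    obtain ⟨l, hl⟩ := VT_surj (ν := nu) nu_inj nu_ne hS.le (fun _ => -1)
    refine ⟨l, fun j hj => ?_⟩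
    have : ∑ i, l i * nu j ^ (i.val + 1) = -1 := congrFun hl ⟨j, hj⟩
    rw [this]; ring
  choose! lam hlam using hlam
  -- the values `y` only depend on the indices off `S`
  let y : Pt m s D → Fin m → ℂ := fun p j => if j ∈ p.1.1 then 0 else ec (p.2 j).val
  let x : Pt m s D → Fin m → ℂ := fun p j =>
    if j ∈ p.1.1 then er (z p.1.1 (y p) j) (p.2 j).val else ec (p.2 j).val
  have hnc : ∀ p : Pt m s D, ∀ j ∈ p.1.1, ∀ c, g1 D c = 0 → z p.1.1 (y p) j ≠ g0 D c := by
    intro p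
    refine hρ p.1.1 (hcard p).le (y p) _ (fun l hl => ?_) (hz _ _ (hcard p))
    simp only [y, hl, if_false]
    exact hec _ (hlt2 p l hl)
  have hx1 : ∀ p : Pt m s D, ∀ j, j ∉ p.1.1 → g1 D (x p j) = 0 := by
    intro p j hj
    simp only [x, hj, if_false]
    exact hec _ (hlt2 p j hj)
  have hx0 : ∀ p : Pt m s D, ∀ j ∈ p.1.1, g0 D (x p j) = z p.1.1 (y p) j := by
    intro p j hj
    simp only [x, hj, if_true]
    exact her _ (hnc p j hj) _ (hlt1 p j hj)
  have hx2 : ∀ p : Pt m s D, ∀ j ∈ p.1.1, g1 D (x p j) ≠ 0 := by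
    intro p j hj h
    exact hnc p j hj _ h (hx0 p j hj).symm
  refine ⟨ρ, x, fun p => lam p.1.1, ?_, fun G p => ⟨?_, ?_⟩⟩
  · rintro ⟨S, k⟩ ⟨S', k'⟩ h
    have hSS : S = S' := by
      apply Subtype.ext
      ext j
      constructor
      · intro hj
        by_contra hc
        exact hx2 ⟨S, k⟩ j hj (by rw [h]; exact hx1 ⟨S', k'⟩ j hc)
      · intro hj
        by_contra hc
        exact hx2 ⟨S', k'⟩ j hj (by rw [← h]; exact hx1 ⟨S, k⟩ j hc)
    subst hSS
    have hoff : ∀ j, j ∉ S.1 → (k j).val = (k' j).val := by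
      intro j hj
      have := congrFun h j
      simp only [x, hj, if_false] at this
      exact heci _ (hlt2 ⟨S, k⟩ j hj) _ (hlt2 ⟨S, k'⟩ j hj) this
    have hy : y ⟨S, k⟩ = y ⟨S, k'⟩ := by
      funext j
      by_cases hj : j ∈ S.1
      · simp [y, hj]
      · simp [y, hj, hoff j hj]
    congr 1
    funext j
    apply Fin.ext
    by_cases hj : j ∈ S.1
    · have := congrFun h j
      simp only [x, hj, if_true] at this
      rw [hy] at this
      exact heri _ (hnc ⟨S, k'⟩ j hj) _ (hlt1 ⟨S, k⟩ j hj) _ (hlt1 ⟨S, k'⟩ j hj) this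
    · exact hoff j hj
  · rw [sysf_F0]
    refine Prod.ext ?_ ?_
    · funext i
      simp only [Prod.fst_zero, Pi.zero_apply]
      rw [sub_eq_zero, ← hz p.1.1 (y p) (hcard p) i, ← Finset.sum_add_sum_compl p.1.1]
      congr 1
      · exact Finset.sum_congr rfl fun j hj => by rw [hx0 p j hj]
      · refine Finset.sum_congr rfl fun j hj => ?_
        rw [Finset.mem_compl] at hj
        simp [x, y, hj]
    · funext j
      simp only [Prod.snd_zero, Pi.zero_apply]
      by_cases hj : j ∈ p.1.1
      · rw [hlam _ (hcard p) j hj, mul_zero]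
      · rw [hx1 p j hj, zero_mul]
  · refine nondeg hD ρ G (x p) (lam p.1.1) p.1.1 (hcard p) (hx1 p) (hx2 p) ?_ (hlam _ (hcard p))
    intro j hj h0
    obtain ⟨l, hl, hl2⟩ := ell_ne (s := s) nu_inj (insert j p.1.1)
      (by rw [Finset.card_insert_of_notMem hj, hcard p]; lia) (lam p.1.1)
    apply hl2
    rcases Finset.mem_insert.1 hl with rfl | hl
    · exact h0
    · exact hlam _ (hcard p) l hl

theorem exists_points (m s : ℕ) {D : ℕ} (hD : 1 ≤ D) : ∃ ρ : ℕ,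
    ∀ F : Fin s → MvPolynomial (Fin m) ℂ, ∀ᶠ τ in 𝓝 (0 : ℂ), ∃ z : Pt m s D → Fin m → ℂ,
      Function.Injective z ∧ ∀ p g,
        eval (z p) (gen D (fun i => F0 m s D ρ ℂ i + C τ * (F i - F0 m s D ρ ℂ i)) g) = 0 := by
  obtain ⟨ρ, x, lam, hinj, h⟩ := special_sols m s hD
  refine ⟨ρ, fun F => ?_⟩
  set G := fun i => F i - F0 m s D ρ ℂ i with hG
  obtain ⟨U, hU1, hU2⟩ := (Set.finite_range x).t2_separation
  have key : ∀ p, ∀ᶠ τ in 𝓝 (0 : ℂ), ∃ z ∈ (Prod.fst ⁻¹' (U (x p)) : Set ((Fin m → ℂ) × (Fin s → ℂ))),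
      sysf D (F0 m s D ρ ℂ) G (τ, z) = 0 := by
    intro p
    refine ift (by simp [add_comm]) _ (x p, lam p) (sysf_contDiff _ _) (h G p).1 (h G p).2 _ ?_
    exact continuous_fst.continuousAt.preimage_mem_nhds ((hU1 (x p)).2.mem_nhds (hU1 (x p)).1)
  rw [← eventually_all] at key
  filter_upwards [key] with τ hτ
  choose z hz1 hz2 using hτ
  refine ⟨fun p => (z p).1, ?_, fun p g => sysf_zero_gen _ _ τ _ (z p).2 (hz2 p) g⟩
  intro p q hpq
  by_contra hne
  have := hU2 ⟨p, rfl⟩ ⟨q, rfl⟩ (fun h => hne (hinj h))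
  exact Set.disjoint_left.1 this (hz1 p) (by
    have h1 := hz1 q
    have h2 : (z p).1 = (z q).1 := hpq
    simp only [Set.mem_preimage] at h1
    rwa [← h2] at h1)

end pts
end HP

namespace HP

section indep
open Filter Topology
variable {m s D : ℕ}

lemma sep_poly {K ι : Type*} [Field K] [Fintype ι] [DecidableEq ι] (z : ι → Fin m → K)
    (hz : Function.Injective z) (p : ι) : ∃ q : MvPolynomial (Fin m) K,
      q.totalDegree ≤ Fintype.card ι ∧ eval (z p) q ≠ 0 ∧ ∀ p', p' ≠ p → eval (z p') q = 0 := by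
  have h : ∀ p' : ι, ∃ q : MvPolynomial (Fin m) K, q.totalDegree ≤ 1 ∧ (p' ≠ p →
      eval (z p) q ≠ 0 ∧ eval (z p') q = 0) := by
    intro p'
    by_cases hp' : p' = p
    · exact ⟨0, by simp, fun h => absurd hp' h⟩
    obtain ⟨k, hk⟩ : ∃ k, z p k ≠ z p' k := by
      by_contra hc; push Not at hc
      exact hp' (hz (funext hc)).symm
    refine ⟨X k - C (z p' k), ?_, fun _ => ⟨?_, ?_⟩⟩
    · refine (totalDegree_sub _ _).trans ?_
      simp
    · simp only [map_sub, eval_X, eval_C]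
      exact sub_ne_zero.2 hk
    · simp
  choose q hq1 hq2 using h
  refine ⟨∏ p' ∈ Finset.univ.erase p, q p', ?_, ?_, ?_⟩
  · refine (totalDegree_finsetProd _ _).trans ?_
    refine (Finset.sum_le_card_nsmul _ _ 1 fun p' _ => hq1 p').trans ?_
    simp only [smul_eq_mul, mul_one]
    exact Finset.card_le_univ _
  · rw [map_prod, Finset.prod_ne_zero_iff]
    intro p' hp'
    exact (hq2 p' (Finset.ne_of_mem_erase hp')).1
  · intro p' hp'
    rw [map_prod]
    exact Finset.prod_eq_zero (Finset.mem_erase.2 ⟨hp', Finset.mem_univ _⟩) (hq2 p' hp').2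

lemma card_ge (hD : 1 ≤ D) (F : Fin s → MvPolynomial (Fin m) ℂ)
    (hF : ∀ i, F i ∈ Fil (triv ℂ) m D) (B : Finset (Fin m →₀ ℕ)) (d : ℕ) (hd : N0 m s D ≤ d)
    (hspan : ∀ μ ∈ Mon m d, InN (triv ℂ) D B F d (monomial μ 1)) : N0 m s D ≤ B.card := by
  classical
  by_contra hlt
  push Not at hlt
  obtain ⟨u, H, hdata, hGG⟩ := exists_data hspan
  obtain ⟨ρ, hρ⟩ := exists_points m s hD
  let Ft : ℂ → Fin s → MvPolynomial (Fin m) ℂ := fun τ i =>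
    F0 m s D ρ ℂ i + C τ * (F i - F0 m s D ρ ℂ i)
  let FP : Fin s → MvPolynomial (Fin m) (Polynomial ℂ) := fun i =>
    map Polynomial.C (F0 m s D ρ ℂ i) +
      C Polynomial.X * map Polynomial.C (F i - F0 m s D ρ ℂ i)
  have hdet : ∀ τ : ℂ, (GG D d B u H (Ft τ)).det = (GG D d B u H FP).det.eval τ := by
    intro τ
    have : Ft τ = fun i => map ((Polynomial.aeval τ : Polynomial ℂ →ₐ[ℂ] ℂ) : Polynomial ℂ →+* ℂ)
        (FP i) := by
      funext i
      simp only [Ft, FP, map_add, map_mul, MvPolynomial.map_map, map_C]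
      have h : ((Polynomial.aeval τ : Polynomial ℂ →ₐ[ℂ] ℂ) : Polynomial ℂ →+* ℂ).comp
          Polynomial.C = RingHom.id ℂ := by
        apply RingHom.ext; intro a; simp
      rw [h, MvPolynomial.map_id, MvPolynomial.map_id]
      simp
    rw [this, GG_det_map, Polynomial.coe_aeval_eq_eval]
  have h1 : (GG D d B u H FP).det ≠ 0 := by
    intro h0
    have := hdet 1
    have h2 : Ft 1 = F := by funext i; simp [Ft]
    rw [h2, hGG, h0] at this
    simp at this
  have hev : ∀ᶠ τ in 𝓝[≠] (0 : ℂ), (GG D d B u H FP).det.eval τ ≠ 0 := by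
    have hfin : {τ : ℂ | (GG D d B u H FP).det.eval τ = 0}.Finite := by
      refine ((GG D d B u H FP).det.roots.toFinset.finite_toSet).subset fun x hx => ?_
      simpa [h1] using hx
    have h3 : ({τ : ℂ | (GG D d B u H FP).det.eval τ = 0} \ {0})ᶜ ∈ 𝓝 (0 : ℂ) :=
      (hfin.subset Set.sdiff_subset).isClosed.isOpen_compl.mem_nhds (by simp)
    filter_upwards [nhdsWithin_le_nhds h3, self_mem_nhdsWithin] with τ h4 h5 h6
    exact h4 ⟨h6, h5⟩
  obtain ⟨τ, ⟨z, hz, hzg⟩, hτ⟩ := (((hρ F).filter_mono nhdsWithin_le_nhds).and hev).exists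
  rw [← hdet] at hτ
  have hFt : ∀ i, Ft τ i ∈ Fil (triv ℂ) m D := by
    intro i
    refine add_mem (F0_Fil hD _ i) ?_
    refine Fil_mono (d := 0 + D) (by lia) (Fil_mul (Fil_C (triv_w_of_nonneg le_rfl _)) ?_)
    exact sub_mem (hF i) (F0_Fil hD _ i)
  have hN := InN_of_det hD hdata (Ft τ) hFt (isUnit_iff_ne_zero.2 hτ)
  -- a functional
  let T : (Pt m s D → ℂ) →ₗ[ℂ] (B → ℂ) :=
    { toFun := fun c b => ∑ p, c p * eval (z p) (monomial b.1 1)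
      map_add' := by intro c c'; funext b; simp [add_mul, Finset.sum_add_distrib]
      map_smul' := by intro a c; funext b; simp [Finset.mul_sum, mul_assoc] }
  have hTn : LinearMap.ker T ≠ ⊥ := by
    apply LinearMap.ker_ne_bot_of_finrank_lt
    rw [Module.finrank_fintype_fun_eq_card, Module.finrank_fintype_fun_eq_card, card_Pt,
      Fintype.card_coe]
    exact hlt
  obtain ⟨c, hc, hc0⟩ := Submodule.exists_mem_ne_zero_of_ne_bot hTn
  have hmon : ∀ μ ∈ Mon m d, ∑ p, c p * eval (z p) (monomial μ 1) = 0 := by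
    intro μ hμ
    obtain ⟨u', H', -, -, h5⟩ := hN μ hμ
    rw [h5]
    have h6 : ∀ p, eval (z p) (∑ b ∈ B, monomial b (u' b) + ∑ g, H' g * gen D (Ft τ) g) =
        ∑ b ∈ B, u' b * eval (z p) (monomial b 1) := by
      intro p
      rw [map_add, map_sum, map_sum]
      rw [Finset.sum_eq_zero (s := Finset.univ) (fun g _ => by rw [map_mul, hzg p g, mul_zero]),
        add_zero]
      refine Finset.sum_congr rfl fun b _ => ?_
      rw [eval_monomial, eval_monomial, one_mul]
    simp only [h6, Finset.mul_sum]
    rw [Finset.sum_comm]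
    refine Finset.sum_eq_zero fun b hb => ?_
    have := congrFun (LinearMap.mem_ker.1 hc) ⟨b, hb⟩
    simp only [T, LinearMap.coe_mk, AddHom.coe_mk, Pi.zero_apply] at this
    calc _ = u' b * ∑ p, c p * eval (z p) (monomial b 1) := by
            rw [Finset.mul_sum]; exact Finset.sum_congr rfl fun _ _ => by ring
      _ = 0 := by rw [this, mul_zero]
  have hpoly : ∀ q : MvPolynomial (Fin m) ℂ, q.totalDegree ≤ d →
      ∑ p, c p * eval (z p) q = 0 := by
    intro q hq
    rw [sum_Mon (Fil_triv.2 hq)]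
    simp only [map_sum, Finset.mul_sum]
    rw [Finset.sum_comm]
    refine Finset.sum_eq_zero fun ν _ => ?_
    have := hmon ν.1 ν.2
    calc _ = coeff ν.1 q * ∑ p, c p * eval (z p) (monomial ν.1 1) := by
            rw [Finset.mul_sum]; refine Finset.sum_congr rfl fun _ _ => ?_
            rw [eval_monomial, eval_monomial]; ring
      _ = 0 := by rw [this, mul_zero]
  apply hc0
  funext p
  obtain ⟨q, hq1, hq2, hq3⟩ := sep_poly z hz p
  rw [card_Pt] at hq1
  have := hpoly q (hq1.trans hd)
  rw [Finset.sum_eq_single p (fun p' _ hp' => by rw [hq3 p' hp', mul_zero]) (by simp)] at this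
  exact (mul_eq_zero.1 this).resolve_right hq2

lemma solve_basis {m : ℕ} {B : Finset (Fin m →₀ ℕ)} {b : Fin m →₀ ℕ} {c : (Fin m →₀ ℕ) → ℂ}
    {ι : Type} [Fintype ι] {H G : ι → MvPolynomial (Fin m) ℂ} (hne : c b ≠ 0) (hb0 : b ∈ B)
    (hH : ∑ g, H g * G g = ∑ b ∈ B, monomial b (c b)) :
    (monomial b (1 : ℂ) : MvPolynomial (Fin m) ℂ) =
      ∑ b' ∈ B.erase b, monomial b' (- (c b)⁻¹ * c b') + ∑ g, C ((c b)⁻¹) * H g * G g := by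
  have h1 := Finset.add_sum_erase B
    (fun b => (monomial b (c b) : MvPolynomial (Fin m) ℂ)) hb0
  beta_reduce at h1
  have h2 : (monomial b (c b) : MvPolynomial (Fin m) ℂ) = ∑ g, H g * G g
      - ∑ b' ∈ B.erase b, monomial b' (c b') := by
    rw [hH]
    exact eq_sub_of_add_eq h1
  have h3 : (monomial b (1 : ℂ) : MvPolynomial (Fin m) ℂ)
      = C ((c b)⁻¹) * monomial b (c b) := by
    rw [C_mul_monomial, inv_mul_cancel₀ hne]
  rw [h3, h2, mul_sub, Finset.mul_sum, Finset.mul_sum, sub_eq_neg_add, ← Finset.sum_neg_distrib]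
  refine congrArg₂ _ ?_ ?_
  · refine Finset.sum_congr rfl fun b' _ => ?_
    rw [C_mul_monomial, neg_mul, map_neg]
  · refine Finset.sum_congr rfl fun g _ => ?_
    rw [mul_assoc]

variable (hD : 1 ≤ D) (hs : s ≤ m) (F : Fin s → MvPolynomial (Fin m) ℂ)
    (hF : ∀ i, F i ∈ Fil (triv ℂ) m D)
    (hspan : ∀ γ : Fin m →₀ ℕ, InN (triv ℂ) D (BB m s D) F γ.degree (monomial γ 1))
include hD hs hF hspan

lemma card_BB_eq : (BB m s D).card = N0 m s D :=
  le_antisymm (card_BB hD hs) (card_ge hD F hF _ (N0 m s D) le_rfl fun μ hμ =>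
    (hspan μ).mono (by have := mem_Mon.1 hμ; lia))

lemma indep (c : (Fin m →₀ ℕ) → ℂ)
    (hc : ∑ b ∈ BB m s D, monomial b (c b) ∈ Ideal.span (Set.range (gen D F))) :
    ∀ b ∈ BB m s D, c b = 0 := by
  classical
  intro b0 hb0
  by_contra hne
  rw [Ideal.mem_span_range_iff_exists_fun] at hc
  obtain ⟨H, hH⟩ := hc
  obtain ⟨d, hdN, hdM, hdg⟩ : ∃ d : ℕ, N0 m s D ≤ d ∧ MM m s D ≤ d ∧
      ∀ g, H g ∈ Fil (triv ℂ) m ((d : ℤ) - gdeg m s D g) := by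
    refine ⟨N0 m s D + MM m s D + ∑ g, ((H g).totalDegree + (gdeg m s D g).toNat), by lia,
      by lia, fun g => ?_⟩
    have := Finset.single_le_sum (f := fun g => (H g).totalDegree + (gdeg m s D g).toNat)
      (fun _ _ => Nat.zero_le _) (Finset.mem_univ g)
    have h2 := Int.self_le_toNat (gdeg m s D g)
    beta_reduce at this
    refine Fil_mono ?_ (Fil_triv.2 (le_refl (H g).totalDegree))
    lia
  have hbas : ∀ b ∈ BB m s D, InN (triv ℂ) D ((BB m s D).erase b0) F d (monomial b 1) := by
    intro b hb
    have hbd : (b.degree : ℤ) ≤ d := by have := BB_deg hb; lia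
    by_cases hbb : b = b0
    · subst hbb
      refine ⟨fun b' => - (c b)⁻¹ * c b', fun g => C ((c b)⁻¹) * H g, ?_, ?_, ?_⟩
      · intro b' hb'
        have := BB_deg (Finset.mem_of_mem_erase hb')
        exact triv_w_of_nonneg (by lia) _
      · intro g
        have h0 : (C ((c b)⁻¹) : MvPolynomial (Fin m) ℂ) ∈ Fil (triv ℂ) m 0 :=
          Fil_C (triv_w_of_nonneg le_rfl _)
        have := Fil_mul h0 (hdg g)
        rwa [zero_add] at this
      · exact solve_basis hne hb0 hH
    · have := BB_deg hb
      refine ⟨Pi.single b 1, 0, ?_, ?_, ?_⟩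
      · intro b' hb'
        have := BB_deg (Finset.mem_of_mem_erase hb')
        exact triv_w_of_nonneg (by lia) _
      · intro g; exact zero_mem _
      · rw [Finset.sum_eq_single_of_mem b (Finset.mem_erase.2 ⟨hbb, hb⟩)]
        · simp
        · intro b' _ h; rw [Pi.single_eq_of_ne h, map_zero]
  have := card_ge hD F hF ((BB m s D).erase b0) d (by lia) (fun μ hμ => by
    obtain ⟨u, H', h1, h2, h3⟩ := hspan μ
    rw [h3]
    have hμ' := mem_Mon.1 hμ
    refine InN.add (InN.sum fun b hb => ?_) (InN.sum fun g _ => InN.gen_mul g ?_)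
    · have := (hbas b hb).C_mul (k := 0) (e := d) (by lia) (triv_w_of_nonneg le_rfl (u b))
      rwa [C_mul_monomial, mul_one] at this
    · exact Fil_mono (by lia) (h2 g))
  have h1 := Finset.card_erase_lt_of_mem hb0
  have h2 := card_BB (m := m) (s := s) hD hs
  lia

end indep
end HP

namespace HP

section tracealg
variable {m : ℕ} {A : Type*} [CommRing A] [Algebra ℂ A] (e : MvPolynomial (Fin m) ℂ →ₐ[ℂ] A)

def Wsp (χ : Fin m → ℂ) : Submodule ℂ A :=
  ⨅ k, Module.End.maxGenEigenspace (LinearMap.mulLeft ℂ (e (X k))) (χ k)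

lemma mulLeft_comm' (a b : A) : Commute (LinearMap.mulLeft ℂ a) (LinearMap.mulLeft ℂ b) := by
  apply LinearMap.ext
  intro v
  simp [mul_left_comm]

lemma Wsp_mapsTo (a : A) (χ : Fin m → ℂ) :
    Set.MapsTo (LinearMap.mulLeft ℂ a) (Wsp e χ) (Wsp e χ) := by
  intro v hv
  simp only [Wsp, SetLike.mem_coe, Submodule.mem_iInf] at hv ⊢
  intro k
  exact Module.End.mapsTo_maxGenEigenspace_of_comm (mulLeft_comm' _ _) _ (hv k)

lemma sub_pow_apply (a v : A) (μ : ℂ) (k : ℕ) :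
    ((LinearMap.mulLeft ℂ a - μ • (1 : Module.End ℂ A)) ^ k) v
      = (a - algebraMap ℂ A μ) ^ k * v := by
  induction k generalizing v with
  | zero => simp
  | succ k ih =>
    rw [pow_succ, Module.End.mul_apply, ih, pow_succ, mul_assoc]
    congr 1
    simp [sub_mul, Algebra.smul_def]

lemma Wsp_mem {χ : Fin m → ℂ} {v : A} : v ∈ Wsp e χ ↔
    ∀ k, ∃ N : ℕ, e ((X k - C (χ k)) ^ N) * v = 0 := by
  simp only [Wsp, Submodule.mem_iInf, Module.End.mem_maxGenEigenspace, sub_pow_apply, map_pow,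
    map_sub]
  have : ∀ c, e (C c) = algebraMap ℂ A c := fun c => e.commutes c
  simp only [this]

def annI (W : Submodule ℂ A) : Ideal (MvPolynomial (Fin m) ℂ) where
  carrier := {p | ∀ v ∈ W, e p * v = 0}
  add_mem' := by
    intro a b ha hb v hv
    rw [map_add, add_mul, ha v hv, hb v hv, add_zero]
  zero_mem' := by intro v hv; simp
  smul_mem' := by
    intro c x hx v hv
    rw [smul_eq_mul, map_mul, mul_assoc, hx v hv, mul_zero]

lemma X_sub_mem_rad [FiniteDimensional ℂ A] (χ : Fin m → ℂ) (k : Fin m) :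
    X k - C (χ k) ∈ (annI e (Wsp e χ)).radical := by
  set f : Module.End ℂ A := LinearMap.mulLeft ℂ (e (X k))
  refine ⟨Module.finrank ℂ A, fun v hv => ?_⟩
  have h1 : v ∈ f.maxGenEigenspace (χ k) := by
    simp only [Wsp, Submodule.mem_iInf] at hv; exact hv k
  rw [Module.End.maxGenEigenspace_eq_genEigenspace_finrank, Module.End.mem_genEigenspace_nat,
    LinearMap.mem_ker, sub_pow_apply] at h1
  have : ∀ c, e (C c) = algebraMap ℂ A c := fun c => e.commutes c
  rw [map_pow, map_sub, this]
  exact h1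

lemma sub_eval_mem_rad [FiniteDimensional ℂ A] (χ : Fin m → ℂ) (p : MvPolynomial (Fin m) ℂ) :
    p - C (eval χ p) ∈ (annI e (Wsp e χ)).radical := by
  set J := (annI e (Wsp e χ)).radical
  induction p using MvPolynomial.induction_on with
  | C a => simp
  | add p q hp hq =>
    have := J.add_mem hp hq
    have h : p + q - C (eval χ (p + q)) = p - C (eval χ p) + (q - C (eval χ q)) := by
      rw [map_add, map_add]; abel
    rwa [h]
  | mul_X p k hp =>
    have := J.add_mem (J.mul_mem_left (X k) hp)
      (J.mul_mem_left (C (eval χ p)) (X_sub_mem_rad e χ k))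
    have h : p * X k - C (eval χ (p * X k)) = X k * (p - C (eval χ p)) +
        C (eval χ p) * (X k - C (χ k)) := by
      rw [map_mul, map_mul, eval_X]; ring
    rwa [h]

lemma Wsp_eval_zero [FiniteDimensional ℂ A] {χ : Fin m → ℂ} (hW : Wsp e χ ≠ ⊥)
    {p : MvPolynomial (Fin m) ℂ} (hp : e p = 0) : eval χ p = 0 := by
  have h0 : p ∈ (annI e (Wsp e χ)).radical := Ideal.le_radical (fun v _ => by rw [hp, zero_mul])
  have h1 := Ideal.sub_mem _ h0 (sub_eval_mem_rad e χ p)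
  rw [sub_sub_cancel] at h1
  by_contra hne
  have h2 : (1 : MvPolynomial (Fin m) ℂ) ∈ (annI e (Wsp e χ)).radical := by
    have := Ideal.mul_mem_left _ (C (eval χ p)⁻¹) h1
    rwa [← C_mul, inv_mul_cancel₀ hne, C_1] at this
  obtain ⟨N, hN⟩ := h2
  obtain ⟨v, hv, hv0⟩ := Submodule.exists_mem_ne_zero_of_ne_bot hW
  have := hN v hv
  rw [one_pow, map_one, one_mul] at this
  exact hv0 this

lemma Wsp_indep : iSupIndep (Wsp e) :=
  Module.End.independent_iInf_maxGenEigenspace_of_forall_mapsTo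
    (fun k => LinearMap.mulLeft ℂ (e (X k)))
    (fun _ _ _ => Module.End.mapsTo_maxGenEigenspace_of_comm (mulLeft_comm' _ _) _)

lemma Wsp_top [FiniteDimensional ℂ A] : ⨆ χ, Wsp e χ = ⊤ :=
  Module.End.iSup_iInf_maxGenEigenspace_eq_top_of_forall_mapsTo
    (fun k => LinearMap.mulLeft ℂ (e (X k)))
    (fun _ _ _ => Module.End.mapsTo_maxGenEigenspace_of_comm (mulLeft_comm' _ _) _)
    (fun _ => Module.End.iSup_maxGenEigenspace_eq_top _)

lemma Wsp_ne_bot [FiniteDimensional ℂ A] (he : Function.Surjective e) {χ : Fin m → ℂ}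
    (hχ : ∀ p, e p = 0 → eval χ p = 0) : Wsp e χ ≠ ⊥ := by
  intro hbot
  have key : ∀ v : A, ∀ p, e p = v → eval χ p = 0 := by
    intro v
    have hv : v ∈ ⨆ χ, Wsp e χ := by rw [Wsp_top]; trivial
    refine Submodule.iSup_induction (Wsp e) (motive := fun v => ∀ p, e p = v → eval χ p = 0)
      hv ?_ hχ ?_
    · intro χ' v hv p hp
      by_cases hc : χ' = χ
      · rw [hc, hbot, Submodule.mem_bot] at hv
        exact hχ p (hp.trans hv)
      obtain ⟨k, hk⟩ : ∃ k, χ' k ≠ χ k := by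
        by_contra h; push Not at h; exact hc (funext h)
      obtain ⟨N, hN⟩ := (Wsp_mem e).1 hv k
      rw [← hp, ← map_mul] at hN
      have := hχ _ hN
      rw [map_mul, map_pow, map_sub, eval_X, eval_C] at this
      exact (mul_eq_zero.1 this).resolve_left (pow_ne_zero _ (sub_ne_zero.2 hk.symm))
    · intro v w hv hw p hp
      obtain ⟨q, hq⟩ := he v
      have h1 := hv q hq
      have h2 := hw (p - q) (by rw [map_sub, hp, hq]; abel)
      rw [map_sub, h1, sub_zero] at h2
      exact h2
  have := key 1 1 (map_one e)
  simp at this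

lemma trace_Wsp [FiniteDimensional ℂ A] (χ : Fin m → ℂ) (p : MvPolynomial (Fin m) ℂ) :
    LinearMap.trace ℂ (Wsp e χ) ((LinearMap.mulLeft ℂ (e p)).restrict (Wsp_mapsTo e (e p) χ))
      = (Module.finrank ℂ (Wsp e χ) : ℂ) * eval χ p := by
  set f : Module.End ℂ (Wsp e χ) := (LinearMap.mulLeft ℂ (e p)).restrict (Wsp_mapsTo e (e p) χ)
  have hnil : IsNilpotent (f - (eval χ p) • (1 : Module.End ℂ (Wsp e χ))) := by
    obtain ⟨N, hN⟩ := sub_eval_mem_rad e χ p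
    refine ⟨N, LinearMap.ext fun v => ?_⟩
    have key : ∀ (k : ℕ) (v : Wsp e χ),
        (((f - (eval χ p) • (1 : Module.End ℂ (Wsp e χ))) ^ k) v : A)
          = e ((p - C (eval χ p)) ^ k) * v := by
      intro k
      induction k with
      | zero => intro v; simp
      | succ k ih =>
        intro v
        rw [pow_succ, Module.End.mul_apply, ih, pow_succ, map_mul, mul_assoc]
        congr 1
        have : ∀ c, e (C c) = algebraMap ℂ A c := fun c => e.commutes c
        have hf : ((f v : Wsp e χ) : A) = e p * v := rfl
        simp [hf, sub_mul, Algebra.smul_def, this]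
    apply Subtype.ext
    rw [key]
    exact hN v v.2
  have h := (LinearMap.isNilpotent_trace_of_isNilpotent hnil).eq_zero
  have h' := (LinearMap.trace ℂ (Wsp e χ)).map_sub f ((eval χ p) • (1 : Module.End ℂ (Wsp e χ)))
  rw [h, map_smul, LinearMap.trace_one, eq_comm, sub_eq_zero] at h'
  rw [h', smul_eq_mul, mul_comm]

lemma trace_alg [FiniteDimensional ℂ A] (he : Function.Surjective e) :
    ∃ (Z : Finset (Fin m → ℂ)) (μ : (Fin m → ℂ) → ℕ),
      (∀ z, z ∈ Z ↔ ∀ p, e p = 0 → eval z p = 0) ∧ (∀ z ∈ Z, 0 < μ z) ∧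
      ∀ p, LinearMap.trace ℂ A (LinearMap.mulLeft ℂ (e p)) = ∑ z ∈ Z, (μ z : ℂ) * eval z p := by
  classical
  have hfin : {χ | Wsp e χ ≠ ⊥}.Finite := WellFoundedGT.finite_ne_bot_of_iSupIndep (Wsp_indep e)
  have hInt : DirectSum.IsInternal (Wsp e) :=
    DirectSum.isInternal_submodule_of_iSupIndep_of_iSup_eq_top (Wsp_indep e) (Wsp_top e)
  refine ⟨hfin.toFinset, fun z => Module.finrank ℂ (Wsp e z), ?_, ?_, ?_⟩
  · intro z
    rw [Set.Finite.mem_toFinset]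
    exact ⟨fun h p hp => Wsp_eval_zero e h hp, fun h => Wsp_ne_bot e he h⟩
  · intro z hz
    rw [Set.Finite.mem_toFinset] at hz
    have : Nontrivial (Wsp e z) := (Submodule.nontrivial_iff_ne_bot).2 hz
    exact Module.finrank_pos
  · intro p
    rw [LinearMap.trace_eq_sum_trace_restrict' hInt hfin (Wsp_mapsTo e (e p))]
    exact Finset.sum_congr rfl fun z _ => trace_Wsp e z p

end tracealg

section traceideal
variable {m : ℕ}

theorem trace_ideal (I : Ideal (MvPolynomial (Fin m) ℂ)) (B : Finset (Fin m →₀ ℕ))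
    (u : (Fin m →₀ ℕ) → (Fin m →₀ ℕ) → ℂ)
    (hspan : ∀ γ, monomial γ 1 - ∑ b ∈ B, monomial b (u γ b) ∈ I)
    (hind : ∀ c : (Fin m →₀ ℕ) → ℂ, ∑ b ∈ B, monomial b (c b) ∈ I → ∀ b ∈ B, c b = 0) :
    ∃ (Z : Finset (Fin m → ℂ)) (μ : (Fin m → ℂ) → ℕ),
      (∀ z, z ∈ Z ↔ ∀ p ∈ I, eval z p = 0) ∧ (∀ z ∈ Z, 0 < μ z) ∧
      (∑ z ∈ Z, μ z = B.card) ∧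
      ∀ γ, ∑ b ∈ B, u (γ + b) b = ∑ z ∈ Z, (μ z : ℂ) * eval z (monomial γ 1) := by
  classical
  set e : MvPolynomial (Fin m) ℂ →ₐ[ℂ] (MvPolynomial (Fin m) ℂ ⧸ I) := Ideal.Quotient.mkₐ ℂ I
  have he : Function.Surjective e := Ideal.Quotient.mkₐ_surjective ℂ I
  have he0 : ∀ p, e p = 0 ↔ p ∈ I := fun p => Ideal.Quotient.eq_zero_iff_mem
  have hmon : ∀ (b : Fin m →₀ ℕ) (c : ℂ), c • e (monomial b 1) = e (monomial b c) := by
    intro b c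
    rw [← map_smul, smul_monomial, smul_eq_mul, mul_one]
  have hγ : ∀ γ, e (monomial γ 1) = ∑ b : B, u γ b • e (monomial b.1 1) := by
    intro γ
    have := (he0 _).2 (hspan γ)
    rw [map_sub, sub_eq_zero] at this
    rw [this, map_sum, ← Finset.sum_coe_sort]
    exact Finset.sum_congr rfl fun b _ => (hmon _ _).symm
  let v : B → (MvPolynomial (Fin m) ℂ ⧸ I) := fun b => e (monomial b.1 1)
  have hli : LinearIndependent ℂ v := by
    rw [Fintype.linearIndependent_iff]
    intro g hg b
    have h1 := hind (fun b => if h : b ∈ B then g ⟨b, h⟩ else 0) (by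
      rw [← he0, map_sum, ← Finset.sum_coe_sort, ← hg]
      refine Finset.sum_congr rfl fun b _ => ?_
      rw [dif_pos b.2, hmon]) b b.2
    simpa using h1
  have hsp : ⊤ ≤ Submodule.span ℂ (Set.range v) := by
    intro a _
    obtain ⟨p, rfl⟩ := he a
    induction p using MvPolynomial.induction_on' with
    | monomial γ c =>
      rw [← hmon, hγ]
      exact Submodule.smul_mem _ _ (Submodule.sum_mem _ fun b _ =>
        Submodule.smul_mem _ _ (Submodule.subset_span ⟨b, rfl⟩))
    | add p q hp hq => rw [map_add]; exact Submodule.add_mem _ (hp trivial) (hq trivial)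
  let bas : Module.Basis B ℂ (MvPolynomial (Fin m) ℂ ⧸ I) := Module.Basis.mk hli hsp
  have hbas : ∀ b, bas b = e (monomial b.1 1) := fun b => Module.Basis.mk_apply hli hsp b
  have : FiniteDimensional ℂ (MvPolynomial (Fin m) ℂ ⧸ I) := bas.finiteDimensional_of_finite
  obtain ⟨Z, μ, h1, h2, h3⟩ := trace_alg e he
  refine ⟨Z, μ, ?_, h2, ?_, ?_⟩
  · intro z; rw [h1]; simp only [he0]
  · have := h3 1
    rw [map_one, LinearMap.mulLeft_one] at this
    have h4 : LinearMap.trace ℂ (MvPolynomial (Fin m) ℂ ⧸ I) LinearMap.id = (B.card : ℂ) := by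
      rw [LinearMap.trace_id, Module.finrank_eq_card_basis bas, Fintype.card_coe]
    rw [h4] at this
    simp only [map_one, mul_one] at this
    exact_mod_cast this.symm
  · intro γ
    rw [← h3, LinearMap.trace_eq_matrix_trace ℂ bas, Matrix.trace, ← Finset.sum_coe_sort]
    refine Finset.sum_congr rfl fun b _ => ?_
    rw [Matrix.diag_apply, LinearMap.toMatrix_apply, LinearMap.mulLeft_apply, hbas, ← map_mul,
      monomial_mul, one_mul, hγ]
    simp only [← hbas, map_sum, map_smul, Module.Basis.repr_self, Finsupp.coe_finsetSum,
      Finset.sum_apply, Finsupp.smul_apply, Finsupp.single_apply]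
    simp

end traceideal
end HP

namespace HP

section descartes
open Polynomial

lemma eraseLead_comp_neg (p : ℝ[X]) :
    (p.comp (-Polynomial.X)).eraseLead = p.eraseLead.comp (-Polynomial.X) := by
  have h := Polynomial.eraseLead_add_C_mul_X_pow p
  have h2 : p.comp (-Polynomial.X) = p.eraseLead.comp (-Polynomial.X) +
      Polynomial.C ((-1) ^ p.natDegree * p.leadingCoeff) * Polynomial.X ^ p.natDegree := by
    conv_lhs => rw [← h]
    rw [Polynomial.add_comp, Polynomial.mul_comp, Polynomial.C_comp, Polynomial.pow_comp,
      Polynomial.X_comp, neg_pow, Polynomial.C_mul, Polynomial.C_pow, Polynomial.C_neg,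
      Polynomial.C_1]
    ring
  have h3 := Polynomial.eraseLead_add_C_mul_X_pow (p.comp (-Polynomial.X))
  rw [Polynomial.comp_neg_X_leadingCoeff_eq] at h3
  have h4 : (p.comp (-Polynomial.X)).natDegree = p.natDegree := by
    rw [Polynomial.natDegree_comp]; simp
  rw [h4] at h3
  exact add_right_cancel (h3.trans h2)

lemma sv_add (k : ℕ) : ∀ (d : ℕ) (p : ℝ[X]), p.natDegree = d → p ≠ 0 → (∀ i < k, p.coeff i = 0) →
    p.signVariations + (p.comp (-Polynomial.X)).signVariations + k ≤ d := by
  intro d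
  induction d using Nat.strong_induction_on with
  | _ d ih =>
  intro p hd hp hk
  have hkd : k ≤ d := by
    by_contra hc
    exact hp (Polynomial.leadingCoeff_eq_zero.1 (hk _ (by rw [hd]; lia)))
  have hp2 : p.comp (-Polynomial.X) ≠ 0 := by rwa [Ne, Polynomial.comp_neg_X_eq_zero_iff]
  rw [Polynomial.signVariations_eq_eraseLead_add_ite hp,
    Polynomial.signVariations_eq_eraseLead_add_ite hp2, eraseLead_comp_neg,
    Polynomial.comp_neg_X_leadingCoeff_eq, Polynomial.comp_neg_X_leadingCoeff_eq, hd]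
  have hl : p.leadingCoeff ≠ 0 := Polynomial.leadingCoeff_ne_zero.2 hp
  by_cases hq : p.eraseLead = 0
  · simp [hq, hl, hkd]
  have hlt : p.eraseLead.natDegree < d := by
    rw [← hd]
    refine Polynomial.eraseLead_natDegree_lt ?_
    by_contra hc
    apply hq
    rw [← Polynomial.card_support_eq_zero]
    have := Polynomial.card_support_eraseLead (f := p)
    have : p.support.card ≠ 0 := by simpa using hp
    lia
  have hkq : ∀ i < k, p.eraseLead.coeff i = 0 := by
    intro i hi
    rw [Polynomial.eraseLead_coeff]; split_ifs
    · rfl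
    · exact hk i hi
  have := ih _ hlt p.eraseLead rfl hq hkq
  have hl2 : p.eraseLead.leadingCoeff ≠ 0 := Polynomial.leadingCoeff_ne_zero.2 hq
  set e := p.eraseLead.natDegree
  set a := p.leadingCoeff
  set b := p.eraseLead.leadingCoeff
  have hcase : (if SignType.sign a = -SignType.sign b then 1 else 0) +
      (if SignType.sign ((-1) ^ d * a) = -SignType.sign ((-1) ^ e * b) then 1 else 0) ≤ d - e := by
    rcases Nat.even_or_odd d with hd' | hd' <;> rcases Nat.even_or_odd e with he' | he'
    · have : 2 ≤ d - e := by
        obtain ⟨x, rfl⟩ := hd'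
        obtain ⟨y, hy⟩ := he'; lia
      split_ifs <;> lia
    · rw [hd'.neg_one_pow, he'.neg_one_pow]
      rcases lt_or_gt_of_ne hl with h1 | h1 <;> rcases lt_or_gt_of_ne hl2 with h2 | h2 <;>
      · have h3 := h1
        have h4 := h2
        simp only [one_mul, neg_mul, Left.sign_neg, sign_neg, sign_pos, h3, h4]
        simp +decide
        lia
    · rw [hd'.neg_one_pow, he'.neg_one_pow]
      rcases lt_or_gt_of_ne hl with h1 | h1 <;> rcases lt_or_gt_of_ne hl2 with h2 | h2 <;>
      · have h3 := h1
        have h4 := h2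
        simp only [one_mul, neg_mul, Left.sign_neg, sign_neg, sign_pos, h3, h4]
        simp +decide
        lia
    · have : 2 ≤ d - e := by
        obtain ⟨x, hx⟩ := hd'
        obtain ⟨y, hy⟩ := he'; lia
      split_ifs <;> lia
  lia

variable {B : Type*} [Fintype B]

lemma counts (l : B → ℝ) (p : ℝ[X]) (hp : p = ∏ b, (Polynomial.X - Polynomial.C (l b))) :
    (Finset.univ.filter fun b => 0 < l b).card = p.signVariations ∧
    (Finset.univ.filter fun b => l b < 0).card = (p.comp (-Polynomial.X)).signVariations := by
  classical
  have hmon : p.Monic := by rw [hp]; exact Polynomial.monic_prod_X_sub_C _ _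
  have hp0 : p ≠ 0 := hmon.ne_zero
  have hdeg : p.natDegree = Fintype.card B := by
    rw [hp, Polynomial.natDegree_finsetProd_X_sub_C_eq_card]; rfl
  have hroots : p.roots = Finset.univ.val.map l := by
    have := Polynomial.roots_multiset_prod_X_sub_C (Finset.univ.val.map l)
    rw [Multiset.map_map] at this
    rw [hp]; exact this
  have h1 : (Finset.univ.filter fun b => 0 < l b).card ≤ p.signVariations := by
    refine le_trans (le_of_eq ?_) (Polynomial.roots_countP_pos_le_signVariations _)
    rw [hroots, Multiset.countP_map]; rfl
  have h2 : (Finset.univ.filter fun b => l b < 0).card ≤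
      (p.comp (-Polynomial.X)).signVariations := by
    refine le_trans (le_of_eq ?_) (Polynomial.roots_countP_pos_le_signVariations _)
    rw [Polynomial.roots_comp_neg_X, hroots, Multiset.map_map, Multiset.countP_map]
    simp only [Function.comp_apply, Left.neg_pos_iff]; rfl
  have h3 := sv_add (Finset.univ.filter fun b => l b = 0).card _ p rfl hp0 (by
    rw [← Polynomial.X_pow_dvd_iff, hp, ← Finset.prod_const]
    refine dvd_trans ?_ (Finset.prod_dvd_prod_of_subset _ _ _
      (Finset.filter_subset (fun b => l b = 0) Finset.univ))
    refine (Finset.prod_dvd_prod_of_dvd _ _ fun b hb => ?_)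
    rw [(Finset.mem_filter.1 hb).2]; simp)
  have h4 : (Finset.univ.filter fun b => 0 < l b).card + (Finset.univ.filter fun b => l b < 0).card
      + (Finset.univ.filter fun b => l b = 0).card = Fintype.card B := by
    rw [← Finset.card_union_of_disjoint, ← Finset.card_union_of_disjoint, ← Finset.card_univ]
    · congr 1; ext b
      simp only [Finset.mem_union, Finset.mem_filter, Finset.mem_univ, true_and, iff_true]
      rcases lt_trichotomy (l b) 0 with h | h | h <;> simp [h]
    · rw [Finset.disjoint_left]; intro b hb hb'
      simp only [Finset.mem_union, Finset.mem_filter, Finset.mem_univ, true_and] at hb hb'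
      rw [hb'] at hb; simp at hb
    · rw [Finset.disjoint_left]; intro b hb hb'
      simp only [Finset.mem_filter, Finset.mem_univ, true_and] at hb hb'
      exact lt_asymm hb hb'
  lia

lemma sv_congr {p q : ℝ[X]} (hd : p.degree = q.degree)
    (h : ∀ k, SignType.sign (p.coeff k) = SignType.sign (q.coeff k)) :
    p.signVariations = q.signVariations := by
  have : (p.coeffList).map SignType.sign = (q.coeffList).map SignType.sign := by
    rw [Polynomial.coeffList, Polynomial.coeffList, List.map_map, List.map_map, hd]
    exact List.map_congr_left fun k _ => h k
  rw [Polynomial.signVariations, Polynomial.signVariations, this]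

lemma coeff_comp_neg (p : ℝ[X]) (k : ℕ) :
    (p.comp (-Polynomial.X)).coeff k = (-1) ^ k * p.coeff k := by
  induction p using Polynomial.induction_on' with
  | add p q hp hq => rw [Polynomial.add_comp, Polynomial.coeff_add, hp, hq, Polynomial.coeff_add]; ring
  | monomial n a =>
    rw [Polynomial.monomial_comp, neg_pow, ← mul_assoc, ← Polynomial.C_1, ← Polynomial.C_neg,
      ← Polynomial.C_pow, ← Polynomial.C_mul, Polynomial.coeff_C_mul_X_pow,
      Polynomial.coeff_monomial]
    by_cases hk : k = n
    · subst hk; simp [mul_comm]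
    · simp [hk, Ne.symm hk]

theorem sign_det {B' : Type*} [Fintype B'] (hB : Fintype.card B = Fintype.card B') (l : B → ℝ)
    (l' : B' → ℝ) (p q : ℝ[X])
    (hp : p = ∏ b, (Polynomial.X - Polynomial.C (l b)))
    (hq : q = ∏ b, (Polynomial.X - Polynomial.C (l' b)))
    (h : ∀ k, SignType.sign (p.coeff k) = SignType.sign (q.coeff k)) :
    (Finset.univ.filter fun b => 0 < l b).card = (Finset.univ.filter fun b => 0 < l' b).card ∧
    (Finset.univ.filter fun b => l b < 0).card = (Finset.univ.filter fun b => l' b < 0).card := by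
  have h1 := counts l p hp
  have h2 := counts l' q hq
  have hm1 : p.Monic := by rw [hp]; exact Polynomial.monic_prod_X_sub_C _ _
  have hm2 : q.Monic := by rw [hq]; exact Polynomial.monic_prod_X_sub_C _ _
  have hd1 : p.natDegree = Fintype.card B := by
    rw [hp, Polynomial.natDegree_finsetProd_X_sub_C_eq_card]; rfl
  have hd2 : q.natDegree = Fintype.card B' := by
    rw [hq, Polynomial.natDegree_finsetProd_X_sub_C_eq_card]; rfl
  have hd : p.degree = q.degree := by
    rw [Polynomial.degree_eq_natDegree hm1.ne_zero, Polynomial.degree_eq_natDegree hm2.ne_zero,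
      hd1, hd2, hB]
  rw [h1.1, h1.2, h2.1, h2.2]
  refine ⟨sv_congr hd h, sv_congr (by simpa using hd) fun k => ?_⟩
  rw [coeff_comp_neg, coeff_comp_neg, sign_mul, sign_mul, h]

end descartes
end HP

namespace HP

section hermite
open ComplexConjugate
variable {B : Type*} [Fintype B]

lemma pos_ge (l : B → ℝ) (T : (B → ℝ) ≃ₗ[ℝ] (B → ℝ)) {W : Type*} [AddCommGroup W] [Module ℝ W]
    (L : W →ₗ[ℝ] (B → ℝ)) (h : ∀ w, w ≠ 0 → 0 < ∑ b, l b * (T (L w) b) ^ 2) :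
    Module.finrank ℝ W ≤ (Finset.univ.filter fun b => 0 < l b).card := by
  classical
  let P : W →ₗ[ℝ] ({b // 0 < l b} → ℝ) :=
    (LinearMap.funLeft ℝ ℝ (Subtype.val : {b // 0 < l b} → B)) ∘ₗ T.toLinearMap ∘ₗ L
  have hP : Function.Injective P := by
    rw [injective_iff_map_eq_zero]
    intro w hw
    by_contra hne
    have h1 := h w hne
    have h2 : ∑ b, l b * (T (L w) b) ^ 2 ≤ 0 := by
      refine Finset.sum_nonpos fun b _ => ?_
      by_cases hb : 0 < l b
      · have : T (L w) b = 0 := congrFun hw ⟨b, hb⟩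
        rw [this]; simp
      · exact mul_nonpos_of_nonpos_of_nonneg (not_lt.1 hb) (sq_nonneg _)
    exact absurd h1 (not_lt.2 h2)
  have := LinearMap.finrank_le_finrank_of_injective hP
  rwa [Module.finrank_pi, Fintype.card_subtype] at this

def incl (l : B → ℝ) : ({b // 0 < l b} → ℝ) →ₗ[ℝ] (B → ℝ) := by
  classical
  exact
  { toFun := fun c b => if h : 0 < l b then c ⟨b, h⟩ else 0
    map_add' := by intro c d; funext b; by_cases h : 0 < l b <;> simp [h]
    map_smul' := by intro c d; funext b; by_cases h : 0 < l b <;> simp [h] }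

lemma incl_pos (l : B → ℝ) (T : (B → ℝ) ≃ₗ[ℝ] (B → ℝ)) (c : {b // 0 < l b} → ℝ) (hc : c ≠ 0) :
    0 < ∑ b, l b * (T (T.symm (incl l c)) b) ^ 2 := by
  classical
  rw [LinearEquiv.apply_symm_apply]
  have hval : ∀ b, incl l c b = if h : 0 < l b then c ⟨b, h⟩ else 0 := fun b => by
    simp only [incl, LinearMap.coe_mk, AddHom.coe_mk]
  obtain ⟨b, hb⟩ := Function.ne_iff.1 hc
  refine Finset.sum_pos' (fun b' _ => ?_) ⟨b.1, Finset.mem_univ _, ?_⟩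
  · rw [hval]
    split_ifs with h
    · exact mul_nonneg h.le (sq_nonneg _)
    · simp
  · rw [hval, dif_pos b.2]
    exact mul_pos b.2 (pow_pos_of_ne hb)
where
  pow_pos_of_ne {x : ℝ} (h : x ≠ 0) : 0 < x ^ 2 := by positivity

lemma finrank_incl (l : B → ℝ) : Module.finrank ℝ ({b // 0 < l b} → ℝ) =
    (Finset.univ.filter fun b => 0 < l b).card := by
  classical
  rw [Module.finrank_pi, Fintype.card_subtype]

variable {ι : Type*} [Fintype ι]

def EE (ev : B → ι → ℂ) : (B → ℝ) →ₗ[ℝ] (ι → ℂ) where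
  toFun a i := ∑ b, (a b : ℂ) * ev b i
  map_add' a a' := by funext i; simp [add_mul, Finset.sum_add_distrib]
  map_smul' r a := by funext i; simp [Finset.mul_sum, mul_assoc]

lemma EE_apply (ev : B → ι → ℂ) (a : B → ℝ) (i : ι) : EE ev a i = ∑ b, (a b : ℂ) * ev b i := rfl

lemma EE_conj {σ : ι → ι} {ev : B → ι → ℂ} (hev : ∀ b i, ev b (σ i) = conj (ev b i))
    (a : B → ℝ) (i : ι) : EE ev a (σ i) = conj (EE ev a i) := by
  simp [EE_apply, hev]

lemma EE_lift {σ : ι → ι} (hσ : ∀ i, σ (σ i) = i) {ev : B → ι → ℂ}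
    (hev : ∀ b i, ev b (σ i) = conj (ev b i))
    (hsurj : ∀ h : ι → ℂ, ∃ c : B → ℂ, ∀ i, h i = ∑ b, c b * ev b i)
    {W : Type*} [AddCommGroup W] [Module ℝ W] (L : W →ₗ[ℝ] (ι → ℂ))
    (hL : ∀ w i, L w (σ i) = conj (L w i)) :
    ∃ L' : W →ₗ[ℝ] (B → ℝ), ∀ w, EE ev (L' w) = L w := by
  have hmem : ∀ w, L w ∈ LinearMap.range (EE ev) := by
    intro w
    obtain ⟨c, hc⟩ := hsurj (L w)
    refine ⟨fun b => (c b).re, funext fun i => ?_⟩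
    have h1 : L w i = ∑ b, conj (c b) * ev b i := by
      have := congrArg conj (hc (σ i))
      rw [hL, Complex.conj_conj] at this
      rw [this, map_sum]
      refine Finset.sum_congr rfl fun b _ => ?_
      rw [map_mul, hev, Complex.conj_conj]
    have h2 : EE ev (fun b => (c b).re) i = (L w i + L w i) / 2 := by
      conv_rhs => rw [h1]
      conv_rhs => enter [1, 1]; rw [← h1, hc]
      rw [EE_apply, ← Finset.sum_add_distrib, Finset.sum_div]
      refine Finset.sum_congr rfl fun b _ => ?_
      rw [Complex.re_eq_add_conj]; ring
    rw [h2]; ring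
  obtain ⟨S, hS⟩ := (EE ev).rangeRestrict.exists_rightInverse_of_surjective
    (EE ev).range_rangeRestrict
  refine ⟨S ∘ₗ L.codRestrict _ hmem, fun w => ?_⟩
  have := LinearMap.congr_fun hS (L.codRestrict _ hmem w)
  exact congrArg Subtype.val this

lemma exists_j (σ : ι → ι) (hσ : ∀ i, σ (σ i) = i) : ∃ j : ι → ℂ,
    (∀ i, j (σ i) = conj (j i)) ∧ (∀ i, σ i = i → j i = 0) ∧ (∀ i, σ i ≠ i → j i ^ 2 = -1) := by
  classical
  let o := Fintype.equivFin ι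
  refine ⟨fun i => if σ i = i then 0 else if o i < o (σ i) then Complex.I else -Complex.I,
    ?_, ?_, ?_⟩
  · intro i
    by_cases h : σ i = i
    · simp [h]
    · have h' : ¬ (σ (σ i) = σ i) := by rw [hσ]; exact Ne.symm h
      have h'' : i ≠ σ i := Ne.symm h
      have hne : o i ≠ o (σ i) := fun hc => h'' (o.injective hc)
      simp only [hσ, if_neg h, if_neg h'']
      rcases lt_or_gt_of_ne hne with h1 | h1
      · simp [h1, not_lt.2 h1.le]
      · simp [h1, not_lt.2 h1.le]
  · intro i h; simp [h]
  · intro i h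
    simp only [h, if_false]
    split_ifs <;> simp

def mulJ (j : ι → ℂ) : (ι → ℂ) →ₗ[ℝ] (ι → ℂ) where
  toFun h i := j i * h i
  map_add' a a' := by funext i; simp [mul_add]
  map_smul' r a := by funext i; simp [mul_left_comm]

theorem hermite (σ : ι → ι) (hσ : ∀ i, σ (σ i) = i) (μ : ι → ℝ) (hμ : ∀ i, 0 < μ i)
    (ev : B → ι → ℂ) (hev : ∀ b i, ev b (σ i) = conj (ev b i))
    (hsurj : ∀ h : ι → ℂ, ∃ c : B → ℂ, ∀ i, h i = ∑ b, c b * ev b i)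
    (l : B → ℝ) (T : (B → ℝ) ≃ₗ[ℝ] (B → ℝ))
    (hQ : ∀ a : B → ℝ, ((∑ b, l b * (T a b) ^ 2 : ℝ) : ℂ) = ∑ i, (μ i : ℂ) * (EE ev a i) ^ 2) :
    (∃ i, σ i = i) ↔ (Finset.univ.filter fun b => l b < 0).card <
      (Finset.univ.filter fun b => 0 < l b).card := by
  classical
  obtain ⟨j, hj1, hj2, hj3⟩ := exists_j σ hσ
  have hneg : (Finset.univ.filter fun b => l b < 0).card =
      (Finset.univ.filter fun b => 0 < (-l) b).card := by
    congr 1; ext b; simp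
  have hnegsum : ∀ a : B → ℝ, ∑ b, (-l) b * (T a b) ^ 2 = - ∑ b, l b * (T a b) ^ 2 := by
    intro a; rw [← Finset.sum_neg_distrib]; simp
  constructor
  · rintro ⟨i0, hi0⟩
    -- positive definite space of dimension `#neg + 1`
    let W := ({b // 0 < (-l) b} → ℝ)
    let e0 : ℝ →ₗ[ℝ] (ι → ℂ) :=
      { toFun := fun c i => if i = i0 then (c : ℂ) else 0
        map_add' := by intro a b; funext i; by_cases h : i = i0 <;> simp [h]
        map_smul' := by intro a b; funext i; by_cases h : i = i0 <;> simp [h] }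
    have he0 : ∀ c i, e0 c i = if i = i0 then (c : ℂ) else 0 := fun _ _ => rfl
    let L0 : W →ₗ[ℝ] (B → ℝ) := T.symm.toLinearMap ∘ₗ incl (-l)
    let L : W × ℝ →ₗ[ℝ] (ι → ℂ) :=
      LinearMap.coprod (mulJ j ∘ₗ EE ev ∘ₗ L0) e0
    have hLv : ∀ w i, L w i = j i * EE ev (L0 w.1) i + e0 w.2 i := fun w i => rfl
    obtain ⟨L', hL'⟩ := EE_lift hσ hev hsurj L (by
      intro w i
      rw [hLv, hLv, hj1, EE_conj hev, map_add, map_mul, he0, he0]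
      by_cases h : i = i0
      · simp [h, hi0]
      · have : σ i ≠ i0 := by
          intro hc; apply h; rw [← hσ i, hc, hi0]
        simp [h, this])
    have hreal : ∀ a i, σ i = i → ∃ r : ℝ, EE ev a i = r := by
      intro a i hi
      have := EE_conj hev a i
      rw [hi] at this
      exact ⟨_, (Complex.conj_eq_iff_real.1 this.symm).choose_spec⟩
    have key : ∀ w : W × ℝ, (∑ b, l b * (T (L' w) b) ^ 2 : ℝ) =
        (∑ b, (-l) b * (T (L0 w.1) b) ^ 2 : ℝ) + (∑ i, if σ i = i then μ i * (EE ev (L0 w.1) i).re ^ 2 else 0) + μ i0 * w.2 ^ 2 := by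
      intro w
      apply Complex.ofReal_injective
      rw [hQ, hL', hnegsum, Complex.ofReal_add, Complex.ofReal_add, Complex.ofReal_neg, hQ,
        Complex.ofReal_sum]
      have h3 : ((μ i0 * w.2 ^ 2 : ℝ) : ℂ) = ∑ i, if i = i0 then (μ i0 : ℂ) * (w.2 : ℂ) ^ 2 else 0 := by
        simp
      rw [h3, ← Finset.sum_neg_distrib, ← Finset.sum_add_distrib, ← Finset.sum_add_distrib]
      refine Finset.sum_congr rfl fun i _ => ?_
      rw [hLv, he0]
      by_cases hi : σ i = i
      · obtain ⟨r, hr⟩ := hreal (L0 w.1) i hi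
        rw [hj2 i hi, hr, if_pos hi]
        by_cases h : i = i0
        · subst h; simp
        · simp [h]
      · have : i ≠ i0 := by rintro rfl; exact hi hi0
        have h4 := hj3 i hi
        simp only [this, hi, if_false, add_zero, Complex.ofReal_zero]
        rw [mul_pow, h4]; ring
    have := pos_ge l T L' (by
      intro w hw
      rw [key]
      have hn1 : 0 ≤ ∑ i, if σ i = i then μ i * (EE ev (L0 w.1) i).re ^ 2 else 0 :=
        Finset.sum_nonneg fun i _ => by
          split_ifs
          · exact mul_nonneg (hμ i).le (sq_nonneg _)
          · exact le_rfl
      have hn2 : 0 ≤ μ i0 * w.2 ^ 2 := mul_nonneg (hμ i0).le (sq_nonneg _)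
      by_cases h1 : w.1 = 0
      · have h2 : w.2 ≠ 0 := fun h => hw (Prod.ext h1 h)
        have : 0 < μ i0 * w.2 ^ 2 := mul_pos (hμ i0) (by positivity)
        have h0 : ∑ b, (-l) b * (T (L0 w.1) b) ^ 2 = 0 := by
          rw [h1, map_zero]; simp
        linarith
      · have : 0 < ∑ b, (-l) b * (T (L0 w.1) b) ^ 2 := incl_pos (-l) T w.1 h1
        linarith)
    rw [Module.finrank_prod, finrank_incl, Module.finrank_self, ← hneg] at this
    lia
  · intro hlt
    by_contra hno
    push Not at hno
    let L0 : ({b // 0 < l b} → ℝ) →ₗ[ℝ] (B → ℝ) := T.symm.toLinearMap ∘ₗ incl l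
    obtain ⟨L', hL'⟩ := EE_lift hσ hev hsurj (mulJ j ∘ₗ EE ev ∘ₗ L0) (by
      intro w i
      change j (σ i) * EE ev (L0 w) (σ i) = conj (j i * EE ev (L0 w) i)
      rw [hj1, EE_conj hev, map_mul])
    have := pos_ge (-l) T L' (by
      intro w hw
      have h1 : 0 < ∑ b, l b * (T (L0 w) b) ^ 2 := incl_pos l T w hw
      have h2 : ∑ b, (-l) b * (T (L' w) b) ^ 2 = ∑ b, l b * (T (L0 w) b) ^ 2 := by
        rw [hnegsum]
        apply Complex.ofReal_injective
        rw [Complex.ofReal_neg, hQ, hQ, hL', ← Finset.sum_neg_distrib]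
        refine Finset.sum_congr rfl fun i _ => ?_
        change -((μ i : ℂ) * (j i * EE ev (L0 w) i) ^ 2) = _
        rw [mul_pow, hj3 i (hno i)]; ring
      rw [h2]; exact h1)
    rw [finrank_incl, ← hneg] at this
    lia

end hermite
end HP

namespace HP

section odd
open ComplexConjugate

lemma odd_fixed {ι B : Type*} [Fintype ι] [Fintype B] (σ : ι → ι) (hσ : ∀ i, σ (σ i) = i)
    (μ : ι → ℕ)
    (ev : B → ι → ℂ) (hev : ∀ b i, ev b (σ i) = conj (ev b i))
    (hsurj : ∀ h : ι → ℂ, ∃ c : B → ℂ, ∀ i, h i = ∑ b, c b * ev b i)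
    (hT : ∀ b, ∃ r : ℝ, (r : ℂ) = ∑ i, (μ i : ℂ) * ev b i)
    (hodd : Odd (∑ i, μ i)) : ∃ i, σ i = i := by
  classical
  by_contra hno
  push Not at hno
  obtain ⟨j, hj1, hj2, hj3⟩ := exists_j σ hσ
  obtain ⟨L', hL'⟩ := EE_lift hσ hev hsurj (LinearMap.toSpanSingleton ℝ (ι → ℂ) j) (by
    intro w i
    simp [hj1])
  have h1 : EE ev (L' 1) = j := by rw [hL']; simp
  choose r hr using hT
  have h2 : ∑ i, (μ i : ℂ) * j i = ((∑ b, L' 1 b * r b : ℝ) : ℂ) := by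
    rw [← h1, Complex.ofReal_sum]
    simp only [EE_apply, Finset.mul_sum, Complex.ofReal_mul, hr]
    rw [Finset.sum_comm]
    refine Finset.sum_congr rfl fun b _ => Finset.sum_congr rfl fun i _ => ?_
    ring
  have hj4 : ∀ i, ∃ e : ℤ, j i = e * Complex.I ∧ Odd e := by
    intro i
    have := hj3 i (hno i)
    have h3 : (j i - Complex.I) * (j i + Complex.I) = 0 := by
      linear_combination this - Complex.I_sq
    rcases mul_eq_zero.1 h3 with h | h
    · exact ⟨1, by push_cast; linear_combination h, odd_one⟩
    · exact ⟨-1, by push_cast; linear_combination h, by decide⟩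
  choose e he1 he2 using hj4
  have h5 : ∑ i, (μ i : ℤ) * e i = 0 := by
    have := congrArg Complex.im h2
    rw [Complex.ofReal_im, Complex.im_sum] at this
    have h6 : ∀ i, ((μ i : ℂ) * j i).im = ((μ i * e i : ℤ) : ℝ) := by
      intro i; rw [he1]; simp
    simp only [h6] at this
    exact_mod_cast this
  have h7 : Even (∑ i, (μ i : ℤ)) := by
    have : (∑ i, (μ i : ℤ)) = ∑ i, (μ i : ℤ) * (1 - e i) := by
      have : ∀ i, (μ i : ℤ) * (1 - e i) = μ i - μ i * e i := fun i => by ring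
      simp only [this, Finset.sum_sub_distrib, h5, sub_zero]
    rw [this]
    refine Finset.even_sum _ fun i _ => ?_
    exact (odd_one.sub_odd (he2 i)).mul_left _
  have h8 : Even (∑ i, μ i) := by exact_mod_cast h7
  exact (Nat.not_even_iff_odd.2 hodd) h8

end odd

section fibre
variable {m s D t : ℕ}

def evR (y : Fin t → ℝ) : MvPolynomial (Fin t) ℚ →+* ℝ := (aeval y : _ →ₐ[ℚ] ℝ).toRingHom

lemma evR_apply (y : Fin t → ℝ) (p : MvPolynomial (Fin t) ℚ) : evR y p = aeval y p := rfl

lemma tdeg_triv {S : Type*} [CommRing S] (ψ : MvPolynomial (Fin t) ℚ →+* S) :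
    ∀ k a, a ∈ (tdeg t).w k → ψ a ∈ (triv S).w k := by
  intro k a ha
  rw [triv_mem]
  intro hk
  rcases tdeg_mem.1 ha with h | h
  · rw [h, map_zero]
  · lia

/-- The specialised generators of the critical system. -/
def Gy (D : ℕ) (F : Fin s → MvPolynomial (Fin m) (MvPolynomial (Fin t) ℚ)) (y : Fin t → ℝ)
    (g : GI m s) : MvPolynomial (Fin m) ℝ := gen D (fun i => map (evR y) (F i)) g

theorem fibre (hD : 1 ≤ D) (hs : s ≤ m) (F : Fin s → MvPolynomial (Fin m) (MvPolynomial (Fin t) ℚ))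
    (hF : ∀ i, F i ∈ Fil (tdeg t) m D)
    (hspan : ∀ γ : Fin m →₀ ℕ, InN (tdeg t) D (BB m s D) F γ.degree (monomial γ 1)) :
    ∃ T : (Fin m →₀ ℕ) → MvPolynomial (Fin t) ℚ, (∀ γ, (T γ).totalDegree ≤ γ.degree) ∧
      ∀ y : Fin t → ℝ, ∃ (Z : Finset (Fin m → ℂ)) (μ : (Fin m → ℂ) → ℕ),
        (∀ z, z ∈ Z ↔ ∀ g, eval z (map Complex.ofRealHom (Gy D F y g)) = 0) ∧
        (∀ z ∈ Z, 0 < μ z) ∧ (∑ z ∈ Z, μ z = N0 m s D) ∧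
        (∀ γ, ((aeval y (T γ) : ℝ) : ℂ) = ∑ z ∈ Z, (μ z : ℂ) * eval z (monomial γ 1)) ∧
        ∀ h : (Fin m → ℂ) → ℂ, ∃ c : (Fin m →₀ ℕ) → ℂ, ∀ z ∈ Z,
          h z = ∑ b ∈ BB m s D, c b * eval z (monomial b 1) := by
  classical
  have hspan' := hspan
  choose u H hu hH hm using hspan
  refine ⟨fun γ => ∑ b ∈ BB m s D, u (γ + b) b, ?_, ?_⟩
  · intro γ
    refine totalDegree_finsetSum_le fun b hb => ?_
    have := hu (γ + b) b hb
    rcases tdeg_mem.1 this with h | h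
    · rw [h]; simp
    · rw [map_add] at h; push_cast at h; lia
  intro y
  set ψ : MvPolynomial (Fin t) ℚ →+* ℂ := Complex.ofRealHom.comp (evR y) with hψ
  set FC : Fin s → MvPolynomial (Fin m) ℂ := fun i => map ψ (F i) with hFC
  have hFC' : ∀ i, FC i ∈ Fil (triv ℂ) m D := fun i => Fil_map ψ (tdeg_triv ψ) (hF i)
  have hspC : ∀ γ : Fin m →₀ ℕ, InN (triv ℂ) D (BB m s D) FC γ.degree (monomial γ 1) := by
    intro γ
    have := (hspan' γ).map ψ (tdeg_triv ψ)
    rwa [map_monomial, map_one] at this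
  have hgen : ∀ g, gen D FC g = map Complex.ofRealHom (Gy D F y g) := by
    intro g
    rw [Gy, ← gen_map]
    simp only [MvPolynomial.map_map, hFC, hψ]
  set I := Ideal.span (Set.range (gen D FC)) with hI
  have hr : ∀ γ, monomial γ 1 - ∑ b ∈ BB m s D, monomial b (ψ (u γ b)) ∈ I := by
    intro γ
    have := congrArg (map ψ) (hm γ)
    rw [map_monomial, map_one, map_add, map_sum, map_sum] at this
    rw [this]
    simp only [map_monomial, add_sub_cancel_left, map_mul]
    refine Ideal.sum_mem _ fun g _ => Ideal.mul_mem_left _ _ ?_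
    rw [← gen_map]
    exact Ideal.subset_span ⟨g, rfl⟩
  obtain ⟨Z, μ, h1, h2, h3, h4⟩ := trace_ideal I (BB m s D) (fun γ b => ψ (u γ b)) hr
    (fun c hc => indep hD hs FC hFC' hspC c hc)
  refine ⟨Z, μ, ?_, h2, ?_, ?_, ?_⟩
  · intro z
    rw [h1]
    constructor
    · intro h g
      rw [← hgen]; exact h _ (Ideal.subset_span ⟨g, rfl⟩)
    · intro h p hp
      have : I ≤ RingHom.ker (eval z) := by
        rw [hI, Ideal.span_le]
        rintro _ ⟨g, rfl⟩
        rw [SetLike.mem_coe, RingHom.mem_ker, hgen]; exact h g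
      exact this hp
  · rw [h3, card_BB_eq hD hs FC hFC' hspC]
  · intro γ
    rw [← h4, map_sum, Complex.ofReal_sum]
    rfl
  · intro h
    have hq : ∀ q : MvPolynomial (Fin m) ℂ, ∃ c : (Fin m →₀ ℕ) → ℂ, ∀ z ∈ Z,
        eval z q = ∑ b ∈ BB m s D, c b * eval z (monomial b 1) := by
      intro q
      induction q using MvPolynomial.induction_on' with
      | monomial γ a =>
        refine ⟨fun b => a * ψ (u γ b), fun z hz => ?_⟩
        have := (h1 z).1 hz _ (hr γ)
        rw [map_sub, sub_eq_zero, map_sum] at this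
        have h5 : eval z (monomial γ a) = a * eval z (monomial γ 1) := by
          rw [eval_monomial, eval_monomial, one_mul]
        rw [h5, this, Finset.mul_sum]
        refine Finset.sum_congr rfl fun b _ => ?_
        rw [eval_monomial, eval_monomial, one_mul, mul_assoc]
      | add p q hp hq =>
        obtain ⟨c, hc⟩ := hp
        obtain ⟨d, hd⟩ := hq
        refine ⟨c + d, fun z hz => ?_⟩
        rw [map_add, hc z hz, hd z hz, ← Finset.sum_add_distrib]
        refine Finset.sum_congr rfl fun b _ => ?_
        rw [Pi.add_apply, add_mul]
    have hsep : ∀ p : Z, ∃ q : MvPolynomial (Fin m) ℂ, ∀ p' : Z,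
        eval p'.1 q = if p' = p then 1 else 0 := by
      intro p
      obtain ⟨q, _, hq2, hq3⟩ := sep_poly (fun z : Z => z.1) Subtype.val_injective p
      refine ⟨C (eval p.1 q)⁻¹ * q, fun p' => ?_⟩
      rw [map_mul, eval_C]
      split_ifs with hp
      · rw [hp, inv_mul_cancel₀ hq2]
      · rw [hq3 p' hp, mul_zero]
    choose q hq' using hsep
    obtain ⟨c, hc⟩ := hq (∑ p : Z, C (h p.1) * q p)
    refine ⟨c, fun z hz => ?_⟩
    rw [← hc z hz, map_sum]
    have : ∀ p : Z, eval z (C (h p.1) * q p) = if (⟨z, hz⟩ : Z) = p then h p.1 else 0 := by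
      intro p
      rw [map_mul, eval_C]
      have := hq' p ⟨z, hz⟩
      dsimp only at this
      rw [this]; split_ifs <;> simp
    simp only [this, Finset.sum_ite_eq, Finset.mem_univ, if_true]

end fibre
end HP

namespace HP

section spectral
variable {B : Type*} [Fintype B] [DecidableEq B]

lemma spectral_quad (A : Matrix B B ℝ) (hA : A.IsHermitian) :
    ∃ T : (B → ℝ) ≃ₗ[ℝ] (B → ℝ), ∀ a, ∑ b, hA.eigenvalues b * (T a b) ^ 2 = a ⬝ᵥ (A.mulVec a) := by
  set U := hA.eigenvectorUnitary
  refine ⟨Matrix.UnitaryGroup.toLinearEquiv (star U), fun a => ?_⟩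
  have hT : ∀ a, Matrix.UnitaryGroup.toLinearEquiv (star U) a
      = Matrix.mulVec (star (U : Matrix B B ℝ)) a := fun a => rfl
  rw [hT]
  have hsp := hA.spectral_theorem
  rw [Unitary.conjStarAlgAut_apply] at hsp
  conv_rhs => rw [hsp]
  rw [← Matrix.mulVec_mulVec, ← Matrix.mulVec_mulVec, Matrix.dotProduct_mulVec]
  have h1 : Matrix.vecMul a (U : Matrix B B ℝ) = Matrix.mulVec (star (U : Matrix B B ℝ)) a := by
    rw [Matrix.star_eq_conjTranspose, Matrix.conjTranspose_eq_transpose_of_trivial,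
      Matrix.mulVec_transpose]
  rw [h1, dotProduct]
  refine Finset.sum_congr rfl fun b _ => ?_
  rw [Matrix.mulVec_diagonal]
  simp only [Function.comp_apply, RCLike.ofReal_real_eq_id, id]
  ring

end spectral

section realpt
open ComplexConjugate
variable {m s D t : ℕ}

lemma eval_conj (z : Fin m → ℂ) (p : MvPolynomial (Fin m) ℝ) :
    eval (fun k => conj (z k)) (map Complex.ofRealHom p) = conj (eval z (map Complex.ofRealHom p)) := by
  induction p using MvPolynomial.induction_on with
  | C a => simp
  | add p q hp hq => simp only [map_add, hp, hq]
  | mul_X p k hp => simp only [map_mul, map_X, eval_X, hp]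

lemma eval_mon_conj (z : Fin m → ℂ) (b : Fin m →₀ ℕ) :
    eval (fun k => conj (z k)) (monomial b (1 : ℂ)) = conj (eval z (monomial b 1)) := by
  have := eval_conj z (monomial b 1)
  rwa [map_monomial, map_one] at this

lemma eval_ofReal (x : Fin m → ℝ) (p : MvPolynomial (Fin m) ℝ) :
    eval (fun k => (x k : ℂ)) (map Complex.ofRealHom p) = ((eval x p : ℝ) : ℂ) := by
  induction p using MvPolynomial.induction_on with
  | C a => simp
  | add p q hp hq => simp only [map_add, hp, hq, Complex.ofReal_add]
  | mul_X p k hp => simp only [map_mul, map_X, eval_X, hp, Complex.ofReal_mul]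

def RealPt (D : ℕ) (F : Fin s → MvPolynomial (Fin m) (MvPolynomial (Fin t) ℚ)) (y : Fin t → ℝ) :
    Prop := ∃ x : Fin m → ℝ, ∀ g, eval x (Gy D F y g) = 0

variable {F : Fin s → MvPolynomial (Fin m) (MvPolynomial (Fin t) ℚ)} {y : Fin t → ℝ}
  {Z : Finset (Fin m → ℂ)}

def cj (hZ : ∀ z, z ∈ Z ↔ ∀ g, eval z (map Complex.ofRealHom (Gy D F y g)) = 0) (z : Z) : Z :=
  ⟨fun k => conj (z.1 k), by
    rw [hZ]; intro g
    rw [eval_conj, (hZ z.1).1 z.2 g, map_zero]⟩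

lemma cj_cj (hZ : ∀ z, z ∈ Z ↔ ∀ g, eval z (map Complex.ofRealHom (Gy D F y g)) = 0) (z : Z) :
    cj hZ (cj hZ z) = z := by
  apply Subtype.ext; funext k; simp [cj]

lemma cj_fixed (hZ : ∀ z, z ∈ Z ↔ ∀ g, eval z (map Complex.ofRealHom (Gy D F y g)) = 0) :
    (∃ z : Z, cj hZ z = z) ↔ RealPt D F y := by
  constructor
  · rintro ⟨z, hz⟩
    have h1 : ∀ k, ((z.1 k).re : ℂ) = z.1 k := by
      intro k
      have := congrFun (congrArg Subtype.val hz) k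
      exact Complex.conj_eq_iff_re.1 this
    refine ⟨fun k => (z.1 k).re, fun g => ?_⟩
    apply Complex.ofReal_injective
    rw [← eval_ofReal]
    simp only [h1]
    rw [(hZ z.1).1 z.2 g]; simp
  · rintro ⟨x, hx⟩
    refine ⟨⟨fun k => (x k : ℂ), ?_⟩, ?_⟩
    · rw [hZ]; intro g; rw [eval_ofReal, hx]; simp
    · apply Subtype.ext; funext k; simp [cj]

/-- The (parametric) Hermite matrix. -/
def Hm (m s D : ℕ) (T : (Fin m →₀ ℕ) → MvPolynomial (Fin t) ℚ) :
    Matrix (BB m s D) (BB m s D) (MvPolynomial (Fin t) ℚ) :=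
  Matrix.of fun b b' => T (b.1 + b'.1)

lemma Hm_herm (T : (Fin m →₀ ℕ) → MvPolynomial (Fin t) ℚ) (y : Fin t → ℝ) :
    ((Hm m s D T).map (evR y)).IsHermitian := by
  apply Matrix.IsHermitian.ext
  intro i j
  simp [Hm, add_comm]

open Classical in
def eigs (m s D : ℕ) (T : (Fin m →₀ ℕ) → MvPolynomial (Fin t) ℚ) (y : Fin t → ℝ) :
    BB m s D → ℝ := (Hm_herm (m := m) (s := s) (D := D) T y).eigenvalues

lemma eigs_quad (T : (Fin m →₀ ℕ) → MvPolynomial (Fin t) ℚ) (y : Fin t → ℝ) :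
    ∃ Q : (BB m s D → ℝ) ≃ₗ[ℝ] (BB m s D → ℝ), ∀ a, ∑ b, eigs m s D T y b * (Q a b) ^ 2 =
      a ⬝ᵥ (((Hm m s D T).map (evR y)).mulVec a) := by
  classical
  exact spectral_quad _ (Hm_herm (m := m) (s := s) (D := D) T y)

open Classical in
lemma eigs_charpoly (T : (Fin m →₀ ℕ) → MvPolynomial (Fin t) ℚ) (y : Fin t → ℝ) :
    ((Hm m s D T).map (evR y)).charpoly =
      ∏ b, (Polynomial.X - Polynomial.C (eigs m s D T y b)) :=
  (Hm_herm (m := m) (s := s) (D := D) T y).charpoly_eq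

lemma surj_sub (h : ∀ h : (Fin m → ℂ) → ℂ, ∃ c : (Fin m →₀ ℕ) → ℂ, ∀ z ∈ Z,
          h z = ∑ b ∈ BB m s D, c b * eval z (monomial b 1)) (f : Z → ℂ) :
    ∃ c : BB m s D → ℂ, ∀ i : Z, f i = ∑ b : BB m s D, c b * eval i.1 (monomial b.1 1) := by
  classical
  obtain ⟨c, hc⟩ := h (fun z => if hz : z ∈ Z then f ⟨z, hz⟩ else 0)
  refine ⟨fun b => c b.1, fun i => ?_⟩
  have := hc i.1 i.2
  rw [dif_pos i.2] at this
  rw [this, ← Finset.sum_coe_sort]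

lemma quad_expand {ι B : Type*} [Fintype ι] [Fintype B] (w : ι → ℂ) (e : B → ι → ℂ)
    (H : B → B → ℂ) (hH : ∀ b b', H b b' = ∑ i, w i * (e b i * e b' i)) (a : B → ℂ) :
    ∑ b, a b * ∑ b', H b b' * a b' = ∑ i, w i * (∑ b, a b * e b i) ^ 2 := by
  have h1 : ∀ i, w i * (∑ b, a b * e b i) ^ 2 =
      ∑ b, ∑ b', a b * (w i * (e b i * e b' i) * a b') := by
    intro i
    rw [sq, Finset.sum_mul, Finset.mul_sum]
    refine Finset.sum_congr rfl fun b _ => ?_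
    rw [Finset.mul_sum, Finset.mul_sum]
    refine Finset.sum_congr rfl fun b' _ => ?_
    ring
  rw [Finset.sum_congr rfl fun i _ => h1 i, Finset.sum_comm]
  refine Finset.sum_congr rfl fun b _ => ?_
  rw [Finset.sum_comm, Finset.mul_sum]
  refine Finset.sum_congr rfl fun b' _ => ?_
  rw [hH, Finset.sum_mul, Finset.mul_sum]

lemma eigs_EE {T : (Fin m →₀ ℕ) → MvPolynomial (Fin t) ℚ}
    {μ : (Fin m → ℂ) → ℕ}
    (hT : ∀ γ, ((aeval y (T γ) : ℝ) : ℂ) = ∑ z ∈ Z, (μ z : ℂ) * eval z (monomial γ 1)) :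
    ∃ Q : (BB m s D → ℝ) ≃ₗ[ℝ] (BB m s D → ℝ), ∀ a : BB m s D → ℝ,
      ((∑ b, eigs m s D T y b * (Q a b) ^ 2 : ℝ) : ℂ) =
      ∑ i : Z, (((μ i.1 : ℕ) : ℝ) : ℂ) *
        (EE (fun (b : BB m s D) (z : Z) => eval z.1 (monomial b.1 (1 : ℂ))) a i) ^ 2 := by
  obtain ⟨Q, hQ⟩ := eigs_quad (m := m) (s := s) (D := D) T y
  refine ⟨Q, fun a => ?_⟩
  rw [hQ]
  simp only [dotProduct, Matrix.mulVec, Complex.ofReal_sum, Complex.ofReal_mul, EE_apply]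
  refine quad_expand (ι := Z) (B := BB m s D) (fun i => (((μ i.1 : ℕ) : ℝ) : ℂ))
    (fun b z => eval z.1 (monomial b.1 (1 : ℂ)))
    (fun b b' => (((Hm m s D T).map (evR y) b b' : ℝ) : ℂ)) ?_ (fun b => (a b : ℂ))
  intro b b'
  have h2 : (Hm m s D T).map (evR y) b b' = aeval y (T (b.1 + b'.1)) := rfl
  rw [h2, hT, ← Finset.sum_coe_sort Z]
  refine Finset.sum_congr rfl fun z _ => ?_
  rw [← one_mul (1 : ℂ), ← monomial_mul, map_mul, one_mul, Complex.ofReal_natCast]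

theorem realPt_iff {T : (Fin m →₀ ℕ) → MvPolynomial (Fin t) ℚ}
    {μ : (Fin m → ℂ) → ℕ}
    (hZ : ∀ z, z ∈ Z ↔ ∀ g, eval z (map Complex.ofRealHom (Gy D F y g)) = 0)
    (hμ : ∀ z ∈ Z, 0 < μ z)
    (hT : ∀ γ, ((aeval y (T γ) : ℝ) : ℂ) = ∑ z ∈ Z, (μ z : ℂ) * eval z (monomial γ 1))
    (hsurj : ∀ h : (Fin m → ℂ) → ℂ, ∃ c : (Fin m →₀ ℕ) → ℂ, ∀ z ∈ Z,
          h z = ∑ b ∈ BB m s D, c b * eval z (monomial b 1)) :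
    RealPt D F y ↔ (Finset.univ.filter fun b => eigs m s D T y b < 0).card <
      (Finset.univ.filter fun b => 0 < eigs m s D T y b).card := by
  obtain ⟨Q, hQ⟩ := eigs_EE (s := s) (D := D) hT
  rw [← cj_fixed hZ]
  have hμ' : ∀ z : Z, (0 : ℝ) < ((μ z.1 : ℕ) : ℝ) := fun z => Nat.cast_pos.2 (hμ z.1 z.2)
  have hev : ∀ (b : BB m s D) (z : Z), eval (cj hZ z).1 (monomial b.1 (1 : ℂ)) =
    conj (eval z.1 (monomial b.1 (1 : ℂ))) := fun b z => eval_mon_conj _ _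
  exact hermite (ι := Z) (B := BB m s D) (cj hZ) (cj_cj hZ) (fun z => ((μ z.1 : ℕ) : ℝ)) hμ'
    (fun b z => eval z.1 (monomial b.1 (1 : ℂ))) hev (surj_sub hsurj) (eigs m s D T y) Q hQ

lemma det_coeff_deg {B : Type*} [Fintype B] [DecidableEq B] {d : ℕ}
    (A : Matrix B B (Polynomial (MvPolynomial (Fin t) ℚ)))
    (hA : ∀ i j k, ((A i j).coeff k).totalDegree ≤ d) (k : ℕ) :
    (A.det.coeff k).totalDegree ≤ Fintype.card B * d := by
  have hprod : ∀ (S : Finset B) (f : B → B) (k : ℕ),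
      ((∏ i ∈ S, A (f i) i).coeff k).totalDegree ≤ S.card * d := by
    intro S f
    induction S using Finset.induction_on with
    | empty =>
      intro k
      rw [Finset.prod_empty, Polynomial.coeff_one]; split_ifs <;> simp
    | insert a S ha ih =>
      intro k
      rw [Finset.prod_insert ha, Polynomial.coeff_mul, Finset.card_insert_of_notMem ha]
      refine totalDegree_finsetSum_le fun x _ => ?_
      refine (totalDegree_mul _ _).trans ?_
      have h1 := hA (f a) a x.1
      have h2 := ih x.2
      rw [add_mul]; lia
  rw [Matrix.det_apply, Polynomial.finsetSum_coeff]
  refine totalDegree_finsetSum_le fun σ _ => ?_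
  have := hprod Finset.univ σ k
  rw [Finset.card_univ] at this
  refine le_trans ?_ this
  rcases Int.units_eq_one_or (Equiv.Perm.sign σ) with h | h
  · rw [h, one_smul]
  · rw [h, Units.neg_smul, one_smul, Polynomial.coeff_neg, totalDegree_neg]

open Classical in
lemma charpoly_deg (T : (Fin m →₀ ℕ) → MvPolynomial (Fin t) ℚ)
    (hT : ∀ γ, (T γ).totalDegree ≤ γ.degree) (k : ℕ) :
    ((Hm m s D T).charpoly.coeff k).totalDegree ≤ (BB m s D).card * (2 * MM m s D) := by
  have := det_coeff_deg (d := 2 * MM m s D) (Hm m s D T).charmatrix (by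
    intro i j k
    rw [Matrix.charmatrix_apply, Polynomial.coeff_sub]
    refine (totalDegree_sub _ _).trans (max_le ?_ ?_)
    · rw [Matrix.diagonal_apply]
      split_ifs
      · rw [Polynomial.coeff_X]; split_ifs <;> simp
      · simp
    · rw [Polynomial.coeff_C]
      split_ifs
      · have h1 := hT (i.1 + j.1)
        have h2 := BB_deg i.2
        have h3 := BB_deg j.2
        rw [map_add] at h1
        change (T (i.1 + j.1)).totalDegree ≤ _
        lia
      · simp) k
  rwa [Fintype.card_coe] at this

/-- For the parametric system, finitely many polynomials whose signs determine the existence of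
real points. -/
theorem sign_polys (hD : 1 ≤ D) (hs : s ≤ m)
    (hF : ∀ i, F i ∈ Fil (tdeg t) m D)
    (hspan : ∀ γ : Fin m →₀ ℕ, InN (tdeg t) D (BB m s D) F γ.degree (monomial γ 1)) :
    ∃ (N : ℕ) (P : Fin N → MvPolynomial (Fin t) ℚ),
      (∀ k, (P k).totalDegree ≤ N0 m s D * (2 * MM m s D)) ∧
      ∀ y y' : Fin t → ℝ,
        (∀ k, SignType.sign (aeval y (P k) : ℝ) = SignType.sign (aeval y' (P k) : ℝ)) →
          (RealPt D F y ↔ RealPt D F y') := by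
  classical
  obtain ⟨T, hT1, hT2⟩ := fibre hD hs F hF hspan
  have hcard := card_BB (m := m) (s := s) hD hs
  refine ⟨(BB m s D).card + 1, fun k => (Hm m s D T).charpoly.coeff k, fun k => ?_, ?_⟩
  · exact (charpoly_deg T hT1 k).trans (Nat.mul_le_mul_right _ hcard)
  intro y y' hyy
  obtain ⟨Z, μ, h1, h2, -, h4, h5⟩ := hT2 y
  obtain ⟨Z', μ', h1', h2', -, h4', h5'⟩ := hT2 y'
  rw [realPt_iff h1 h2 h4 h5, realPt_iff h1' h2' h4' h5']
  have hcp : ∀ y : Fin t → ℝ, ∀ k, ((Hm m s D T).map (evR y)).charpoly.coeff k =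
      aeval y ((Hm m s D T).charpoly.coeff k) := by
    intro y k
    rw [Matrix.charpoly_map, Polynomial.coeff_map]; rfl
  have := sign_det rfl _ _ _ _ (eigs_charpoly (m := m) (s := s) (D := D) T y)
    (eigs_charpoly (m := m) (s := s) (D := D) T y') (by
      intro k
      by_cases hk : k < (BB m s D).card + 1
      · rw [hcp, hcp]; exact hyy ⟨k, hk⟩
      · have hz : ∀ y : Fin t → ℝ, ((Hm m s D T).map (evR y)).charpoly.coeff k = 0 := by
          intro y
          apply Polynomial.coeff_eq_zero_of_natDegree_lt
          rw [Matrix.charpoly_natDegree_eq_dim, Fintype.card_coe]; lia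
        rw [hz, hz])
  rw [this.1, this.2]

/-- In the odd case there is always a real point. -/
theorem odd_real (hD : 1 ≤ D) (hs : s ≤ m)
    (hF : ∀ i, F i ∈ Fil (tdeg t) m D)
    (hspan : ∀ γ : Fin m →₀ ℕ, InN (tdeg t) D (BB m s D) F γ.degree (monomial γ 1))
    (hodd : Odd (N0 m s D)) (y : Fin t → ℝ) : RealPt D F y := by
  classical
  obtain ⟨T, hT1, hT2⟩ := fibre hD hs F hF hspan
  obtain ⟨Z, μ, h1, h2, h3, h4, h5⟩ := hT2 y
  rw [← cj_fixed h1]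
  refine odd_fixed (cj h1) (cj_cj h1) (fun z => μ z.1)
    (fun (b : BB m s D) z => eval z.1 (monomial b.1 1)) (fun b z => eval_mon_conj _ _)
    (surj_sub h5) (fun b => ⟨aeval y (T b.1), ?_⟩) ?_
  · rw [h4, ← Finset.sum_coe_sort]
  · rwa [Finset.sum_coe_sort Z μ, h3]

end realpt
end HP

namespace HP

section form
variable {t : ℕ}

def bigConj : List (SAForm t) → SAForm t
  | [] => SAForm.eq 0
  | φ :: L => SAForm.conj φ (bigConj L)

def bigDisj : List (SAForm t) → SAForm t
  | [] => SAForm.ne 0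
  | φ :: L => SAForm.disj φ (bigDisj L)

lemma bigConj_holds (L : List (SAForm t)) (y : Fin t → ℝ) :
    (bigConj L).holds y ↔ ∀ φ ∈ L, φ.holds y := by
  induction L with
  | nil => simp [bigConj, SAForm.holds]
  | cons φ L ih => simp [bigConj, SAForm.holds, ih]

lemma bigDisj_holds (L : List (SAForm t)) (y : Fin t → ℝ) :
    (bigDisj L).holds y ↔ ∃ φ ∈ L, φ.holds y := by
  induction L with
  | nil => simp [bigDisj, SAForm.holds]
  | cons φ L ih => simp [bigDisj, SAForm.holds, ih]

lemma bigConj_deg (L : List (SAForm t)) (d : ℕ) (h : ∀ φ ∈ L, φ.deg ≤ d) :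
    (bigConj L).deg ≤ d := by
  induction L with
  | nil => simp [bigConj, SAForm.deg]
  | cons φ L ih =>
    simp only [List.mem_cons, forall_eq_or_imp] at h
    exact max_le h.1 (ih h.2)

lemma bigDisj_deg (L : List (SAForm t)) (d : ℕ) (h : ∀ φ ∈ L, φ.deg ≤ d) :
    (bigDisj L).deg ≤ d := by
  induction L with
  | nil => simp [bigDisj, SAForm.deg]
  | cons φ L ih =>
    simp only [List.mem_cons, forall_eq_or_imp] at h
    exact max_le h.1 (ih h.2)

lemma cont_aeval (p : MvPolynomial (Fin t) ℚ) : Continuous fun y : Fin t → ℝ => aeval y p := by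
  have : (fun y : Fin t → ℝ => aeval y p) = fun y => eval y (map (algebraMap ℚ ℝ) p) := by
    funext y; rw [eval_map, aeval_def]
  rw [this]; exact MvPolynomial.continuous_eval _

lemma exists_nonvanish (Q : MvPolynomial (Fin t) ℚ) (hQ : Q ≠ 0) (U : Set (Fin t → ℝ))
    (hU : IsOpen U) (hne : U.Nonempty) : ∃ y ∈ U, (aeval y Q : ℝ) ≠ 0 := by
  by_contra! hcon
  obtain ⟨y, hy⟩ := hne
  obtain ⟨ε, hε, hb⟩ := Metric.isOpen_iff.1 hU y hy
  apply hQ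
  apply MvPolynomial.map_injective (algebraMap ℚ ℝ) (algebraMap ℚ ℝ).injective
  rw [map_zero]
  refine MvPolynomial.funext_set (fun i => Metric.ball (y i) ε) (fun i => ?_) ?_
  · rw [Real.ball_eq_Ioo]
    exact Set.Ioo_infinite (by linarith)
  · intro x hx
    have hxU : x ∈ U := by
      apply hb
      rw [Metric.mem_ball, dist_pi_lt_iff hε]
      intro i
      exact hx i (Set.mem_univ i)
    have := hcon x hxU
    rw [aeval_def, ← eval_map] at this
    simp [this]

open Classical in
lemma exists_form {N d : ℕ} (P : Fin N → MvPolynomial (Fin t) ℚ)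
    (hd : ∀ k, (P k).totalDegree ≤ d) (A : Set (Fin t → ℝ))
    (hA : ∀ y y' : Fin t → ℝ,
      (∀ k, SignType.sign (aeval y (P k) : ℝ) = SignType.sign (aeval y' (P k) : ℝ)) →
        (y ∈ A ↔ y' ∈ A)) :
    ∃ Φ : SAForm t, Φ.deg ≤ d ∧ Φ.zset ⊆ interior A ∧ interior A ⊆ closure Φ.zset := by
  let atom : Fin N → Bool → SAForm t := fun k b =>
    if P k = 0 then SAForm.eq 0 else if b then SAForm.pos (P k) else SAForm.pos (-P k)
  let pat : (Fin N → Bool) → SAForm t := fun e => bigConj (List.ofFn fun k => atom k (e k))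
  let good : (Fin N → Bool) → Prop := fun e => ∃ y ∈ A, (pat e).holds y
  let Φ : SAForm t := bigDisj ((Finset.univ.filter good).toList.map pat)
  have hpat : ∀ e y, (pat e).holds y ↔ ∀ k, (atom k (e k)).holds y := by
    intro e y
    simp [pat, bigConj_holds, List.mem_ofFn]
  have hatom : ∀ k b y, (atom k b).holds y ↔
      (P k = 0 ∨ if b then (0 : ℝ) < aeval y (P k) else (aeval y (P k) : ℝ) < 0) := by
    intro k b y
    by_cases h : P k = 0
    · simp [atom, h, SAForm.holds]
    · cases b <;> simp [atom, h, SAForm.holds]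
  have hΦ : ∀ y, Φ.holds y ↔ ∃ e, good e ∧ (pat e).holds y := by
    intro y
    simp [Φ, bigDisj_holds]
  have hsign : ∀ e y y', (pat e).holds y → (pat e).holds y' →
      ∀ k, SignType.sign (aeval y (P k) : ℝ) = SignType.sign (aeval y' (P k) : ℝ) := by
    intro e y y' h h' k
    have h1 := (hatom k (e k) y).1 ((hpat e y).1 h k)
    have h2 := (hatom k (e k) y').1 ((hpat e y').1 h' k)
    by_cases h0 : P k = 0
    · simp [h0]
    · simp only [h0, false_or] at h1 h2
      cases hb : e k
      · simp only [hb, Bool.false_eq_true, if_false] at h1 h2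
        rw [sign_neg h1, sign_neg h2]
      · simp only [hb, if_true] at h1 h2
        rw [sign_pos h1, sign_pos h2]
  have hopen : IsOpen Φ.zset := by
    have : Φ.zset = ⋃ e ∈ {e | good e}, ⋂ k, {y | (atom k (e k)).holds y} := by
      ext y
      simp only [SAForm.zset, Set.mem_iUnion, Set.mem_iInter]
      refine (hΦ y).trans ?_
      constructor
      · rintro ⟨e, he, h⟩; exact ⟨e, he, fun k => (hpat e y).1 h k⟩
      · rintro ⟨e, he, h⟩; exact ⟨e, he, (hpat e y).2 h⟩
    rw [this]
    refine isOpen_biUnion fun e _ => isOpen_iInter_of_finite fun k => ?_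
    by_cases h : P k = 0
    · simp [atom, h, SAForm.holds]
    · cases hb : e k
      · simp only [hatom, h, false_or, Bool.false_eq_true, if_false]
        exact isOpen_lt (cont_aeval _) continuous_const
      · simp only [hatom, h, false_or, if_true]
        exact isOpen_lt continuous_const (cont_aeval _)
  refine ⟨Φ, ?_, ?_, ?_⟩
  · apply bigDisj_deg
    intro φ hφ
    obtain ⟨e, -, rfl⟩ := List.mem_map.1 hφ
    apply bigConj_deg
    intro φ hφ
    obtain ⟨k, rfl⟩ := (List.mem_ofFn' _ _).1 hφ
    by_cases h : P k = 0
    · simp [atom, h, SAForm.deg]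
    · cases hb : e k
      · simpa [atom, h, hb, SAForm.deg, totalDegree_neg] using hd k
      · simpa [atom, h, hb, SAForm.deg] using hd k
  · apply interior_maximal _ hopen
    intro y hy
    obtain ⟨e, ⟨y', hy', he'⟩, he⟩ := (hΦ y).1 hy
    exact (hA y y' (hsign e y y' he he')).2 hy'
  · intro y hy
    rw [mem_closure_iff]
    intro U hU hyU
    obtain ⟨x, ⟨hxU, hxA⟩, hx⟩ := exists_nonvanish
      (∏ k ∈ Finset.univ.filter (fun k => P k ≠ 0), P k)
      (Finset.prod_ne_zero_iff.2 fun k hk => (Finset.mem_filter.1 hk).2)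
      (U ∩ interior A) (hU.inter isOpen_interior) ⟨y, hyU, hy⟩
    refine ⟨x, hxU, (hΦ x).2 ⟨fun k => decide ((0 : ℝ) < aeval x (P k)), ?_⟩⟩
    have hp : (pat fun k => decide ((0 : ℝ) < aeval x (P k))).holds x := by
      rw [hpat]; intro k
      rw [hatom]
      by_cases h : P k = 0
      · exact Or.inl h
      · right
        rw [map_prod, Finset.prod_ne_zero_iff] at hx
        have h1 : (aeval x (P k) : ℝ) ≠ 0 := hx k (by simp [h])
        by_cases h2 : (0 : ℝ) < aeval x (P k)
        · simp [h2]
        · simp only [h2, decide_false, Bool.false_eq_true, if_false]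
          exact lt_of_le_of_ne (not_lt.1 h2) h1
    exact ⟨⟨x, interior_subset hxA, hp⟩, hp⟩

end form

end HP

namespace HP

section crit
variable {m s : ℕ}

lemma strict_eval (p : MvPolynomial (Fin m) ℝ) (x : Fin m → ℝ) :
    HasStrictFDerivAt (fun x : Fin m → ℝ => eval x p)
      (∑ j, eval x (pderiv j p) • (ContinuousLinearMap.proj (R := ℝ) (φ := fun _ : Fin m => ℝ) j)) x := by
  induction p using MvPolynomial.induction_on with
  | C a => simpa using hasStrictFDerivAt_const a x
  | add p q hp hq =>
    simp only [map_add, add_smul, Finset.sum_add_distrib]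
    exact hp.add hq
  | mul_X p i hp =>
    have h2 : HasStrictFDerivAt (fun x : Fin m → ℝ => x i)
      (ContinuousLinearMap.proj (R := ℝ) (φ := fun _ : Fin m => ℝ) i) x :=
      (ContinuousLinearMap.proj (R := ℝ) (φ := fun _ : Fin m => ℝ) i).hasStrictFDerivAt
    have h := hp.mul h2
    simp only [map_mul, eval_X]
    refine h.congr_fderiv ?_
    ext v
    simp only [ContinuousLinearMap.add_apply, ContinuousLinearMap.smul_apply,
      ContinuousLinearMap.sum_apply, ContinuousLinearMap.proj_apply, smul_eq_mul,
      Derivation.leibniz, map_add, map_mul, eval_X, pderiv_X, Pi.single_apply]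
    simp only [add_mul, Finset.sum_add_distrib]
    congr 1
    · rw [Finset.sum_eq_single i]
      · simp
      · intro j _ hj; simp [hj.symm]
      · simp
    · rw [Finset.mul_sum]
      exact Finset.sum_congr rfl fun j _ => by ring

lemma phi_eval (D : ℕ) (x : Fin m → ℝ) :
    eval x (phi m ℝ D) = ∑ j, (x j ^ D - ((D - 1 : ℕ) : ℝ) * x j) := by
  simp [phi]

lemma one_var {D : ℕ} (h2 : Even D) (hD : 1 ≤ D) (u : ℝ) (c : ℝ) :
    u ^ 2 / 2 ≤ u ^ D - c * u + (1 + c ^ 2 / 2) := by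
  obtain ⟨k, rfl⟩ := h2
  have hk : k ≠ 0 := by omega
  have h : u ^ 2 - 1 ≤ u ^ (k + k) := by
    rw [← two_mul, pow_mul]
    by_cases h1 : 1 ≤ u ^ 2
    · have := le_self_pow₀ h1 hk
      linarith
    · have : 0 ≤ (u ^ 2) ^ k := by positivity
      linarith
  nlinarith [sq_nonneg (u - c)]

lemma exists_min {D : ℕ} (h2 : Even D) (hD : 1 ≤ D) (S : Set (Fin m → ℝ)) (hS : IsClosed S)
    (hne : S.Nonempty) : ∃ x ∈ S, IsMinOn (fun x => eval x (phi m ℝ D)) S x := by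
  obtain ⟨x0, hx0⟩ := hne
  set c : ℝ := ((D - 1 : ℕ) : ℝ)
  set K : ℝ := 1 + c ^ 2 / 2 with hK
  set v := eval x0 (phi m ℝ D)
  have hcont : Continuous fun x : Fin m → ℝ => eval x (phi m ℝ D) := MvPolynomial.continuous_eval _
  have hbound : ∀ x : Fin m → ℝ, eval x (phi m ℝ D) ≤ v → ∀ j, (x j) ^ 2 / 2 ≤ v + m * K := by
    intro x hx j
    have h1 : ∑ j, (x j) ^ 2 / 2 ≤ eval x (phi m ℝ D) + m * K := by
      rw [phi_eval]
      have : (m : ℝ) * K = ∑ _j : Fin m, K := by simp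
      rw [this, ← Finset.sum_add_distrib]
      exact Finset.sum_le_sum fun j _ => one_var h2 hD (x j) c
    have h3 : (x j) ^ 2 / 2 ≤ ∑ j, (x j) ^ 2 / 2 :=
      Finset.single_le_sum (f := fun j => (x j) ^ 2 / 2) (fun j _ => by positivity)
        (Finset.mem_univ j)
    linarith
  have hcomp : IsCompact (S ∩ {x | eval x (phi m ℝ D) ≤ v}) := by
    refine Metric.isCompact_of_isClosed_isBounded
      (hS.inter (isClosed_le hcont continuous_const)) ?_
    refine (Metric.isBounded_iff_subset_closedBall 0).2 ⟨|v + m * K| * 2 + 1, ?_⟩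
    rintro x ⟨-, hx⟩
    rw [mem_closedBall_zero_iff, pi_norm_le_iff_of_nonneg (by positivity)]
    intro j
    have := hbound x hx j
    have h5 := le_abs_self (v + m * K)
    rw [Real.norm_eq_abs]
    refine abs_le_of_sq_le_sq ?_ (by positivity)
    nlinarith [abs_nonneg (v + m * K)]
  obtain ⟨x, ⟨hxS, hxv⟩, hmin⟩ := hcomp.exists_isMinOn ⟨x0, hx0, le_refl v⟩ hcont.continuousOn
  refine ⟨x, hxS, fun z hz => ?_⟩
  by_cases h : eval z (phi m ℝ D) ≤ v
  · exact hmin ⟨hz, h⟩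
  · exact le_trans hxv (not_le.1 h).le

lemma exists_crit {D : ℕ} (h2 : Even D) (hD : 1 ≤ D) (F : Fin s → MvPolynomial (Fin m) ℝ)
    (hne : ∃ x, ∀ i, eval x (F i) = 0) : ∃ x, ∀ g, eval x (gen D F g) = 0 := by
  obtain ⟨x, hx, hmin⟩ := exists_min h2 hD {x : Fin m → ℝ | ∀ i, eval x (F i) = 0}
    (by
      have : {x : Fin m → ℝ | ∀ i, eval x (F i) = 0} = ⋂ i, {x | eval x (F i) = 0} := by
        ext; simp
      rw [this]
      exact isClosed_iInter fun i =>
        isClosed_eq (MvPolynomial.continuous_eval _) continuous_const) hne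
  have hx' : ∀ i, eval x (F i) = 0 := hx
  have hext : IsLocalExtrOn (fun x => eval x (phi m ℝ D))
      {z | ∀ i, eval z (F i) = eval x (F i)} x := by
    simp only [hx']
    exact hmin.localize.isExtr
  obtain ⟨L, L0, h0, hsum⟩ := hext.exists_multipliers_of_hasStrictFDerivAt
    (fun i => strict_eval (F i) x) (strict_eval (phi m ℝ D) x)
  refine ⟨x, gen_lagr D x F hx' (Fin.cons L0 L) ?_ ?_⟩
  · intro h
    apply h0
    have h3 : L0 = 0 := congrFun h 0
    have h4 : L = 0 := by funext i; exact congrFun h i.succ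
    rw [h3, h4]; rfl
  · intro j
    have := congrArg (fun T : StrongDual ℝ (Fin m → ℝ) => T (Pi.single j 1)) hsum
    simp [Pi.single_apply] at this
    rw [Fin.sum_univ_succ]
    simp only [Fin.cons_zero, Fin.cons_succ]
    linarith

end crit

section psi
variable {n t m : ℕ}

/-- Extend by zero. -/
def ext0 (n : ℕ) (x : Fin m → ℝ) : Fin n → ℝ :=
  fun j => eval x (keepX n m ℝ j)

lemma Psi_eval (y : Fin t → ℝ) (x : Fin m → ℝ) (f : MvPolynomial (Fin n ⊕ Fin t) ℚ) :
    eval x (map (evR y) (Psi n t m f)) = aeval (Sum.elim (ext0 n x) y) f := by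
  have h : ((eval x).comp ((map (evR y)).comp (Psi n t m).toRingHom)) =
      (aeval (Sum.elim (ext0 n x) y) : _ →ₐ[ℚ] ℝ).toRingHom := by
    apply MvPolynomial.ringHom_ext
    · intro a
      exact (RingHom.congr_fun (Subsingleton.elim
        (((eval x).comp ((map (evR y)).comp (Psi n t m).toRingHom)).comp C)
        ((aeval (Sum.elim (ext0 n x) y) : _ →ₐ[ℚ] ℝ).toRingHom.comp C)) a)
    · rintro (j | l)
      · simp [Psi, keepX_map, ext0]
      · simp [Psi, evR_apply]
  exact RingHom.congr_fun h f

lemma ext0_self (x : Fin n → ℝ) : ext0 n x = x := by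
  funext j; simp [ext0, keepX]

lemma proj_of_realPt {s D : ℕ} (f : Fin s → MvPolynomial (Fin n ⊕ Fin t) ℚ) (y : Fin t → ℝ)
    (h : RealPt D (fun i => Psi n t m (f i)) y) : y ∈ projY '' realPts f := by
  obtain ⟨x, hx⟩ := h
  refine ⟨Sum.elim (ext0 n x) y, fun i => ?_, by funext l; rfl⟩
  have := hx (Sum.inl i)
  rw [← Psi_eval]
  exact this

lemma proj_iff {s D : ℕ} (h2 : Even D) (hD : 1 ≤ D) (f : Fin s → MvPolynomial (Fin n ⊕ Fin t) ℚ)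
    (y : Fin t → ℝ) :
    y ∈ projY '' realPts f ↔ RealPt D (fun i => Psi n t n (f i)) y := by
  refine ⟨?_, proj_of_realPt f y⟩
  rintro ⟨z, hz, rfl⟩
  refine exists_crit h2 hD _ ⟨z ∘ Sum.inl, fun i => ?_⟩
  rw [Psi_eval, ext0_self]
  have : Sum.elim (z ∘ Sum.inl) (projY z) = z := by
    funext a; rcases a with a | a <;> rfl
  rw [this]
  exact hz i

end psi

end HP

open HP in
theorem statement_0 (n t s D : ℕ) (hD : 1 ≤ D) (hs : s ≤ n) :
    ∃ 𝓕 : Set (Fin s → MvPolynomial (Fin n ⊕ Fin t) ℂ),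
      IsZariskiOpenTuple s D 𝓕 ∧ 𝓕.Nonempty ∧
      ∀ f : Fin s → MvPolynomial (Fin n ⊕ Fin t) ℚ,
        (fun i => toC (f i)) ∈ 𝓕 →
        ∃ Φ : SAForm t,
          Φ.deg ≤ 2 * (n + s) * D ^ s * (D - 1) ^ (n - s + 1) * Nat.choose n s ∧
          Φ.zset ⊆ interior (projY '' realPts f) ∧
          interior (projY '' realPts f) ⊆ closure Φ.zset := by
  have key : ∀ m, s ≤ m → m ≤ n → ∃ 𝓕 : Set (Fin s → MvPolynomial (Fin n ⊕ Fin t) ℂ),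
      IsZariskiOpenTuple s D 𝓕 ∧ 𝓕.Nonempty ∧
      ∀ f : Fin s → MvPolynomial (Fin n ⊕ Fin t) ℚ,
        (fun i => toC (f i)) ∈ 𝓕 → (∀ i, (f i).totalDegree ≤ D) ∧
        ∀ γ, InN (tdeg t) D (BB m s D) (fun i => Psi n t m (f i)) γ.degree (monomial γ 1) := by
    intro m hsm hmn
    obtain ⟨P, ⟨f0, hf0, hP0⟩, hP⟩ := exists_open (t := t) hD hsm hmn
    refine ⟨_, ⟨{P}, rfl⟩, ⟨f0, hf0, P, rfl, hP0⟩, ?_⟩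
    rintro f ⟨hdeg, p, hp, hne⟩
    have hp' : p = P := hp
    subst hp'
    have hdeg' : ∀ i, (f i).totalDegree ≤ D := by
      intro i
      have h := hdeg i
      change (MvPolynomial.map (algebraMap ℚ ℂ) (f i)).totalDegree ≤ D at h
      rwa [MvPolynomial.totalDegree, MvPolynomial.support_map_of_injective _
        (algebraMap ℚ ℂ).injective] at h
    exact ⟨hdeg', hP f hdeg' hne⟩
  rcases Nat.even_or_odd D with h2 | h2
  · obtain ⟨𝓕, h1, h3, h4⟩ := key n hs le_rfl
    refine ⟨𝓕, h1, h3, fun f hf => ?_⟩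
    obtain ⟨hdeg, hspan⟩ := h4 f hf
    obtain ⟨N, P, hP1, hP2⟩ := sign_polys hD hs (fun i => Psi_Fil (f i) (hdeg i)) hspan
    obtain ⟨Φ, hΦ, h5⟩ := exists_form P hP1 (projY '' realPts f) (fun y y' h => by
      rw [proj_iff h2 hD, proj_iff h2 hD]; exact hP2 y y' h)
    refine ⟨Φ, hΦ.trans (le_of_eq ?_), h5⟩
    rw [N0, MM, pow_succ]
    ring
  · obtain ⟨𝓕, h1, h3, h4⟩ := key s le_rfl hs
    refine ⟨𝓕, h1, h3, fun f hf => ?_⟩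
    obtain ⟨hdeg, hspan⟩ := h4 f hf
    have hu : projY '' realPts f = Set.univ := by
      refine Set.eq_univ_of_forall fun y => proj_of_realPt f y
        (odd_real hD le_rfl (fun i => Psi_Fil (f i) (hdeg i)) hspan ?_ y)
      simp only [N0, Nat.sub_self, pow_zero, mul_one, Nat.choose_self]
      exact h2.pow
    have hz : (SAForm.eq (0 : MvPolynomial (Fin t) ℚ)).zset = Set.univ := by
      ext y; simp [SAForm.zset, SAForm.holds]
    refine ⟨SAForm.eq 0, by simp [SAForm.deg], ?_, ?_⟩
    · rw [hu]; simp
    · rw [hz]; simp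

end
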